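/- Let k be a nonzero integer. Suppose that for every integer J ≥ 2 and every decomposition k = d_1 + ... + d_J with each d_i a nonzero integer, the strict inequality I_k < I_{d_1} + ... + I_{d_J} holds. Then the infimum I_k is achieved: there exists φ ∈ X with d(φ) = k and ℰ(φ) = I_k. -/

import Mathlib

/- Common setting: Skyrme maps φ : ℝ³ → S³ ⊂ ℝ⁴ with weak partial derivatives. -/

open MeasureTheory Real Filter
open scoped Topology ENNReal BigOperators

noncomputable section

abbrev R3 : Type := Fin 3 → ℝ
abbrev R4 : Type := Fin 4 → ℝ

/-- Euclidean dot product on ℝ⁴. -/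
def dot (u v : R4) : ℝ := ∑ a, u a * v a

/-- Squared Euclidean norm on ℝ⁴. -/
def nsq (u : R4) : ℝ := dot u u

/-- |u∧v|² = |u|²|v|² − ⟨u,v⟩². -/
def wedgeSq (u v : R4) : ℝ := nsq u * nsq v - (dot u v) ^ 2

/-- Gram determinant of three vectors of ℝ⁴. -/
def gram (u v w : R4) : ℝ :=
  Matrix.det !![dot u u, dot u v, dot u w; dot v u, dot v v, dot v w; dot w u, dot w v, dot w w]

/-- Determinant of the 4×4 matrix with columns a, b, c, d. -/
def det4 (a b c d : R4) : ℝ := Matrix.det (Matrix.of fun i j => ![a, b, c, d] j i)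

/-- Smooth compactly supported test functions on ℝ³. -/
def IsTestFun {E : Type*} [NormedAddCommGroup E] [NormedSpace ℝ E] (ψ : R3 → E) : Prop :=
  ContDiff ℝ (⊤ : ℕ∞) ψ ∧ HasCompactSupport ψ

/-- A weakly differentiable map φ : ℝ³ → S³ ⊂ ℝ⁴ together with its weak
partial derivatives `pderiv i = ∂ᵢφ`. -/
structure SkyrmeMap where
  toFun : R3 → R4
  pderiv : Fin 3 → R3 → R4
  meas : Measurable toFun
  pderiv_locInt : ∀ i, LocallyIntegrable (pderiv i) volume
  sphere : ∀ᵐ x : R3, nsq (toFun x) = 1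
  weak : ∀ (i : Fin 3) (a : Fin 4) (ψ : R3 → ℝ), IsTestFun ψ →
    ∫ x : R3, fderiv ℝ ψ x (Pi.single i 1) * toFun x a
      = - ∫ x : R3, ψ x * pderiv i x a

/-- |∇φ|² = Σᵢ |∂ᵢφ|². -/
def gradSq (φ : SkyrmeMap) (x : R3) : ℝ := ∑ i, nsq (φ.pderiv i x)

/-- |A(φ)|² = Σᵢⱼ |∂ᵢφ∧∂ⱼφ|². -/
def ASq (φ : SkyrmeMap) (x : R3) : ℝ := ∑ i, ∑ j, wedgeSq (φ.pderiv i x) (φ.pderiv j x)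

/-- The Skyrme energy density |∇φ|² + |A(φ)|². -/
def energyDensity (φ : SkyrmeMap) (x : R3) : ℝ := gradSq φ x + ASq φ x

/-- φ ∈ X : finite Skyrme energy. -/
def memX (φ : SkyrmeMap) : Prop := Integrable (energyDensity φ) volume

/-- The Skyrme energy ℰ(φ). -/
def energy (φ : SkyrmeMap) : ℝ := ∫ x, energyDensity φ x

/-- det(φ, ∇φ)(x). -/
def detDen (φ : SkyrmeMap) (x : R3) : ℝ :=
  det4 (φ.toFun x) (φ.pderiv 0 x) (φ.pderiv 1 x) (φ.pderiv 2 x)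

/-- The topological degree d(φ) = (1/(2π²)) ∫ det(φ,∇φ). -/
def degree (φ : SkyrmeMap) : ℝ := (1 / (2 * π ^ 2)) * ∫ x, detDen φ x

/-- I_k = inf of the energy over maps of degree k. -/
def Skyrme.I (k : ℤ) : ℝ :=
  sInf {E : ℝ | ∃ φ : SkyrmeMap, memX φ ∧ degree φ = (k : ℝ) ∧ energy φ = E}

/-- The north pole P = (0,0,0,1) of S³. -/
def northPole : R4 := ![0, 0, 0, 1]

/-- The Euclidean ball B(y,r) in ℝ³. -/
def eball (y : R3) (r : ℝ) : Set R3 := {x | ∑ i, (x i - y i) ^ 2 < r ^ 2}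


section

abbrev QR (R : ℝ) : Set R3 := Metric.closedBall (0 : R3) R

abbrev pd (i : Fin 3) (ψ : R3 → ℝ) (x : R3) : ℝ := fderiv ℝ ψ x (Pi.single i 1)

def L2loc (f : R3 → ℝ) : Prop := ∀ R : ℝ, MemLp f 2 (volume.restrict (QR R))

theorem cs_int {α : Type*} [MeasurableSpace α] {μ : Measure α} {f g : α → ℝ}
    (hf : MemLp f 2 μ) (hg : MemLp g 2 μ) :
    ∫ x, |f x * g x| ∂μ ≤ √(∫ x, f x ^ 2 ∂μ) * √(∫ x, g x ^ 2 ∂μ) := by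
  have h := integral_mul_norm_le_Lp_mul_Lq (μ := μ) (f := f) (g := g) (p := 2) (q := 2)
    Real.HolderConjugate.two_two (by simpa using hf) (by simpa using hg)
  simp only [Real.norm_eq_abs, Real.rpow_two, sq_abs] at h
  simp only [abs_mul, Real.sqrt_eq_rpow]
  exact h

theorem L2loc.aesm {f : R3 → ℝ} (hf : L2loc f) : AEStronglyMeasurable f volume := by
  have h : (⋃ n : ℕ, QR n) = Set.univ := Metric.iUnion_closedBall_nat 0
  rw [← Measure.restrict_univ (μ := (volume : Measure R3)), ← h, aestronglyMeasurable_iUnion_iff]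
  exact fun n => (hf n).1

theorem L2loc.sub {f g : R3 → ℝ} (hf : L2loc f) (hg : L2loc g) : L2loc (fun x => f x - g x) :=
  fun R => (hf R).sub (hg R)

theorem L2loc.add {f g : R3 → ℝ} (hf : L2loc f) (hg : L2loc g) : L2loc (fun x => f x + g x) :=
  fun R => (hf R).add (hg R)

theorem L2loc.const_mul {f : R3 → ℝ} (hf : L2loc f) (c : ℝ) : L2loc (fun x => c * f x) :=
  fun R => (hf R).const_mul c

theorem L2loc.bdd_mul {f w : R3 → ℝ} {C : ℝ} (hf : L2loc f) (hw : AEStronglyMeasurable w volume)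
    (hC : ∀ᵐ x, |w x| ≤ C) : L2loc (fun x => w x * f x) := by
  intro R
  refine MemLp.of_le_mul (c := C) (hf R) (hw.restrict.mul (hf R).1) ?_
  filter_upwards [ae_restrict_of_ae hC] with x hx
  rw [norm_mul]
  gcongr
  exact hx

theorem L2loc_of_bdd {f : R3 → ℝ} {C : ℝ} (hf : AEStronglyMeasurable f volume)
    (hC : ∀ᵐ x, |f x| ≤ C) : L2loc f := by
  intro R
  have : IsFiniteMeasure (volume.restrict (QR R)) :=
    ⟨by rw [Measure.restrict_apply_univ]; exact measure_closedBall_lt_top⟩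
  exact MemLp.of_bound hf.restrict C (ae_restrict_of_ae (by simpa using hC))

theorem Continuous.l2loc {f : R3 → ℝ} (hf : Continuous f) : L2loc f := by
  intro R
  have : IsFiniteMeasure (volume.restrict (QR R)) :=
    ⟨by rw [Measure.restrict_apply_univ]; exact measure_closedBall_lt_top⟩
  obtain ⟨C, hC⟩ := (isCompact_closedBall (0 : R3) R).exists_bound_of_continuousOn hf.continuousOn
  refine MemLp.of_bound hf.aestronglyMeasurable C ?_
  exact (ae_restrict_iff' measurableSet_closedBall).2 (Eventually.of_forall hC)

theorem L2loc_of_memLp {f : R3 → ℝ} (hf : MemLp f 2 volume) : L2loc f := fun _ => hf.restrict _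

theorem L2loc.locInt {f : R3 → ℝ} (hf : L2loc f) : LocallyIntegrable f volume := by
  rw [locallyIntegrable_iff]
  intro K hK
  obtain ⟨R, hR⟩ := hK.isBounded.subset_closedBall (0 : R3)
  have : IsFiniteMeasure (volume.restrict (QR R)) :=
    ⟨by rw [Measure.restrict_apply_univ]; exact measure_closedBall_lt_top⟩
  exact IntegrableOn.mono_set ((hf R).integrable (by norm_num)) hR

/-- bounded compactly supported multiplier -/
structure BC (R C : ℝ) (w : R3 → ℝ) : Prop where
  meas : AEStronglyMeasurable w volume
  bdd : ∀ᵐ x, |w x| ≤ C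
  supp : ∀ x, x ∉ QR R → w x = 0

theorem setInt_eq_of_supp {f : R3 → ℝ} {R : ℝ} (h : ∀ x, x ∉ QR R → f x = 0) :
    ∫ x in QR R, f x = ∫ x, f x :=
  setIntegral_eq_integral_of_forall_compl_eq_zero h

theorem integrable_of_supp {f : R3 → ℝ} {R : ℝ} (h : ∀ x, x ∉ QR R → f x = 0)
    (hi : IntegrableOn f (QR R) volume) : Integrable f volume :=
  (integrableOn_iff_integrable_of_support_subset (by
    intro x hx
    by_contra h'
    exact hx (h x h'))).1 hi

theorem BC.integrable_mul {R C : ℝ} {w f g : R3 → ℝ} (hw : BC R C w) (hf : L2loc f)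
    (hg : L2loc g) : Integrable (fun x => w x * (f x * g x)) volume := by
  refine integrable_of_supp (R := R) (fun x hx => by simp [hw.supp x hx]) ?_
  have h := (hf R).integrable_mul (hg R)
  exact Integrable.bdd_mul (c := C) h hw.meas.restrict (ae_restrict_of_ae (by simpa using hw.bdd))

theorem BC.integrable_mul1 {R C : ℝ} {w f : R3 → ℝ} (hw : BC R C w) (hf : L2loc f) :
    Integrable (fun x => w x * f x) volume := by
  have := hw.integrable_mul hf (continuous_const (y := (1:ℝ))).l2loc
  simpa using this

theorem BC.bound {R C : ℝ} {w f g : R3 → ℝ} (hC : 0 ≤ C) (hw : BC R C w) (hf : L2loc f)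
    (hg : L2loc g) : |∫ x, w x * (f x * g x)| ≤
      C * (√(∫ x in QR R, f x ^ 2) * √(∫ x in QR R, g x ^ 2)) := by
  rw [← setInt_eq_of_supp (R := R) (fun x hx => by simp [hw.supp x hx])]
  calc |∫ x in QR R, w x * (f x * g x)| ≤ ∫ x in QR R, |w x * (f x * g x)| :=
        abs_integral_le_integral_abs
    _ ≤ ∫ x in QR R, C * |f x * g x| := by
        refine integral_mono_ae (hw.integrable_mul hf hg).abs.integrableOn
          (((hf R).integrable_mul (hg R)).abs.const_mul C) ?_
        filter_upwards [ae_restrict_of_ae hw.bdd] with x hx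
        rw [abs_mul]; gcongr
    _ = C * ∫ x in QR R, |f x * g x| := integral_const_mul _ _
    _ ≤ _ := by gcongr; exact cs_int (hf R) (hg R)

def L2conv {ι : Type*} (l : Filter ι) (f : ι → R3 → ℝ) (g : R3 → ℝ) : Prop :=
  ∀ R : ℝ, Tendsto (fun n => ∫ x in QR R, (f n x - g x) ^ 2) l (𝓝 0)

/-- strong times bounded tends to zero -/
theorem L2conv.tendsto_zero {ι : Type*} {l : Filter ι} {f : ι → R3 → ℝ} {f' : R3 → ℝ}
    {g : ι → R3 → ℝ} {w : ι → R3 → ℝ} {R C K : ℝ} (hC : 0 ≤ C) (h : L2conv l f f')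
    (hf : ∀ n, L2loc (f n)) (hf' : L2loc f') (hg : ∀ n, L2loc (g n))
    (hK : ∀ n, ∫ x in QR R, g n x ^ 2 ≤ K) (hw : ∀ n, BC R C (w n)) :
    Tendsto (fun n => ∫ x, w n x * ((f n x - f' x) * g n x)) l (𝓝 0) := by
  have h1 : Tendsto (fun n => C * (√(∫ x in QR R, (f n x - f' x) ^ 2) * √K)) l (𝓝 0) := by
    have := (((h R).sqrt).mul_const (√K)).const_mul C
    simpa using this
  refine squeeze_zero_norm (fun n => ?_) h1
  refine ((hw n).bound hC ((hf n).sub hf') (hg n)).trans ?_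
  gcongr
  exact hK n

theorem L2conv.tendsto {ι : Type*} {l : Filter ι} {f : ι → R3 → ℝ} {f' : R3 → ℝ}
    {g : R3 → ℝ} {w : R3 → ℝ} {R C : ℝ} (hC : 0 ≤ C) (h : L2conv l f f')
    (hf : ∀ n, L2loc (f n)) (hf' : L2loc f') (hg : L2loc g) (hw : BC R C w) :
    Tendsto (fun n => ∫ x, w x * (f n x * g x)) l (𝓝 (∫ x, w x * (f' x * g x))) := by
  have h0 := h.tendsto_zero (g := fun _ => g) (w := fun _ => w) hC hf hf' (fun _ => hg)
    (fun _ => le_rfl) (fun _ => hw)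
  have : ∀ n, ∫ x, w x * ((f n x - f' x) * g x) =
      (∫ x, w x * (f n x * g x)) - ∫ x, w x * (f' x * g x) := by
    intro n
    rw [← integral_sub (hw.integrable_mul (hf n) hg) (hw.integrable_mul hf' hg)]
    congr 1; ext x; ring
  simp only [this] at h0
  simpa using h0.add_const (∫ x, w x * (f' x * g x))

theorem IsTestFun.exists_bc {ψ : R3 → ℝ} (h : IsTestFun ψ) : ∃ R C : ℝ, 0 ≤ C ∧ BC R C ψ := by
  obtain ⟨C, hC⟩ := h.2.exists_bound_of_continuous h.1.continuous
  obtain ⟨R, hR⟩ := h.2.isBounded.subset_closedBall (0 : R3)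
  refine ⟨R, C, (norm_nonneg _).trans (hC 0), h.1.continuous.aestronglyMeasurable,
    Eventually.of_forall hC, fun x hx => ?_⟩
  by_contra h'
  exact hx (hR (subset_tsupport _ h'))

theorem IsTestFun.pd {ψ : R3 → ℝ} (h : IsTestFun ψ) (i : Fin 3) : IsTestFun (pd i ψ) := by
  refine ⟨?_, ?_⟩
  · exact (h.1.fderiv_right (m := (⊤ : ℕ∞)) (by simp)).clm_apply contDiff_const
  · exact h.2.fderiv_apply (𝕜 := ℝ) (Pi.single i 1)

theorem IsTestFun.mul_right {ψ u : R3 → ℝ} (h : IsTestFun ψ) (hu : ContDiff ℝ (⊤ : ℕ∞) u) :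
    IsTestFun (fun x => ψ x * u x) := ⟨h.1.mul hu, h.2.mul_right⟩

theorem pd_mul {ψ u : R3 → ℝ} (h : ContDiff ℝ (⊤ : ℕ∞) ψ) (hu : ContDiff ℝ (⊤ : ℕ∞) u)
    (i : Fin 3) (x : R3) : pd i (fun x => ψ x * u x) x = pd i ψ x * u x + ψ x * pd i u x := by
  have h1 : DifferentiableAt ℝ ψ x := h.differentiable (by simp) x
  have h2 : DifferentiableAt ℝ u x := hu.differentiable (by simp) x
  show fderiv ℝ (fun x => ψ x * u x) x _ = _
  rw [fderiv_fun_mul h1 h2]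
  simp [mul_comm]; ring

theorem pd_comm {ψ : R3 → ℝ} (h : ContDiff ℝ (⊤ : ℕ∞) ψ) (i j : Fin 3) (x : R3) :
    pd i (pd j ψ) x = pd j (pd i ψ) x := by
  have hs : IsSymmSndFDerivAt ℝ ψ x := by
    apply h.contDiffAt.isSymmSndFDerivAt
    simp only [minSmoothness_of_isRCLikeNormedField]; exact (WithTop.coe_le_coe (a := ⊤) (b := (2:ℕ∞))).2 le_top
  have hd : DifferentiableAt ℝ (fderiv ℝ ψ) x :=
    (h.fderiv_right (m := (⊤ : ℕ∞)) (by simp)).differentiable (by simp) x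
  have key : ∀ i j : Fin 3, pd i (pd j ψ) x
      = fderiv ℝ (fderiv ℝ ψ) x (Pi.single i 1) (Pi.single j 1) := by
    intro i j
    show fderiv ℝ (fun y => fderiv ℝ ψ y (Pi.single j 1)) x _ = _
    rw [fderiv_clm_apply hd (differentiableAt_const _)]
    simp
  rw [key, key]
  exact hs _ _

end

section

def bmp (n : ℕ) : ContDiffBump (0 : R3) :=
  ⟨1 / (2 * (n + 1)), 1 / (n + 1), by positivity, by
    apply one_div_lt_one_div_of_lt
    · positivity
    · have : (0:ℝ) ≤ n := Nat.cast_nonneg n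
      linarith⟩

def rho (n : ℕ) : R3 → ℝ := (bmp n).normed volume

def moll (n : ℕ) (f : R3 → ℝ) (x : R3) : ℝ := ∫ t, rho n t * f (x - t)

theorem moll_eq (n : ℕ) (f : R3 → ℝ) :
    moll n f = convolution (rho n) f (ContinuousLinearMap.lsmul ℝ ℝ) volume := rfl

theorem moll_swap (n : ℕ) (f : R3 → ℝ) (x : R3) : moll n f x = ∫ t, rho n (x - t) * f t := by
  rw [moll_eq, convolution_lsmul_swap]; rfl

theorem rho_nonneg (n : ℕ) (x : R3) : 0 ≤ rho n x := (bmp n).nonneg_normed x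
theorem rho_integral (n : ℕ) : ∫ x, rho n x = 1 := (bmp n).integral_normed
theorem rho_contDiff (n : ℕ) : ContDiff ℝ (⊤ : ℕ∞) (rho n) := (bmp n).contDiff_normed
theorem rho_cs (n : ℕ) : HasCompactSupport (rho n) := (bmp n).hasCompactSupport_normed
theorem rho_supp (n : ℕ) (x : R3) (hx : (1:ℝ) / (n + 1) ≤ ‖x‖) : rho n x = 0 := by
  have h : x ∉ Function.support (rho n) := by
    rw [rho, (bmp n).support_normed_eq]
    simpa [bmp] using hx
  simpa using h
theorem rho_integrable (n : ℕ) : Integrable (rho n) volume :=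
  (rho_contDiff n).continuous.integrable_of_hasCompactSupport (rho_cs n)

theorem bmp_tendsto : Tendsto (fun n => (bmp n).rOut) atTop (𝓝 0) := by
  show Tendsto (fun n : ℕ => (1:ℝ) / (n + 1)) atTop (𝓝 0)
  exact tendsto_one_div_add_atTop_nhds_zero_nat

theorem moll_contDiff (n : ℕ) {f : R3 → ℝ} (hf : LocallyIntegrable f volume) :
    ContDiff ℝ (⊤ : ℕ∞) (moll n f) := by
  rw [moll_eq]
  exact (rho_cs n).contDiff_convolution_left _ (rho_contDiff n) hf

theorem moll_ae_tendsto {f : R3 → ℝ} (hf : LocallyIntegrable f volume) :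
    ∀ᵐ x, Tendsto (fun n => moll n f x) atTop (𝓝 (f x)) := by
  refine ContDiffBump.ae_convolution_tendsto_right_of_locallyIntegrable (K := 2) bmp_tendsto ?_ hf
  refine Eventually.of_forall fun n => ?_
  show (1:ℝ) / (n + 1) ≤ 2 * (1 / (2 * (n + 1)))
  apply le_of_eq
  field_simp

theorem moll_int (n : ℕ) {f : R3 → ℝ} (hf : LocallyIntegrable f volume) (x : R3) :
    Integrable (fun t => rho n t * f (x - t)) volume := by
  have := (rho_cs n).convolutionExists_left (ContinuousLinearMap.lsmul ℝ ℝ)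
    (rho_contDiff n).continuous hf x
  exact this

theorem moll_bound (n : ℕ) {f : R3 → ℝ} {C : ℝ} (hf : LocallyIntegrable f volume)
    (hC : ∀ᵐ x, |f x| ≤ C) (x : R3) : |moll n f x| ≤ C := by
  have h1 : ∀ᵐ t : R3, |f (x - t)| ≤ C :=
    (Measure.measurePreserving_sub_left volume x).quasiMeasurePreserving.ae hC
  calc |moll n f x| ≤ ∫ t, |rho n t * f (x - t)| := abs_integral_le_integral_abs
    _ ≤ ∫ t, rho n t * C := by
      refine integral_mono_ae (moll_int n hf x).abs ((rho_integrable n).mul_const C) ?_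
      filter_upwards [h1] with t ht
      rw [abs_mul, abs_of_nonneg (rho_nonneg n t)]
      exact mul_le_mul_of_nonneg_left ht (rho_nonneg n t)
    _ = C := by rw [integral_mul_const, rho_integral, one_mul]

theorem moll_congr (n : ℕ) {f g : R3 → ℝ} (h : f =ᵐ[volume] g) : moll n f = moll n g := by
  ext x
  apply integral_congr_ae
  have h1 : ∀ᵐ t : R3, f (x - t) = g (x - t) :=
    (Measure.measurePreserving_sub_left volume x).quasiMeasurePreserving.ae h
  filter_upwards [h1] with t ht
  rw [ht]

theorem pd_moll (n : ℕ) {u g : R3 → ℝ} (i : Fin 3) (hu : LocallyIntegrable u volume)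
    (hw : ∀ ψ : R3 → ℝ, IsTestFun ψ → ∫ x, pd i ψ x * u x = - ∫ x, ψ x * g x) (x : R3) :
    pd i (moll n u) x = moll n g x := by
  have h1 : HasFDerivAt (moll n u) _ x := (rho_cs n).hasFDerivAt_convolution_left
    (ContinuousLinearMap.lsmul ℝ ℝ) ((rho_contDiff n).of_le (by simp)) hu x
  have h2 : pd i (moll n u) x = ∫ t, fderiv ℝ (rho n) (x - t) (Pi.single i 1) * u t := by
    show fderiv ℝ (moll n u) x _ = _
    rw [h1.fderiv, convolution_eq_swap]
    rw [ContinuousLinearMap.integral_apply]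
    · rfl
    · have := (HasCompactSupport.fderiv (𝕜 := ℝ) (rho_cs n)).convolutionExists_left
        ((ContinuousLinearMap.lsmul ℝ ℝ : ℝ →L[ℝ] ℝ →L[ℝ] ℝ).precompL R3)
        ((rho_contDiff n).continuous_fderiv (by simp)) hu x
      exact (convolutionExistsAt_iff_integrable_swap).1 this
  let ψ : R3 → ℝ := fun t => rho n (x - t)
  have hψ : IsTestFun ψ := by
    refine ⟨(rho_contDiff n).comp (contDiff_const.sub contDiff_id), ?_⟩
    exact (rho_cs n).comp_homeomorph (Homeomorph.subLeft x)
  have h3 : ∀ t, pd i ψ t = - fderiv ℝ (rho n) (x - t) (Pi.single i 1) := by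
    intro t
    have hd : HasFDerivAt (rho n) (fderiv ℝ (rho n) (x - t)) (x - t) :=
      ((rho_contDiff n).differentiable (by simp) _).hasFDerivAt
    have h4 : HasFDerivAt ψ _ t := hd.comp t ((hasFDerivAt_id t).const_sub x)
    show fderiv ℝ ψ t _ = _
    rw [h4.fderiv]; simp
  have h5 := hw ψ hψ
  simp only [h3, neg_mul, integral_neg, neg_inj] at h5
  rw [h2, h5, moll_swap]

theorem jensen_sq {ν : Measure R3} [IsProbabilityMeasure ν] {h : R3 → ℝ≥0∞}
    (hh : AEMeasurable h ν) : (∫⁻ t, h t ∂ν) ^ 2 ≤ ∫⁻ t, h t ^ 2 ∂ν := by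
  have := ENNReal.lintegral_mul_le_Lp_mul_Lq ν Real.HolderConjugate.two_two hh
    (aemeasurable_const (b := (1:ℝ≥0∞)))
  simp only [Pi.mul_apply, mul_one, lintegral_const, measure_univ, one_pow, ENNReal.one_rpow,
    ENNReal.rpow_two] at this
  calc (∫⁻ t, h t ∂ν) ^ 2 ≤ ((∫⁻ t, h t ^ 2 ∂ν) ^ (1/2:ℝ)) ^ 2 := by gcongr
    _ = _ := by
      rw [← ENNReal.rpow_natCast, ← ENNReal.rpow_mul]; norm_num

theorem translate_tendsto {f : R3 → ℝ} (hf : MemLp f 2 volume) :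
    Tendsto (fun t : R3 => ∫⁻ x, ‖f (x - t) - f x‖ₑ ^ 2) (𝓝 0) (𝓝 0) := by
  let g : R3 → C(R3, R3) := fun t => ⟨fun x => x - t, by fun_prop⟩
  have hg : Continuous g := by
    have : Continuous (fun p : R3 × R3 => p.2 - p.1) := by fun_prop
    exact (ContinuousMap.curry ⟨_, this⟩).continuous
  have hgm : ∀ t, MeasurePreserving (g t) volume volume := fun t =>
    measurePreserving_sub_right volume t
  have hc : Continuous (fun t : R3 => Lp.compMeasurePreserving (g t) (hgm t) hf.toLp) :=
    (continuous_const (y := hf.toLp)).compMeasurePreservingLp hg hgm (by norm_num)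
  have h0 : Lp.compMeasurePreserving (g 0) (hgm 0) hf.toLp = hf.toLp := by
    rw [Lp.toLp_compMeasurePreserving]
    congr 1
    ext x
    simp [g]
  have h1 := (tendsto_iff_edist_tendsto_0.1 (hc.tendsto 0))
  rw [h0] at h1
  have h2 := ENNReal.Tendsto.pow (n := 2) h1
  rw [zero_pow (by norm_num)] at h2
  refine h2.congr fun t => ?_
  rw [Lp.toLp_compMeasurePreserving, Lp.edist_toLp_toLp,
    eLpNorm_eq_lintegral_rpow_enorm_toReal (by norm_num) (by norm_num), ← ENNReal.rpow_natCast,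
    ← ENNReal.rpow_mul]
  norm_num
  rfl

def nuM (n : ℕ) : Measure R3 := volume.withDensity (fun t => ENNReal.ofReal (rho n t))

theorem rho_meas (n : ℕ) : Measurable (fun t => ENNReal.ofReal (rho n t)) :=
  (rho_contDiff n).continuous.measurable.ennreal_ofReal

instance nuM_prob (n : ℕ) : IsProbabilityMeasure (nuM n) := by
  refine ⟨?_⟩
  rw [nuM, withDensity_apply _ MeasurableSet.univ, Measure.restrict_univ,
    ← ofReal_integral_eq_lintegral_ofReal (rho_integrable n) (Eventually.of_forall (rho_nonneg n)),
    rho_integral, ENNReal.ofReal_one]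

theorem nuM_lintegral (n : ℕ) {h : R3 → ℝ≥0∞} :
    ∫⁻ t, h t ∂(nuM n) = ∫⁻ t, ENNReal.ofReal (rho n t) * h t := by
  rw [nuM, lintegral_withDensity_eq_lintegral_mul_non_measurable _ (rho_meas n)
    (Eventually.of_forall fun _ => ENNReal.ofReal_lt_top)]
  rfl

theorem moll_sub_enorm (n : ℕ) {f : R3 → ℝ} (hf : LocallyIntegrable f volume) (x : R3) :
    ‖moll n f x - f x‖ₑ ≤ ∫⁻ t, ‖f (x - t) - f x‖ₑ ∂(nuM n) := by
  have h1 : moll n f x - f x = ∫ t, rho n t * (f (x - t) - f x) := by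
    have : ∀ t, rho n t * (f (x - t) - f x) = rho n t * f (x - t) - rho n t * f x := by
      intro t; ring
    simp_rw [this]
    rw [integral_sub (moll_int n hf x) ((rho_integrable n).mul_const _), integral_mul_const,
      rho_integral, one_mul]
    rfl
  rw [h1, nuM_lintegral]
  refine (enorm_integral_le_lintegral_enorm _).trans (le_of_eq ?_)
  congr 1; ext t
  rw [enorm_mul, Real.enorm_of_nonneg (rho_nonneg n t)]

theorem moll_l2_aux (n : ℕ) {f : R3 → ℝ} (hm : Measurable f) (hf : LocallyIntegrable f volume) :
    ∫⁻ x, ‖moll n f x - f x‖ₑ ^ 2 ≤ ∫⁻ t, (∫⁻ x, ‖f (x - t) - f x‖ₑ ^ 2) ∂(nuM n) := by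
  rw [lintegral_lintegral_swap]
  · refine lintegral_mono fun x => ?_
    refine (pow_le_pow_left₀ (zero_le) (moll_sub_enorm n hf x) 2).trans ?_
    apply jensen_sq
    have : Measurable (fun t => ‖f (x - t) - f x‖ₑ) := by fun_prop
    exact this.aemeasurable
  · have : Measurable (fun p : R3 × R3 => ‖f (p.2 - p.1) - f p.2‖ₑ ^ 2) := by fun_prop
    exact this.aemeasurable

theorem moll_l2 {f : R3 → ℝ} (hm : Measurable f) (hf : MemLp f 2 volume) :
    Tendsto (fun n => ∫⁻ x, ‖moll n f x - f x‖ₑ ^ 2) atTop (𝓝 0) := by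
  have hl := (L2loc_of_memLp hf).locInt
  rw [ENNReal.tendsto_nhds_zero]
  intro ε hε
  have h1 := (ENNReal.tendsto_nhds_zero.1 (translate_tendsto hf)) ε hε
  obtain ⟨δ, hδ, hb⟩ := Metric.eventually_nhds_iff.1 h1
  have h2 : ∀ᶠ n : ℕ in atTop, (1:ℝ) / (n + 1) < δ :=
    tendsto_one_div_add_atTop_nhds_zero_nat.eventually_lt_const hδ
  filter_upwards [h2] with n hn
  refine (moll_l2_aux n hm hl).trans ?_
  calc ∫⁻ t, (∫⁻ x, ‖f (x - t) - f x‖ₑ ^ 2) ∂(nuM n) ≤ ∫⁻ t, ε ∂(nuM n) := by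
        rw [nuM_lintegral, nuM_lintegral]
        refine lintegral_mono fun t => ?_
        by_cases ht : ‖t‖ < δ
        · exact mul_le_mul_right (hb (by simpa using ht)) _
        · rw [rho_supp n t (by linarith)]; simp
    _ = ε := by simp

theorem moll_local (n : ℕ) {f g : R3 → ℝ} {R : ℝ} (h : ∀ x ∈ QR (R + 1), f x = g x) :
    ∀ x ∈ QR R, moll n f x = moll n g x := by
  intro x hx
  apply integral_congr_ae
  refine Eventually.of_forall fun t => ?_
  by_cases ht : (1:ℝ) / (n + 1) ≤ ‖t‖
  · simp [rho_supp n t ht]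
  · have h1 : ‖t‖ ≤ 1 := by
      push Not at ht
      refine ht.le.trans ?_
      rw [div_le_one (by positivity)]
      linarith [(Nat.cast_nonneg n : (0:ℝ) ≤ n)]
    have h2 : x - t ∈ QR (R + 1) := by
      rw [mem_closedBall_zero_iff] at hx ⊢
      exact (norm_sub_le _ _).trans (add_le_add hx h1)
    show rho n t * f (x - t) = rho n t * g (x - t)
    rw [h _ h2]

theorem setInt_sq_eq {S : Set R3} {f : R3 → ℝ} (hf : AEStronglyMeasurable f (volume.restrict S)) :
    ∫ x in S, f x ^ 2 = (∫⁻ x in S, ‖f x‖ₑ ^ 2).toReal := by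
  rw [integral_eq_lintegral_of_nonneg_ae (Eventually.of_forall fun x => sq_nonneg _)
    (hf.pow 2)]
  congr 2; ext x
  rw [← sq_abs, ENNReal.ofReal_pow (abs_nonneg _), Real.enorm_eq_ofReal_abs]

theorem moll_l2loc (n : ℕ) {f : R3 → ℝ} (hf : L2loc f) : L2loc (moll n f) :=
  (moll_contDiff n hf.locInt).continuous.l2loc

theorem moll_L2conv {f : R3 → ℝ} (hf : L2loc f) : L2conv atTop (fun n => moll n f) f := by
  intro R
  let f1 := (QR (R + 1)).indicator f
  have h1 : MemLp f1 2 volume := (memLp_indicator_iff_restrict measurableSet_closedBall).2 (hf _)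
  let f2 := h1.1.mk f1
  have h12 : f1 =ᵐ[volume] f2 := h1.1.ae_eq_mk
  have h2 : MemLp f2 2 volume := h1.ae_eq h12
  have h3 := moll_l2 h1.1.stronglyMeasurable_mk.measurable h2
  have h4 : ∀ n, ∫ x in QR R, (moll n f x - f x) ^ 2
      = (∫⁻ x in QR R, ‖moll n f2 x - f2 x‖ₑ ^ 2).toReal := by
    intro n
    rw [setInt_sq_eq ((moll_l2loc n hf).sub hf).aesm.restrict]
    congr 1
    apply lintegral_congr_ae
    filter_upwards [ae_restrict_of_ae h12, ae_restrict_mem measurableSet_closedBall] with x hx hx2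
    have e1 : moll n f x = moll n f2 x := by
      rw [← moll_congr n h12]
      exact moll_local n (fun y hy => (Set.indicator_of_mem hy f).symm) x hx2
    have e2 : f x = f2 x := by
      rw [← hx]
      refine (Set.indicator_of_mem ?_ f).symm
      rw [mem_closedBall_zero_iff] at hx2 ⊢
      linarith
    rw [e1, e2]
  simp only [h4]
  rw [← ENNReal.toReal_zero]
  refine (ENNReal.tendsto_toReal (by simp)).comp ?_
  exact tendsto_of_tendsto_of_tendsto_of_le_of_le tendsto_const_nhds h3 (fun _ => zero_le)
    (fun n => setLIntegral_le_lintegral _ _)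

end

section

structure WD (u : R3 → ℝ) (g : Fin 3 → R3 → ℝ) : Prop where
  hu : L2loc u
  hg : ∀ i, L2loc (g i)
  weak : ∀ (i : Fin 3) (ψ : R3 → ℝ), IsTestFun ψ → ∫ x, pd i ψ x * u x = - ∫ x, ψ x * g i x

theorem contDiff_pd {u : R3 → ℝ} (h : ContDiff ℝ (⊤ : ℕ∞) u) (i : Fin 3) :
    ContDiff ℝ (⊤ : ℕ∞) (pd i u) :=
  (h.fderiv_right (m := (⊤ : ℕ∞)) (by simp)).clm_apply contDiff_const

theorem IsTestFun.int_mul {ψ f : R3 → ℝ} (hψ : IsTestFun ψ) (hf : L2loc f) :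
    Integrable (fun x => ψ x * f x) volume := by
  obtain ⟨R, C, hC, hb⟩ := hψ.exists_bc
  exact hb.integrable_mul1 hf

theorem IsTestFun.int_mul2 {ψ f g : R3 → ℝ} (hψ : IsTestFun ψ) (hf : L2loc f) (hg : L2loc g) :
    Integrable (fun x => ψ x * (f x * g x)) volume := by
  obtain ⟨R, C, hC, hb⟩ := hψ.exists_bc
  exact hb.integrable_mul hf hg

theorem IsTestFun.tendsto {ι : Type*} {l : Filter ι} {ψ : R3 → ℝ} {f : ι → R3 → ℝ} {f' g : R3 → ℝ}
    (hψ : IsTestFun ψ) (h : L2conv l f f')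
    (hf : ∀ n, L2loc (f n)) (hf' : L2loc f') (hg : L2loc g) :
    Tendsto (fun n => ∫ x, ψ x * (f n x * g x)) l (𝓝 (∫ x, ψ x * (f' x * g x))) := by
  obtain ⟨R, C, hC, hb⟩ := hψ.exists_bc
  exact h.tendsto hC hf hf' hg hb

/-- integration by parts against a product -/
theorem WD.parts {v : R3 → ℝ} {h : Fin 3 → R3 → ℝ} (hv : WD v h) {ψ u : R3 → ℝ}
    (hψ : IsTestFun ψ) (hu : ContDiff ℝ (⊤ : ℕ∞) u) (j : Fin 3) :
    ∫ x, ψ x * (u x * h j x) = - (∫ x, pd j ψ x * (u x * v x)) - ∫ x, ψ x * (pd j u x * v x) := by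
  have h1 := hv.weak j _ (hψ.mul_right hu)
  simp only [pd_mul hψ.1 hu] at h1
  have e1 : ∀ x, (pd j ψ x * u x + ψ x * pd j u x) * v x
      = pd j ψ x * (u x * v x) + ψ x * (pd j u x * v x) := fun x => by ring
  simp only [e1] at h1
  rw [integral_add ((hψ.pd j).int_mul2 hu.continuous.l2loc hv.hu)
    (hψ.int_mul2 (contDiff_pd hu j).continuous.l2loc hv.hu)] at h1
  have e2 : ∀ x, ψ x * u x * h j x = ψ x * (u x * h j x) := fun x => by ring
  simp only [e2] at h1
  linarith

theorem dc2_smooth {u v : R3 → ℝ} {h : Fin 3 → R3 → ℝ} (hu : ContDiff ℝ (⊤ : ℕ∞) u)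
    (hv : WD v h) {ψ : R3 → ℝ} (hψ : IsTestFun ψ) (i j : Fin 3) :
    (∫ x, ψ x * (pd i u x * h j x)) - (∫ x, ψ x * (pd j u x * h i x))
      = (∫ x, pd j ψ x * (u x * h i x)) - ∫ x, pd i ψ x * (u x * h j x) := by
  have a1 := hv.parts hψ (contDiff_pd hu i) j
  have a2 := hv.parts hψ (contDiff_pd hu j) i
  have a3 := hv.parts (hψ.pd j) hu i
  have a4 := hv.parts (hψ.pd i) hu j
  simp only [pd_comm hψ.1 i j] at a3
  simp only [pd_comm hu i j] at a2
  rw [a1, a2, a3, a4]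
  ring

theorem dc2 {u v : R3 → ℝ} {g h : Fin 3 → R3 → ℝ} (hu : WD u g)
    (hv : WD v h) {ψ : R3 → ℝ} (hψ : IsTestFun ψ) (i j : Fin 3) :
    (∫ x, ψ x * (g i x * h j x)) - (∫ x, ψ x * (g j x * h i x))
      = (∫ x, pd j ψ x * (u x * h i x)) - ∫ x, pd i ψ x * (u x * h j x) := by
  have key := fun n => dc2_smooth (moll_contDiff n hu.hu.locInt) hv hψ i j
  have hp : ∀ n i x, pd i (moll n u) x = moll n (g i) x := fun n i x =>
    pd_moll n i hu.hu.locInt (hu.weak i) x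
  simp only [hp] at key
  have hl : ∀ {f : R3 → ℝ}, L2loc f → ∀ n, L2loc (moll n f) := fun hf n => moll_l2loc n hf
  have t1 := (hψ.tendsto (moll_L2conv (hu.hg i)) (hl (hu.hg i)) (hu.hg i) (hv.hg j)).sub
    (hψ.tendsto (moll_L2conv (hu.hg j)) (hl (hu.hg j)) (hu.hg j) (hv.hg i))
  have t2 := ((hψ.pd j).tendsto (moll_L2conv hu.hu) (hl hu.hu) hu.hu (hv.hg i)).sub
    ((hψ.pd i).tendsto (moll_L2conv hu.hu) (hl hu.hu) hu.hu (hv.hg j))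
  exact tendsto_nhds_unique (t1.congr key) t2

/-- cross product components -/
def cr (p q : Fin 3 → ℝ) (i : Fin 3) : ℝ := p (i + 1) * q (i + 2) - p (i + 2) * q (i + 1)

theorem int_cr {u v : R3 → ℝ} {g h : Fin 3 → R3 → ℝ} (hu : WD u g)
    (hv : WD v h) {ψ : R3 → ℝ} (hψ : IsTestFun ψ) (i : Fin 3) :
    Integrable (fun x => ψ x * cr (fun l => g l x) (fun l => h l x) i) volume := by
  have := (hψ.int_mul2 (hu.hg (i+1)) (hv.hg (i+2))).sub (hψ.int_mul2 (hu.hg (i+2)) (hv.hg (i+1)))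
  refine this.congr (Eventually.of_forall fun x => ?_)
  simp only [cr, Pi.sub_apply]; ring

theorem dc_cr {u v : R3 → ℝ} {g h : Fin 3 → R3 → ℝ} (hu : WD u g)
    (hv : WD v h) {ψ : R3 → ℝ} (hψ : IsTestFun ψ) (i : Fin 3) :
    ∫ x, ψ x * cr (fun l => g l x) (fun l => h l x) i
      = (∫ x, pd (i+2) ψ x * (u x * h (i+1) x)) - ∫ x, pd (i+1) ψ x * (u x * h (i+2) x) := by
  rw [← dc2 hu hv hψ (i+1) (i+2), ← integral_sub (hψ.int_mul2 (hu.hg (i+1)) (hv.hg (i+2)))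
    (hψ.int_mul2 (hu.hg (i+2)) (hv.hg (i+1)))]
  congr 1; ext x; simp only [cr]; ring

theorem div_free {u v : R3 → ℝ} {g h : Fin 3 → R3 → ℝ} (hu : WD u g)
    (hv : WD v h) {ψ : R3 → ℝ} (hψ : IsTestFun ψ) :
    ∑ i, ∫ x, pd i ψ x * cr (fun l => g l x) (fun l => h l x) i = 0 := by
  simp only [dc_cr hu hv (hψ.pd _), Fin.sum_univ_three]
  simp only [zero_add, show (1:Fin 3) + 1 = 2 from rfl, show (1:Fin 3) + 2 = 0 from rfl,
    show (2:Fin 3) + 1 = 0 from rfl, show (2:Fin 3) + 2 = 1 from rfl]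
  have c1 := fun x => pd_comm hψ.1 1 0 x
  have c2 := fun x => pd_comm hψ.1 2 0 x
  have c3 := fun x => pd_comm hψ.1 2 1 x
  simp only [c1, c2, c3]
  ring

/-- weights converging boundedly a.e. and strong L2 convergence -/
theorem tendsto_wfg {ι : Type*} {l : Filter ι} [l.IsCountablyGenerated] {w : ι → R3 → ℝ}
    {w' : R3 → ℝ} {f : ι → R3 → ℝ} {f' g : R3 → ℝ} {R C : ℝ} (hC : 0 ≤ C)
    (hw : ∀ n, BC R C (w n)) (hlim : ∀ᵐ x, Tendsto (fun n => w n x) l (𝓝 (w' x)))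
    (h : L2conv l f f')
    (hf : ∀ n, L2loc (f n)) (hf' : L2loc f') (hg : L2loc g) :
    Tendsto (fun n => ∫ x, w n x * (f n x * g x)) l (𝓝 (∫ x, w' x * (f' x * g x))) := by
  have h0 := h.tendsto_zero (g := fun _ => g) (w := w) hC hf hf' (fun _ => hg)
    (fun _ => le_rfl) hw
  have hbc : BC R C (fun x => (QR R).indicator (fun _ => C) x) := by
    refine ⟨(measurable_const.indicator measurableSet_closedBall).aestronglyMeasurable,
      Eventually.of_forall fun x => ?_, fun x hx => by simp only [Set.indicator_of_notMem hx]⟩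
    by_cases hx : x ∈ QR R
    · simp only [Set.indicator_of_mem hx, abs_of_nonneg hC]; exact le_rfl
    · simp only [Set.indicator_of_notMem hx, abs_zero]; exact hC
  have h1 : Tendsto (fun n => ∫ x, w n x * (f' x * g x)) l (𝓝 (∫ x, w' x * (f' x * g x))) := by
    refine tendsto_integral_filter_of_dominated_convergence
      (fun x => |(QR R).indicator (fun _ => C) x * (f' x * g x)|)
      (Eventually.of_forall fun n => ((hw n).integrable_mul hf' hg).1)
      (Eventually.of_forall fun n => ?_) (hbc.integrable_mul hf' hg).abs ?_
    · filter_upwards [(hw n).bdd] with x hx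
      rw [Real.norm_eq_abs, abs_mul, abs_mul ((QR R).indicator _ x)]
      refine mul_le_mul_of_nonneg_right ?_ (abs_nonneg _)
      by_cases hx2 : x ∈ QR R
      · rwa [Set.indicator_of_mem hx2, abs_of_nonneg hC]
      · simp [(hw n).supp x hx2]
    · filter_upwards [hlim] with x hx
      exact hx.mul_const _
  have h2 := h0.add h1
  rw [zero_add] at h2
  refine h2.congr fun n => ?_
  rw [← integral_add ((hw n).integrable_mul ((hf n).sub hf') hg) ((hw n).integrable_mul hf' hg)]
  congr 1; ext x; ring

end

section

def m3 (p q r : Fin 3 → ℝ) : ℝ := ∑ i, p i * cr q r i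

theorem m3_pow4 (p q r : Fin 3 → ℝ) :
    m3 p q r ^ 4 ≤ (∑ i, cr p q i ^ 2) * (∑ i, cr q r i ^ 2) * (∑ i, cr p r i ^ 2) := by
  -- Hadamard in R3 for the three cross products
  have had : ∀ a b c : Fin 3 → ℝ, m3 a b c ^ 2 ≤ (∑ i, a i ^ 2) * (∑ i, b i ^ 2) * (∑ i, c i ^ 2) := by
    intro a b c
    have h1 : m3 a b c ^ 2 ≤ (∑ i, a i ^ 2) * (∑ i, cr b c i ^ 2) :=
      Finset.sum_mul_sq_le_sq_mul_sq _ _ _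
    have h2 : ∑ i, cr b c i ^ 2 ≤ (∑ i, b i ^ 2) * (∑ i, c i ^ 2) := by
      have : (∑ i, b i ^ 2) * (∑ i, c i ^ 2) = ∑ i, cr b c i ^ 2 + (∑ i, b i * c i) ^ 2 := by
        simp [cr, Fin.sum_univ_three]; ring
      rw [this]; nlinarith [sq_nonneg (∑ i, b i * c i)]
    calc _ ≤ _ := h1
      _ ≤ (∑ i, a i ^ 2) * ((∑ i, b i ^ 2) * (∑ i, c i ^ 2)) := by gcongr
      _ = _ := by ring
  have h1 : m3 p q r ^ 4 = m3 (cr p q) (cr q r) (cr p r) ^ 2 := by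
    simp [m3, cr, Fin.sum_univ_three]; ring
  rw [h1]; exact had _ _ _

theorem m3_abs_le (p q r : Fin 3 → ℝ) : |m3 p q r| ≤ (∑ i, p i ^ 2 + ∑ i, cr q r i ^ 2) / 2 := by
  rw [← Finset.sum_add_distrib, Finset.sum_div]
  refine (Finset.abs_sum_le_sum_abs _ _).trans (Finset.sum_le_sum fun i _ => ?_)
  rw [abs_mul, ← sq_abs (p i), ← sq_abs (cr q r i)]
  nlinarith [sq_nonneg (|p i| - |cr q r i|)]

theorem wedgeSq_eq (u v : R4) : wedgeSq u v = (∑ a, ∑ b, (u a * v b - u b * v a) ^ 2) / 2 := by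
  simp [wedgeSq, nsq, dot, Fin.sum_univ_four]; ring

theorem wedgeSq_nonneg (u v : R4) : 0 ≤ wedgeSq u v := by
  rw [wedgeSq_eq]; positivity

theorem wedgeSq_ge (u v : R4) (a b : Fin 4) : (u a * v b - u b * v a) ^ 2 ≤ 2 * wedgeSq u v := by
  rw [wedgeSq_eq]
  have h1 := Finset.single_le_sum (f := fun a => ∑ b, (u a * v b - u b * v a) ^ 2)
    (fun i _ => by positivity) (Finset.mem_univ a)
  have h2 := Finset.single_le_sum (f := fun b => (u a * v b - u b * v a) ^ 2)
    (fun i _ => by positivity) (Finset.mem_univ b)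
  linarith

theorem wedgeSq_self (u : R4) : wedgeSq u u = 0 := by simp [wedgeSq, nsq]; ring

theorem wedgeSq_symm (u v : R4) : wedgeSq u v = wedgeSq v u := by
  simp [wedgeSq, nsq, dot, Fin.sum_univ_four]; ring

theorem nsq_nonneg (u : R4) : 0 ≤ nsq u := by
  unfold nsq dot
  exact Finset.sum_nonneg fun _ _ => mul_self_nonneg _

namespace SkyrmeMap

def gr (φ : SkyrmeMap) (a : Fin 4) (x : R3) : Fin 3 → ℝ := fun i => φ.pderiv i x a
def AA (φ : SkyrmeMap) (c d : Fin 4) (i : Fin 3) (x : R3) : ℝ := cr (φ.gr c x) (φ.gr d x) i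
def MM (φ : SkyrmeMap) (b c d : Fin 4) (x : R3) : ℝ := m3 (φ.gr b x) (φ.gr c x) (φ.gr d x)
def Mc (φ : SkyrmeMap) (a : Fin 4) (x : R3) : ℝ :=
  ![φ.MM 1 2 3 x, -φ.MM 0 2 3 x, φ.MM 0 1 3 x, -φ.MM 0 1 2 x] a

theorem detDen_eq (φ : SkyrmeMap) (x : R3) : detDen φ x = ∑ a, φ.toFun x a * φ.Mc a x := by
  simp [detDen, det4, Matrix.det_succ_row_zero, Fin.sum_univ_succ, Mc, MM, m3, cr, gr]
  simp [Fin.succAbove, Fin.castSucc, Fin.succ]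
  ring

theorem gradSq_nonneg (φ : SkyrmeMap) (x : R3) : 0 ≤ gradSq φ x :=
  Finset.sum_nonneg fun _ _ => nsq_nonneg _
theorem ASq_nonneg (φ : SkyrmeMap) (x : R3) : 0 ≤ ASq φ x :=
  Finset.sum_nonneg fun _ _ => Finset.sum_nonneg fun _ _ => wedgeSq_nonneg _ _
theorem e_nonneg (φ : SkyrmeMap) (x : R3) : 0 ≤ energyDensity φ x :=
  add_nonneg (gradSq_nonneg φ x) (ASq_nonneg φ x)

theorem gr_sq_sum (φ : SkyrmeMap) (x : R3) : ∑ a, ∑ i, φ.gr a x i ^ 2 = gradSq φ x := by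
  rw [Finset.sum_comm]
  simp [gradSq, nsq, dot, gr, sq]

theorem gr_sq_le (φ : SkyrmeMap) (a : Fin 4) (x : R3) : ∑ i, φ.gr a x i ^ 2 ≤ gradSq φ x := by
  rw [← gr_sq_sum]
  exact Finset.single_le_sum (f := fun a => ∑ i, φ.gr a x i ^ 2)
    (fun i _ => by positivity) (Finset.mem_univ a)

theorem gr_sq_le' (φ : SkyrmeMap) (a : Fin 4) (i : Fin 3) (x : R3) :
    φ.pderiv i x a ^ 2 ≤ gradSq φ x :=
  (Finset.single_le_sum (f := fun i => φ.gr a x i ^ 2)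
    (fun i _ => by positivity) (Finset.mem_univ i)).trans (φ.gr_sq_le a x)

theorem AA_sq_sum_le (φ : SkyrmeMap) (c d : Fin 4) (x : R3) : ∑ i, φ.AA c d i x ^ 2 ≤ ASq φ x := by
  have h : ∀ i, φ.AA c d i x ^ 2 ≤ 2 * wedgeSq (φ.pderiv (i+1) x) (φ.pderiv (i+2) x) := by
    intro i
    refine le_trans (le_of_eq ?_) (wedgeSq_ge _ _ c d)
    simp only [AA, cr, gr]; ring
  refine (Finset.sum_le_sum fun i _ => h i).trans (le_of_eq ?_)
  simp only [ASq, Fin.sum_univ_three, wedgeSq_self]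
  simp only [zero_add, show (1:Fin 3) + 1 = 2 from rfl, show (1:Fin 3) + 2 = 0 from rfl,
    show (2:Fin 3) + 1 = 0 from rfl, show (2:Fin 3) + 2 = 1 from rfl]
  rw [wedgeSq_symm (φ.pderiv 1 x) (φ.pderiv 0 x), wedgeSq_symm (φ.pderiv 2 x) (φ.pderiv 1 x),
    wedgeSq_symm (φ.pderiv 2 x) (φ.pderiv 0 x)]
  ring

theorem AA_sq_le (φ : SkyrmeMap) (c d : Fin 4) (i : Fin 3) (x : R3) :
    φ.AA c d i x ^ 2 ≤ ASq φ x :=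
  (Finset.single_le_sum (f := fun i => φ.AA c d i x ^ 2)
    (fun i _ => by positivity) (Finset.mem_univ i)).trans (φ.AA_sq_sum_le c d x)

theorem AA_abs_le (φ : SkyrmeMap) (c d : Fin 4) (i : Fin 3) (x : R3) :
    |φ.AA c d i x| ≤ gradSq φ x := by
  have h : ∀ a b c d : ℝ, |a * b - c * d| ≤ (a ^ 2 + b ^ 2 + c ^ 2 + d ^ 2) / 2 := by
    intro a b c d
    rw [abs_le]; constructor <;> nlinarith [sq_nonneg (a-b), sq_nonneg (a+b), sq_nonneg (c-d), sq_nonneg (c+d)]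
  have h1 := h (φ.pderiv (i+1) x c) (φ.pderiv (i+2) x d) (φ.pderiv (i+2) x c) (φ.pderiv (i+1) x d)
  refine h1.trans ?_
  have h2 : ∀ c, φ.pderiv (i+1) x c ^ 2 + φ.pderiv (i+2) x c ^ 2 ≤ gradSq φ x := by
    intro c
    refine le_trans ?_ (φ.gr_sq_le c x)
    have : ∑ j, φ.gr c x j ^ 2 = φ.pderiv (i+1) x c ^ 2 + φ.pderiv (i+2) x c ^ 2 + φ.pderiv i x c ^ 2 := by
      simp only [gr, Fin.sum_univ_three]
      fin_cases i <;> simp <;> ring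
    nlinarith [sq_nonneg (φ.pderiv i x c)]
  linarith [h2 c, h2 d]

theorem AA_pow4 (φ : SkyrmeMap) (c d : Fin 4) (i : Fin 3) (x : R3) :
    φ.AA c d i x ^ 4 ≤ energyDensity φ x ^ 3 := by
  have h1 := φ.AA_sq_le c d i x
  have h2 := φ.AA_abs_le c d i x
  have h3 := φ.gradSq_nonneg x
  have h4 := φ.ASq_nonneg x
  have h5 : φ.AA c d i x ^ 2 ≤ energyDensity φ x := by unfold energyDensity; linarith
  have h6 : |φ.AA c d i x| ≤ energyDensity φ x := by unfold energyDensity; linarith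
  calc φ.AA c d i x ^ 4 = φ.AA c d i x ^ 2 * |φ.AA c d i x| ^ 2 := by rw [sq_abs]; ring
    _ ≤ energyDensity φ x * energyDensity φ x ^ 2 := by
        have := φ.e_nonneg x
        gcongr
    _ = _ := by ring

theorem MM_pow4 (φ : SkyrmeMap) (b c d : Fin 4) (x : R3) :
    φ.MM b c d x ^ 4 ≤ energyDensity φ x ^ 3 := by
  have h3 := φ.gradSq_nonneg x
  have h4 : ∀ c d, ∑ i, φ.AA c d i x ^ 2 ≤ energyDensity φ x := fun c d =>
    (φ.AA_sq_sum_le c d x).trans (by unfold energyDensity; linarith)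
  refine (m3_pow4 _ _ _).trans ?_
  have h1 := h4 b c
  have h2 := h4 c d
  have h5 := h4 b d
  simp only [AA] at h1 h2 h5
  calc _ ≤ energyDensity φ x * energyDensity φ x * energyDensity φ x := by
        have := φ.e_nonneg x
        gcongr
    _ = _ := by ring

theorem MM_abs_le (φ : SkyrmeMap) (b c d : Fin 4) (x : R3) :
    |φ.MM b c d x| ≤ energyDensity φ x := by
  refine (m3_abs_le _ _ _).trans ?_
  have h1 := φ.gr_sq_le b x
  have h2 := φ.AA_sq_sum_le c d x
  simp only [AA] at h2
  have h3 := φ.gradSq_nonneg x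
  have h4 := φ.ASq_nonneg x
  unfold energyDensity; linarith

theorem Mc_pow4 (φ : SkyrmeMap) (a : Fin 4) (x : R3) :
    φ.Mc a x ^ 4 ≤ energyDensity φ x ^ 3 := by
  fin_cases a <;> simp [Mc, Even.neg_pow (show Even 4 by decide)] <;> exact φ.MM_pow4 _ _ _ x

theorem Mc_abs_le (φ : SkyrmeMap) (a : Fin 4) (x : R3) :
    |φ.Mc a x| ≤ energyDensity φ x := by
  fin_cases a <;> simp [Mc] <;> exact φ.MM_abs_le _ _ _ x

theorem pd_aesm (φ : SkyrmeMap) (i : Fin 3) (a : Fin 4) :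
    AEStronglyMeasurable (fun x => φ.pderiv i x a) volume := by
  have h := (φ.pderiv_locInt i).aestronglyMeasurable
  exact (continuous_apply a).comp_aestronglyMeasurable h

theorem c_aesm (φ : SkyrmeMap) (a : Fin 4) : AEStronglyMeasurable (fun x => φ.toFun x a) volume :=
  ((measurable_pi_apply a).comp φ.meas).aestronglyMeasurable

theorem c_bdd (φ : SkyrmeMap) : ∀ᵐ x, ∀ a, |φ.toFun x a| ≤ 1 := by
  filter_upwards [φ.sphere] with x hx a
  have : φ.toFun x a * φ.toFun x a ≤ nsq (φ.toFun x) :=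
    Finset.single_le_sum (f := fun a => φ.toFun x a * φ.toFun x a)
      (fun i _ => mul_self_nonneg _) (Finset.mem_univ a)
  rw [hx] at this
  exact abs_le_one_iff_mul_self_le_one.2 this

theorem c_bdd' (φ : SkyrmeMap) (a : Fin 4) : ∀ᵐ x, |φ.toFun x a| ≤ 1 :=
  φ.c_bdd.mono fun _ h => h a

theorem c_l2 (φ : SkyrmeMap) (a : Fin 4) : L2loc (fun x => φ.toFun x a) :=
  L2loc_of_bdd (φ.c_aesm a) (φ.c_bdd' a)

theorem gradSq_aesm (φ : SkyrmeMap) : AEStronglyMeasurable (gradSq φ) volume := by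
  have : gradSq φ = fun x => ∑ a, ∑ i, φ.pderiv i x a ^ 2 := by
    ext x; rw [← gr_sq_sum]; rfl
  rw [this]
  exact Finset.aestronglyMeasurable_fun_sum _ fun a _ =>
    Finset.aestronglyMeasurable_fun_sum _ fun i _ => (φ.pd_aesm i a).pow 2

theorem AA_aesm (φ : SkyrmeMap) (c d : Fin 4) (i : Fin 3) :
    AEStronglyMeasurable (φ.AA c d i) volume :=
  ((φ.pd_aesm _ _).mul (φ.pd_aesm _ _)).sub ((φ.pd_aesm _ _).mul (φ.pd_aesm _ _))

theorem MM_aesm (φ : SkyrmeMap) (b c d : Fin 4) :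
    AEStronglyMeasurable (φ.MM b c d) volume := by
  unfold MM m3
  exact Finset.aestronglyMeasurable_fun_sum _ fun i _ => (φ.pd_aesm i b).mul (φ.AA_aesm c d i)

theorem Mc_aesm (φ : SkyrmeMap) (a : Fin 4) : AEStronglyMeasurable (φ.Mc a) volume := by
  fin_cases a
  · exact φ.MM_aesm 1 2 3
  · exact (φ.MM_aesm 0 2 3).neg
  · exact φ.MM_aesm 0 1 3
  · exact (φ.MM_aesm 0 1 2).neg

theorem det_aesm (φ : SkyrmeMap) : AEStronglyMeasurable (detDen φ) volume := by
  have : detDen φ = fun x => ∑ a, φ.toFun x a * φ.Mc a x := by ext x; exact φ.detDen_eq x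
  rw [this]
  exact Finset.aestronglyMeasurable_fun_sum _ fun i _ => (φ.c_aesm i).mul (φ.Mc_aesm i)

theorem gradSq_int {φ : SkyrmeMap} (h : memX φ) : Integrable (gradSq φ) volume := by
  refine Integrable.mono' h φ.gradSq_aesm (Eventually.of_forall fun x => ?_)
  rw [Real.norm_eq_abs, abs_of_nonneg (φ.gradSq_nonneg x)]
  unfold energyDensity; linarith [φ.ASq_nonneg x]

theorem ASq_int {φ : SkyrmeMap} (h : memX φ) : Integrable (ASq φ) volume := by
  refine (Integrable.sub h (gradSq_int h)).congr (Eventually.of_forall fun x => ?_)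
  simp [energyDensity]

theorem pd_memLp {φ : SkyrmeMap} (h : memX φ) (i : Fin 3) (a : Fin 4) :
    MemLp (fun x => φ.pderiv i x a) 2 volume := by
  rw [memLp_two_iff_integrable_sq (φ.pd_aesm i a)]
  refine Integrable.mono' (gradSq_int h) ((φ.pd_aesm i a).pow 2) (Eventually.of_forall fun x => ?_)
  rw [Real.norm_eq_abs, abs_of_nonneg (sq_nonneg _)]
  exact φ.gr_sq_le' a i x

theorem AA_memLp {φ : SkyrmeMap} (h : memX φ) (c d : Fin 4) (i : Fin 3) :
    MemLp (φ.AA c d i) 2 volume := by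
  rw [memLp_two_iff_integrable_sq (φ.AA_aesm c d i)]
  refine Integrable.mono' (ASq_int h) ((φ.AA_aesm c d i).pow 2) (Eventually.of_forall fun x => ?_)
  rw [Real.norm_eq_abs, abs_of_nonneg (sq_nonneg _)]
  exact φ.AA_sq_le c d i x

theorem AA_int {φ : SkyrmeMap} (h : memX φ) (c d : Fin 4) (i : Fin 3) :
    Integrable (φ.AA c d i) volume :=
  Integrable.mono' (gradSq_int h) (φ.AA_aesm c d i) (Eventually.of_forall fun x => φ.AA_abs_le c d i x)

theorem MM_int {φ : SkyrmeMap} (h : memX φ) (b c d : Fin 4) : Integrable (φ.MM b c d) volume :=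
  Integrable.mono' h (φ.MM_aesm b c d) (Eventually.of_forall fun x => φ.MM_abs_le b c d x)

theorem Mc_int {φ : SkyrmeMap} (h : memX φ) (a : Fin 4) : Integrable (φ.Mc a) volume :=
  Integrable.mono' h (φ.Mc_aesm a) (Eventually.of_forall fun x => φ.Mc_abs_le a x)

theorem det_abs_le (φ : SkyrmeMap) : ∀ᵐ x, |detDen φ x| ≤ 4 * energyDensity φ x := by
  filter_upwards [φ.c_bdd] with x hx
  rw [detDen_eq]
  calc _ ≤ ∑ a, |φ.toFun x a * φ.Mc a x| := Finset.abs_sum_le_sum_abs _ _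
    _ ≤ ∑ a : Fin 4, energyDensity φ x := by
      refine Finset.sum_le_sum fun a _ => ?_
      rw [abs_mul]
      calc _ ≤ 1 * energyDensity φ x := by gcongr; exacts [hx a, φ.Mc_abs_le a x]
        _ = _ := one_mul _
    _ = _ := by simp

theorem det_int {φ : SkyrmeMap} (h : memX φ) : Integrable (detDen φ) volume :=
  Integrable.mono' (h.const_mul 4) φ.det_aesm φ.det_abs_le

theorem wd {φ : SkyrmeMap} (h : memX φ) (a : Fin 4) :
    WD (fun x => φ.toFun x a) (fun i x => φ.pderiv i x a) :=
  ⟨φ.c_l2 a, fun i => L2loc_of_memLp (pd_memLp h i a), fun i ψ hψ => φ.weak i a ψ hψ⟩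

end SkyrmeMap

end

section

abbrev pd4 (e : Fin 4) (F : R4 → ℝ) (y : R4) : ℝ := fderiv ℝ F y (Pi.single e 1)

theorem contDiff_pd4 {F : R4 → ℝ} (h : ContDiff ℝ (⊤ : ℕ∞) F) (i : Fin 4) :
    ContDiff ℝ (⊤ : ℕ∞) (pd4 i F) :=
  (h.fderiv_right (m := (⊤ : ℕ∞)) (by simp)).clm_apply contDiff_const

theorem fderiv_eq_sum4 {F : R4 → ℝ} (y v : R4) : fderiv ℝ F y v = ∑ e, pd4 e F y * v e := by
  conv_lhs => rw [pi_eq_sum_univ' v]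
  rw [map_sum]
  refine Finset.sum_congr rfl fun e _ => ?_
  rw [map_smul, smul_eq_mul, mul_comm]

theorem pd_comp4 {F : R4 → ℝ} {U : R3 → R4} (hF : ContDiff ℝ (⊤ : ℕ∞) F)
    (hU : ∀ a, ContDiff ℝ (⊤ : ℕ∞) (fun x => U x a)) (i : Fin 3) (x : R3) :
    pd i (fun x => F (U x)) x = ∑ e, pd4 e F (U x) * pd i (fun x => U x e) x := by
  have hU' : DifferentiableAt ℝ U x :=
    differentiableAt_pi.2 fun a => (hU a).differentiable (by simp) x
  have hF' : DifferentiableAt ℝ F (U x) := hF.differentiable (by simp) _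
  have h1 : HasFDerivAt (fun x => F (U x)) _ x := hF'.hasFDerivAt.comp x hU'.hasFDerivAt
  show fderiv ℝ (fun x => F (U x)) x _ = _
  rw [h1.fderiv, ContinuousLinearMap.comp_apply, fderiv_eq_sum4]
  refine Finset.sum_congr rfl fun e _ => ?_
  congr 1
  have h2 := hasFDerivAt_pi'.1 hU'.hasFDerivAt e
  show _ = fderiv ℝ (fun x => U x e) x _
  rw [h2.fderiv]; rfl

theorem IsTestFun.bc_mul {χ w : R3 → ℝ} {R C C' : ℝ} (h : BC R C χ) (hC : 0 ≤ C)
    (hw : AEStronglyMeasurable w volume) (hb : ∀ᵐ x, |w x| ≤ C') : BC R (C * C') (fun x => χ x * w x) := by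
  refine ⟨h.meas.mul hw, ?_, fun x hx => by simp [h.supp x hx]⟩
  filter_upwards [h.bdd, hb] with x h1 h2
  rw [abs_mul]
  gcongr

theorem L2conv_const {ι : Type*} {l : Filter ι} (f : R3 → ℝ) : L2conv l (fun _ => f) f := by
  intro R; simpa using tendsto_const_nhds

theorem bdd_on_cube {G : R4 → ℝ} (hG : Continuous G) :
    ∃ C, 0 ≤ C ∧ ∀ y : R4, (∀ a, |y a| ≤ 1) → |G y| ≤ C := by
  obtain ⟨C, hC⟩ := (isCompact_closedBall (0 : R4) 1).exists_bound_of_continuousOn hG.continuousOn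
  refine ⟨C, (norm_nonneg _).trans (hC 0 (by simp)), fun y hy => hC y ?_⟩
  rw [mem_closedBall_zero_iff, pi_norm_le_iff_of_nonneg (by norm_num)]
  exact hy

namespace SkyrmeMap

def mphi (φ : SkyrmeMap) (n : ℕ) (x : R3) : R4 := fun a => moll n (fun x => φ.toFun x a) x

theorem mphi_contDiff (φ : SkyrmeMap) (n : ℕ) (a : Fin 4) :
    ContDiff ℝ (⊤ : ℕ∞) (fun x => φ.mphi n x a) := moll_contDiff n (φ.c_l2 a).locInt

theorem mphi_bdd (φ : SkyrmeMap) (n : ℕ) (x : R3) (a : Fin 4) : |φ.mphi n x a| ≤ 1 :=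
  moll_bound n (φ.c_l2 a).locInt (φ.c_bdd' a) x

theorem mphi_tendsto (φ : SkyrmeMap) : ∀ᵐ x, Tendsto (fun n => φ.mphi n x) atTop (𝓝 (φ.toFun x)) := by
  have h : ∀ᵐ x, ∀ a, Tendsto (fun n => moll n (fun x => φ.toFun x a) x) atTop (𝓝 (φ.toFun x a)) :=
    ae_all_iff.2 fun a => moll_ae_tendsto (φ.c_l2 a).locInt
  filter_upwards [h] with x hx
  exact tendsto_pi_nhds.2 hx

theorem comp_aesm (φ : SkyrmeMap) {G : R4 → ℝ} (hG : Continuous G) :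
    AEStronglyMeasurable (fun x => G (φ.toFun x)) volume :=
  (hG.measurable.comp φ.meas).aestronglyMeasurable

theorem K_aux {φ : SkyrmeMap} (h : memX φ) {F : R4 → ℝ} (hF : ContDiff ℝ (⊤ : ℕ∞) F)
    {χ : R3 → ℝ} (hχ : IsTestFun χ) (c d : Fin 4) :
    ∑ i, ((∫ x, (pd i χ x * F (φ.toFun x)) * (1 * φ.AA c d i x))
      + ∑ e, ∫ x, (χ x * pd4 e F (φ.toFun x)) * (φ.pderiv i x e * φ.AA c d i x)) = 0 := by
  have hcU : ∀ n, Continuous (φ.mphi n) := fun n =>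
    continuous_pi fun a => (φ.mphi_contDiff n a).continuous
  have hA : ∀ i, L2loc (φ.AA c d i) := fun i => L2loc_of_memLp (AA_memLp h c d i)
  have one : L2loc (fun _ => (1:ℝ)) := continuous_const.l2loc
  have lim : ∀ (G : R4 → ℝ), Continuous G → ∀ (χ : R3 → ℝ), IsTestFun χ →
      ∀ (f : ℕ → R3 → ℝ) (f' : R3 → ℝ), L2conv atTop f f' → (∀ n, L2loc (f n)) → L2loc f' → ∀ i,
      Tendsto (fun n => ∫ x, (χ x * G (φ.mphi n x)) * (f n x * φ.AA c d i x)) atTop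
        (𝓝 (∫ x, (χ x * G (φ.toFun x)) * (f' x * φ.AA c d i x))) := by
    intro G hG χ hχ f f' hff hf hf' i
    obtain ⟨R, C, hC, hb⟩ := hχ.exists_bc
    obtain ⟨C', hC', hb'⟩ := bdd_on_cube hG
    refine tendsto_wfg (C := C * C') (R := R) (by positivity) (fun n => ?_) ?_ hff hf hf' (hA i)
    · exact IsTestFun.bc_mul hb hC (hG.comp (hcU n)).aestronglyMeasurable
        (Eventually.of_forall fun x => hb' _ (φ.mphi_bdd n x))
    · filter_upwards [φ.mphi_tendsto] with x hx
      exact ((hG.tendsto _).comp hx).const_mul _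
  have key : ∀ n, ∑ i, ((∫ x, (pd i χ x * F (φ.mphi n x)) * (1 * φ.AA c d i x))
      + ∑ e, ∫ x, (χ x * pd4 e F (φ.mphi n x)) *
        (moll n (fun x => φ.pderiv i x e) x * φ.AA c d i x)) = 0 := by
    intro n
    have hFU : ContDiff ℝ (⊤ : ℕ∞) (fun x => F (φ.mphi n x)) :=
      hF.comp (contDiff_pi.2 (φ.mphi_contDiff n))
    have h1 := div_free (wd h c) (wd h d) (hχ.mul_right hFU)
    rw [← h1]
    refine Finset.sum_congr rfl fun i _ => ?_
    have hi1 : Integrable (fun x => (pd i χ x * F (φ.mphi n x)) * (1 * φ.AA c d i x)) volume :=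
      ((hχ.pd i).mul_right hFU).int_mul2 one (hA i)
    have hi2 : ∀ e, Integrable (fun x => (χ x * pd4 e F (φ.mphi n x)) *
        (moll n (fun x => φ.pderiv i x e) x * φ.AA c d i x)) volume := fun e =>
      (hχ.mul_right ((contDiff_pd4 hF e).comp (contDiff_pi.2 (φ.mphi_contDiff n)))).int_mul2
        (moll_l2loc n ((wd h e).hg i)) (hA i)
    rw [← integral_finsetSum _ (fun e _ => hi2 e), ← integral_add hi1
      (integrable_finsetSum _ (fun e _ => hi2 e))]
    congr 1; ext x
    rw [pd_mul hχ.1 hFU, pd_comp4 hF (φ.mphi_contDiff n)]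
    have : ∀ e, pd i (fun x => φ.mphi n x e) x = moll n (fun x => φ.pderiv i x e) x := fun e =>
      pd_moll n i (φ.c_l2 e).locInt ((wd h e).weak i) x
    simp only [this]
    rw [add_mul, Finset.mul_sum, Finset.sum_mul]
    congr 1
    · show _ = _ * φ.AA c d i x
      ring
    · refine Finset.sum_congr rfl fun e _ => ?_
      show _ = _ * φ.AA c d i x
      ring
  have hlim : Tendsto (fun n => ∑ i, ((∫ x, (pd i χ x * F (φ.mphi n x)) * (1 * φ.AA c d i x))
      + ∑ e, ∫ x, (χ x * pd4 e F (φ.mphi n x)) *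
        (moll n (fun x => φ.pderiv i x e) x * φ.AA c d i x))) atTop (𝓝 (
      ∑ i, ((∫ x, (pd i χ x * F (φ.toFun x)) * (1 * φ.AA c d i x))
      + ∑ e, ∫ x, (χ x * pd4 e F (φ.toFun x)) * (φ.pderiv i x e * φ.AA c d i x)))) := by
    refine tendsto_finsetSum _ fun i _ => Tendsto.add ?_ (tendsto_finsetSum _ fun e _ => ?_)
    · exact lim F hF.continuous _ (hχ.pd i) _ _ (L2conv_const _) (fun _ => one) one i
    · exact lim _ (contDiff_pd4 hF e).continuous _ hχ _ _ (moll_L2conv ((wd h e).hg i))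
        (fun n => moll_l2loc n ((wd h e).hg i)) ((wd h e).hg i) i
  simp only [key] at hlim
  exact (tendsto_nhds_unique hlim tendsto_const_nhds)

theorem comp_bdd (φ : SkyrmeMap) {G : R4 → ℝ} (hG : Continuous G) :
    ∃ C, 0 ≤ C ∧ ∀ᵐ x, |G (φ.toFun x)| ≤ C := by
  obtain ⟨C', hC', hb'⟩ := bdd_on_cube hG
  exact ⟨C', hC', φ.c_bdd.mono fun x hx => hb' _ hx⟩

theorem K_int1 {φ : SkyrmeMap} (h : memX φ) {G : R4 → ℝ} (hG : Continuous G)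
    {χ : R3 → ℝ} (hχ : IsTestFun χ) (c d : Fin 4) (i : Fin 3) (e : Fin 4) :
    Integrable (fun x => (χ x * G (φ.toFun x)) * (φ.pderiv i x e * φ.AA c d i x)) volume := by
  obtain ⟨R, C, hC, hb⟩ := hχ.exists_bc
  obtain ⟨C', hC', hb'⟩ := φ.comp_bdd hG
  exact (IsTestFun.bc_mul hb hC (φ.comp_aesm hG) hb').integrable_mul ((wd h e).hg i)
    (L2loc_of_memLp (AA_memLp h c d i))

theorem K_int2 {φ : SkyrmeMap} (h : memX φ) {G : R4 → ℝ} (hG : Continuous G)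
    {χ : R3 → ℝ} (hχ : IsTestFun χ) (c d : Fin 4) (i : Fin 3) :
    Integrable (fun x => (χ x * G (φ.toFun x)) * (1 * φ.AA c d i x)) volume := by
  obtain ⟨R, C, hC, hb⟩ := hχ.exists_bc
  obtain ⟨C', hC', hb'⟩ := φ.comp_bdd hG
  exact (IsTestFun.bc_mul hb hC (φ.comp_aesm hG) hb').integrable_mul continuous_const.l2loc
    (L2loc_of_memLp (AA_memLp h c d i))

theorem K_loc {φ : SkyrmeMap} (h : memX φ) {F : R4 → ℝ} (hF : ContDiff ℝ (⊤ : ℕ∞) F)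
    {χ : R3 → ℝ} (hχ : IsTestFun χ) (c d : Fin 4) :
    ∫ x, χ x * ∑ e, pd4 e F (φ.toFun x) * φ.MM e c d x
      = - ∫ x, F (φ.toFun x) * ∑ i, pd i χ x * φ.AA c d i x := by
  have h1 := K_aux h hF hχ c d
  rw [Finset.sum_add_distrib] at h1
  have e1 : ∑ i, (∫ x, (pd i χ x * F (φ.toFun x)) * (1 * φ.AA c d i x))
      = ∫ x, F (φ.toFun x) * ∑ i, pd i χ x * φ.AA c d i x := by
    rw [← integral_finsetSum _ (fun i _ => K_int2 h hF.continuous (hχ.pd i) c d i)]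
    congr 1; ext x
    rw [Finset.mul_sum]
    exact Finset.sum_congr rfl fun i _ => by ring
  have e2 : ∑ i, ∑ e, ∫ x, (χ x * pd4 e F (φ.toFun x)) * (φ.pderiv i x e * φ.AA c d i x)
      = ∫ x, χ x * ∑ e, pd4 e F (φ.toFun x) * φ.MM e c d x := by
    have hi := fun e i => K_int1 h (contDiff_pd4 hF e).continuous hχ c d i e
    simp_rw [← integral_finsetSum _ (fun e _ => hi e _)]
    rw [← integral_finsetSum _ (fun i _ => integrable_finsetSum _ (fun e _ => hi e i))]
    congr 1; ext x
    rw [Finset.sum_comm, Finset.mul_sum]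
    refine Finset.sum_congr rfl fun e _ => ?_
    rw [MM, m3, Finset.mul_sum, Finset.mul_sum]
    refine Finset.sum_congr rfl fun i _ => ?_
    simp only [AA, gr]; ring
  rw [e1, e2] at h1
  linarith

end SkyrmeMap

end

section

def etaB : ContDiffBump (0 : R3) := ⟨1, 2, by norm_num, by norm_num⟩
def eta (x : R3) : ℝ := etaB x

theorem eta_test : IsTestFun eta := ⟨etaB.contDiff, etaB.hasCompactSupport⟩

def cut (R : ℝ) (x : R3) : ℝ := eta (R⁻¹ • x)

theorem cut_contDiff (R : ℝ) : ContDiff ℝ (⊤ : ℕ∞) (cut R) :=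
  eta_test.1.comp (contDiff_const_smul R⁻¹)

theorem cut_zero {R : ℝ} (hR : 0 < R) {x : R3} (hx : 2 * R ≤ ‖x‖) : cut R x = 0 := by
  have : R⁻¹ • x ∉ Function.support etaB := by
    rw [etaB.support_eq, Metric.mem_ball, dist_zero_right, norm_smul, norm_inv,
      Real.norm_of_nonneg hR.le, not_lt]
    show 2 ≤ _
    rw [inv_mul_eq_div, le_div_iff₀ hR]; exact hx
  exact Function.notMem_support.1 this

theorem cut_one {R : ℝ} (hR : 0 < R) {x : R3} (hx : ‖x‖ ≤ R) : cut R x = 1 := by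
  apply etaB.one_of_mem_closedBall
  rw [Metric.mem_closedBall, dist_zero_right, norm_smul, norm_inv, Real.norm_of_nonneg hR.le]
  show _ ≤ 1
  rw [inv_mul_eq_div, div_le_one hR]; exact hx

theorem cut_nonneg (R : ℝ) (x : R3) : 0 ≤ cut R x := etaB.nonneg
theorem cut_le_one (R : ℝ) (x : R3) : cut R x ≤ 1 := etaB.le_one

theorem cut_test {R : ℝ} (hR : 0 < R) : IsTestFun (cut R) := by
  refine ⟨cut_contDiff R, HasCompactSupport.of_support_subset_isCompact
    (isCompact_closedBall (0 : R3) (2 * R)) fun x hx => ?_⟩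
  rw [mem_closedBall_zero_iff]
  by_contra h
  exact hx (cut_zero hR (not_le.1 h).le)

theorem pd_cut (R : ℝ) (i : Fin 3) (x : R3) : pd i (cut R) x = R⁻¹ * pd i eta (R⁻¹ • x) := by
  have hd : HasFDerivAt eta (fderiv ℝ eta (R⁻¹ • x)) (R⁻¹ • x) :=
    (eta_test.1.differentiable (by simp) _).hasFDerivAt
  have h4 : HasFDerivAt (cut R) _ x := hd.comp x ((hasFDerivAt_id x).const_smul R⁻¹)
  show fderiv ℝ (cut R) x _ = _
  rw [h4.fderiv]
  simp [pd]

theorem IsTestFun.pd_bdd {ψ : R3 → ℝ} (h : IsTestFun ψ) : ∃ C, 0 ≤ C ∧ ∀ i x, |_root_.pd i ψ x| ≤ C := by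
  have : ∀ i, ∃ C, ∀ x, ‖_root_.pd i ψ x‖ ≤ C := fun i =>
    (h.pd i).2.exists_bound_of_continuous (h.pd i).1.continuous
  choose C hC using this
  refine ⟨∑ i, |C i|, by positivity, fun i x => (hC i x).trans ((le_abs_self _).trans ?_)⟩
  exact Finset.single_le_sum (f := fun i => |C i|) (fun i _ => abs_nonneg _) (Finset.mem_univ i)

theorem pd_cut_bdd : ∃ C, 0 ≤ C ∧ ∀ R : ℝ, 0 < R → ∀ i x, |pd i (cut R) x| ≤ C / R := by
  obtain ⟨C, hC, h⟩ := eta_test.pd_bdd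
  refine ⟨C, hC, fun R hR i x => ?_⟩
  rw [pd_cut, abs_mul, abs_of_pos (inv_pos.2 hR), inv_mul_eq_div]
  gcongr
  exact h i _

/-- cutoff limit -/
theorem cut_tendsto {f : R3 → ℝ} (hf : Integrable f volume) :
    Tendsto (fun n : ℕ => ∫ x, cut (n + 1) x * f x) atTop (𝓝 (∫ x, f x)) := by
  refine tendsto_integral_of_dominated_convergence (fun x => |f x|) (fun n => ?_) hf.abs
    (fun n => Eventually.of_forall fun x => ?_) (Eventually.of_forall fun x => ?_)
  · exact (cut_contDiff _).continuous.aestronglyMeasurable.mul hf.1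
  · rw [Real.norm_eq_abs, abs_mul, abs_of_nonneg (cut_nonneg _ _)]
    exact mul_le_of_le_one_left (abs_nonneg _) (cut_le_one _ _)
  · obtain ⟨N, hN⟩ := exists_nat_ge ‖x‖
    refine tendsto_const_nhds.congr' ?_
    filter_upwards [eventually_ge_atTop N] with n hn
    have : (N:ℝ) ≤ n := by exact_mod_cast hn
    rw [cut_one (by positivity) (by linarith), one_mul]

namespace SkyrmeMap

theorem comp_mul_int (φ : SkyrmeMap) {G : R4 → ℝ} (hG : Continuous G) {f : R3 → ℝ}
    (hf : Integrable f volume) : Integrable (fun x => G (φ.toFun x) * f x) volume := by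
  obtain ⟨C, hC, hb⟩ := φ.comp_bdd hG
  exact hf.bdd_mul (c := C) (φ.comp_aesm hG) (by simpa using hb)

theorem K_glob {φ : SkyrmeMap} (h : memX φ) {F : R4 → ℝ} (hF : ContDiff ℝ (⊤ : ℕ∞) F)
    (c d : Fin 4) :
    ∫ x, ∑ e, pd4 e F (φ.toFun x) * φ.MM e c d x = 0 := by
  have hi : Integrable (fun x => ∑ e, pd4 e F (φ.toFun x) * φ.MM e c d x) volume :=
    integrable_finsetSum _ fun e _ => φ.comp_mul_int (contDiff_pd4 hF e).continuous (MM_int h e c d)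
  have h1 := cut_tendsto hi
  have h2 : ∀ n : ℕ, _ := fun n => K_loc h hF (cut_test (R := (n:ℝ) + 1) (by positivity)) c d
  simp only [h2] at h1
  obtain ⟨C, hC, hcb⟩ := pd_cut_bdd
  obtain ⟨C', hC', hb'⟩ := φ.comp_bdd hF.continuous
  have hAi : Integrable (fun x => ∑ i, |φ.AA c d i x|) volume :=
    integrable_finsetSum _ fun i _ => (AA_int h c d i).abs
  have h3 : Tendsto (fun n : ℕ => - ∫ x, F (φ.toFun x) * ∑ i, pd i (cut ((n:ℝ) + 1)) x * φ.AA c d i x)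
      atTop (𝓝 0) := by
    have h4 : Tendsto (fun n : ℕ => (1 / ((n:ℝ) + 1)) * (C * C' * ∫ x, ∑ i, |φ.AA c d i x|))
        atTop (𝓝 0) := by
      simpa using tendsto_one_div_add_atTop_nhds_zero_nat.mul_const
        (C * C' * ∫ x, ∑ i, |φ.AA c d i x|)
    refine squeeze_zero_norm (fun n => ?_) h4
    rw [norm_neg]
    have e : (1 / ((n:ℝ) + 1)) * (C * C' * ∫ x, ∑ i, |φ.AA c d i x|)
        = ∫ x, C' * (C / ((n:ℝ)+1)) * ∑ i, |φ.AA c d i x| := by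
      rw [integral_const_mul]; ring
    rw [e]
    refine norm_integral_le_of_norm_le (hAi.const_mul _) ?_
    filter_upwards [hb'] with x hx
    rw [Real.norm_eq_abs, abs_mul, mul_assoc]
    gcongr
    rw [Finset.mul_sum]
    refine (Finset.abs_sum_le_sum_abs _ _).trans (Finset.sum_le_sum fun i _ => ?_)
    rw [abs_mul]
    gcongr
    exact hcb _ (by positivity) i x
  exact tendsto_nhds_unique h1 h3

theorem Kp_pt (a b : Fin 4) : ∃ (s : ℝ) (c d : Fin 4), ∀ (φ : SkyrmeMap) (v : Fin 4 → ℝ) (x : R3),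
    v a * φ.Mc b x - v b * φ.Mc a x = s * ∑ e, v e * φ.MM e c d x := by
  have key : ∀ a b : Fin 4, a < b → ∃ (s : ℝ) (c d : Fin 4), ∀ (φ : SkyrmeMap) (v : Fin 4 → ℝ) (x : R3),
    v a * φ.Mc b x - v b * φ.Mc a x = s * ∑ e, v e * φ.MM e c d x := by
    intro a b hab
    fin_cases a <;> fin_cases b <;> simp at hab
    · refine ⟨-1, 2, 3, fun φ v x => ?_⟩
      simp [Mc, MM, m3, cr, Fin.sum_univ_four, Fin.sum_univ_three]; ring
    · refine ⟨1, 1, 3, fun φ v x => ?_⟩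
      simp [Mc, MM, m3, cr, Fin.sum_univ_four, Fin.sum_univ_three]; ring
    · refine ⟨-1, 1, 2, fun φ v x => ?_⟩
      simp [Mc, MM, m3, cr, Fin.sum_univ_four, Fin.sum_univ_three]; ring
    · refine ⟨-1, 0, 3, fun φ v x => ?_⟩
      simp [Mc, MM, m3, cr, Fin.sum_univ_four, Fin.sum_univ_three]; ring
    · refine ⟨1, 0, 2, fun φ v x => ?_⟩
      simp [Mc, MM, m3, cr, Fin.sum_univ_four, Fin.sum_univ_three]; ring
    · refine ⟨-1, 0, 1, fun φ v x => ?_⟩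
      simp [Mc, MM, m3, cr, Fin.sum_univ_four, Fin.sum_univ_three]; ring
  rcases lt_trichotomy a b with hab | hab | hab
  · exact key a b hab
  · subst hab; exact ⟨0, 0, 0, fun φ v x => by simp⟩
  · obtain ⟨s, c, d, hs⟩ := key b a hab
    refine ⟨-s, c, d, fun φ v x => ?_⟩
    have := hs φ v x
    linarith

theorem K' {φ : SkyrmeMap} (h : memX φ) {F : R4 → ℝ} (hF : ContDiff ℝ (⊤ : ℕ∞) F)
    (a b : Fin 4) :
    ∫ x, (pd4 a F (φ.toFun x) * φ.Mc b x - pd4 b F (φ.toFun x) * φ.Mc a x) = 0 := by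
  obtain ⟨s, c, d, hs⟩ := Kp_pt a b
  have : ∀ x, pd4 a F (φ.toFun x) * φ.Mc b x - pd4 b F (φ.toFun x) * φ.Mc a x
      = s * ∑ e, pd4 e F (φ.toFun x) * φ.MM e c d x := fun x =>
    hs φ (fun e => pd4 e F (φ.toFun x)) x
  simp only [this]
  rw [integral_const_mul, K_glob h hF, mul_zero]

/-- each cofactor is a divergence -/
theorem Mc_eq_MM (a : Fin 4) : ∃ (s : ℝ) (b c d : Fin 4), |s| = 1 ∧ ∀ (φ : SkyrmeMap) (x : R3),
    φ.Mc a x = s * φ.MM b c d x := by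
  fin_cases a
  · exact ⟨1, 1, 2, 3, by simp, fun φ x => by simp [Mc]⟩
  · exact ⟨-1, 0, 2, 3, by simp, fun φ x => by simp [Mc]⟩
  · exact ⟨1, 0, 1, 3, by simp, fun φ x => by simp [Mc]⟩
  · exact ⟨-1, 0, 1, 2, by simp, fun φ x => by simp [Mc]⟩

theorem MM_parts {φ : SkyrmeMap} (h : memX φ) {χ : R3 → ℝ} (hχ : IsTestFun χ) (b c d : Fin 4)
    (k : ℝ) : ∫ x, χ x * φ.MM b c d x
      = - ∫ x, (φ.toFun x b - k) * ∑ i, pd i χ x * φ.AA c d i x := by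
  have hF : ContDiff ℝ (⊤ : ℕ∞) (fun y : R4 => y b - k) := by fun_prop
  rw [← K_loc h hF hχ c d]
  congr 1; ext x
  congr 1
  have : ∀ e, pd4 e (fun y : R4 => y b - k) (φ.toFun x) = if e = b then 1 else 0 := by
    intro e
    have h1 : HasFDerivAt (fun y : R4 => y b - k) (ContinuousLinearMap.proj (R := ℝ) b) (φ.toFun x) :=
      (hasFDerivAt_apply b _).sub_const k
    show fderiv ℝ _ _ _ = _
    rw [h1.fderiv]
    simp [Pi.single_apply, eq_comm]
  simp [this]

end SkyrmeMap

end

section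

theorem lint_affine {H : R3 → ℝ≥0∞} (hH : Measurable H) (a : R3) {t : ℝ} (ht : 1/2 ≤ t) :
    ∫⁻ x, H (a + t • x) ≤ 8 * ∫⁻ x, H x := by
  have ht0 : t ≠ 0 := by linarith
  have h1 : ∫⁻ x, H (a + t • x) = ∫⁻ y, H (a + y) ∂(Measure.map (fun x : R3 => t • x) volume) := by
    rw [lintegral_map (by fun_prop) (by fun_prop)]
  rw [h1, Measure.map_addHaar_smul _ ht0, lintegral_smul_measure,
    lintegral_add_left_eq_self (fun y => H y) a, smul_eq_mul]
  gcongr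
  rw [show (8:ℝ≥0∞) = ENNReal.ofReal 8 by norm_num]
  apply ENNReal.ofReal_le_ofReal
  have : Module.finrank ℝ R3 = 3 := by simp
  rw [this, abs_of_nonneg (by positivity), ← inv_inv (8:ℝ)]
  apply inv_anti₀ (by norm_num)
  calc (8:ℝ)⁻¹ = (1/2)^3 := by norm_num
    _ ≤ t ^ 3 := by gcongr

theorem lint_seg {S : Set R3} (hS : MeasurableSet S) {H : R3 → ℝ≥0∞} (hH : Measurable H) :
    ∫⁻ x in S, ∫⁻ z in S, ∫⁻ t in Set.Icc (0:ℝ) 1, H (z + t • (x - z))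
      ≤ 8 * volume S * ∫⁻ x, H x := by
  have m1 : Measurable (fun p : (R3 × R3) × ℝ => H (p.1.2 + p.2 • (p.1.1 - p.1.2))) := by fun_prop
  have e1 : ∀ x : R3, ∫⁻ z in S, ∫⁻ t in Set.Icc (0:ℝ) 1, H (z + t • (x - z))
      = ∫⁻ t in Set.Icc (0:ℝ) 1, ∫⁻ z in S, H (z + t • (x - z)) := by
    intro x
    apply lintegral_lintegral_swap
    have : Measurable (fun p : R3 × ℝ => H (p.1 + p.2 • (x - p.1))) := by fun_prop
    exact this.aemeasurable
  simp only [e1]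
  rw [lintegral_lintegral_swap (f := fun x t => ∫⁻ z in S, H (z + t • (x - z)))]
  · have hb : ∀ t ∈ Set.Icc (0:ℝ) 1, ∫⁻ x in S, ∫⁻ z in S, H (z + t • (x - z))
        ≤ 8 * volume S * ∫⁻ x, H x := by
      intro t ht
      rcases le_total (1/2) t with h | h
      · rw [lintegral_lintegral_swap (f := fun x z => H (z + t • (x - z)))]
        · calc _ ≤ ∫⁻ z in S, 8 * ∫⁻ x, H x := by
                refine lintegral_mono fun z => ?_
                refine (setLIntegral_le_lintegral _ _).trans ?_
                have := lint_affine hH (z - t • z) h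
                refine le_trans (le_of_eq ?_) this
                congr 1; ext x; congr 1; rw [smul_sub]; abel
            _ = _ := by rw [lintegral_const, Measure.restrict_apply_univ]; ring
        · have : Measurable (fun p : R3 × R3 => H (p.2 + t • (p.1 - p.2))) := by fun_prop
          exact this.aemeasurable
      · calc _ ≤ ∫⁻ x in S, 8 * ∫⁻ x, H x := by
                refine lintegral_mono fun x => ?_
                refine (setLIntegral_le_lintegral _ _).trans ?_
                have := lint_affine hH (t • x) (t := 1 - t) (by linarith)
                refine le_trans (le_of_eq ?_) this
                congr 1; ext z; congr 1; rw [smul_sub, sub_smul, one_smul]; abel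
          _ = _ := by rw [lintegral_const, Measure.restrict_apply_univ]; ring
    calc _ ≤ ∫⁻ t in Set.Icc (0:ℝ) 1, 8 * volume S * ∫⁻ x, H x :=
          setLIntegral_mono' measurableSet_Icc hb
      _ = _ := by rw [lintegral_const, Measure.restrict_apply_univ]; simp
  · have : Measurable (fun p : R3 × ℝ => ∫⁻ z in S, H (z + p.2 • (p.1 - z))) := by
      have m2 : Measurable (fun p : (R3 × ℝ) × R3 => H (p.2 + p.1.2 • (p.1.1 - p.2))) := by fun_prop
      exact m2.lintegral_prod_right'
    exact this.aemeasurable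

theorem fderiv_eq_sum3 {F : R3 → ℝ} (y v : R3) : fderiv ℝ F y v = ∑ e, pd e F y * v e := by
  conv_lhs => rw [pi_eq_sum_univ' v]
  rw [map_sum]
  refine Finset.sum_congr rfl fun e _ => ?_
  rw [map_smul, smul_eq_mul, mul_comm]

theorem seg_bound {u : R3 → ℝ} (hu : ContDiff ℝ (⊤ : ℕ∞) u) (x z : R3) :
    ‖u x - u z‖ₑ ≤ ∫⁻ t in Set.Icc (0:ℝ) 1, ‖x - z‖ₑ * ∑ i, ‖pd i u (z + t • (x - z))‖ₑ := by
  have hd : ∀ t : ℝ, HasDerivAt (fun t : ℝ => u (z + t • (x - z)))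
      (fderiv ℝ u (z + t • (x - z)) (x - z)) t := by
    intro t
    have h1 : HasFDerivAt u (fderiv ℝ u (z + t • (x - z))) (z + t • (x - z)) :=
      (hu.differentiable (by simp) _).hasFDerivAt
    have h2 : HasDerivAt (fun t : ℝ => z + t • (x - z)) (x - z) t := by
      have := ((hasDerivAt_id t).smul_const (x - z)).const_add z
      simpa using this
    exact h1.comp_hasDerivAt t h2
  have hc : Continuous (fun t : ℝ => fderiv ℝ u (z + t • (x - z)) (x - z)) := by
    have h1 : Continuous (fderiv ℝ u) := hu.continuous_fderiv (by simp)
    exact (h1.comp (by fun_prop)).clm_apply continuous_const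
  have h1 := intervalIntegral.integral_eq_sub_of_hasDerivAt (a := 0) (b := 1) (fun t _ => hd t)
    (hc.intervalIntegrable _ _)
  simp only [one_smul, zero_smul, add_zero, add_sub_cancel] at h1
  rw [← h1, intervalIntegral.integral_of_le zero_le_one]
  refine (enorm_integral_le_lintegral_enorm _).trans ?_
  rw [restrict_Ioc_eq_restrict_Icc]
  refine lintegral_mono fun t => ?_
  rw [fderiv_eq_sum3, Finset.mul_sum]
  refine (enorm_sum_le _ _).trans (Finset.sum_le_sum fun i _ => ?_)
  rw [enorm_mul, mul_comm]
  gcongr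
  rw [← ofReal_norm, ← ofReal_norm]
  exact ENNReal.ofReal_le_ofReal (norm_le_pi_norm (x - z) i)

theorem jensen_sq' {α : Type*} [MeasurableSpace α] {ν : Measure α} [IsProbabilityMeasure ν] {h : α → ℝ≥0∞}
    (hh : AEMeasurable h ν) : (∫⁻ t, h t ∂ν) ^ 2 ≤ ∫⁻ t, h t ^ 2 ∂ν := by
  have := ENNReal.lintegral_mul_le_Lp_mul_Lq ν Real.HolderConjugate.two_two hh
    (aemeasurable_const (b := (1:ℝ≥0∞)))
  simp only [Pi.mul_apply, mul_one, lintegral_const, measure_univ, one_pow, ENNReal.one_rpow,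
    ENNReal.rpow_two] at this
  calc (∫⁻ t, h t ∂ν) ^ 2 ≤ ((∫⁻ t, h t ^ 2 ∂ν) ^ (1/2:ℝ)) ^ 2 := by gcongr
    _ = _ := by
      rw [← ENNReal.rpow_natCast, ← ENNReal.rpow_mul]; norm_num

instance : IsProbabilityMeasure ((volume : Measure ℝ).restrict (Set.Icc (0:ℝ) 1)) :=
  ⟨by simp⟩

theorem sum3_sq_le (f : Fin 3 → ℝ≥0∞) : (∑ i, f i) ^ 2 ≤ 3 * ∑ i, f i ^ 2 := by
  by_cases h : ∀ i, f i ≠ ⊤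
  · lift f to Fin 3 → NNReal using h
    have := sq_sum_le_card_mul_sum_sq (s := Finset.univ) (f := f)
    simp only [Finset.card_univ, Fintype.card_fin] at this
    have h2 : (((∑ i, f i) ^ 2 : NNReal) : ℝ≥0∞) ≤ ((3 * ∑ i, f i ^ 2 : NNReal) : ℝ≥0∞) := by
      exact_mod_cast this
    push_cast at h2
    exact h2
  · push Not at h
    obtain ⟨i, hi⟩ := h
    have : ∑ i, f i ^ 2 = ⊤ := by
      rw [ENNReal.sum_eq_top]
      exact ⟨i, Finset.mem_univ _, by simp [hi]⟩
    rw [this]; simp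

theorem poinc_smooth1 {u : R3 → ℝ} (hu : ContDiff ℝ (⊤ : ℕ∞) u) {S : Set R3} (hS : MeasurableSet S)
    (hc : Convex ℝ S) {r : ℝ≥0∞} (hr : ∀ x ∈ S, ∀ z ∈ S, ‖x - z‖ₑ ≤ r) :
    ∫⁻ x in S, ∫⁻ z in S, ‖u x - u z‖ₑ ≤ 8 * r * volume S * ∑ i, ∫⁻ x in S, ‖pd i u x‖ₑ := by
  have hm : ∀ i, Measurable (pd i u) := fun i => (contDiff_pd hu i).continuous.measurable
  let H : R3 → ℝ≥0∞ := S.indicator (fun y => r * ∑ i, ‖pd i u y‖ₑ)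
  have hH : Measurable H := Measurable.indicator (by fun_prop) hS
  calc _ ≤ ∫⁻ x in S, ∫⁻ z in S, ∫⁻ t in Set.Icc (0:ℝ) 1, H (z + t • (x - z)) := by
        refine setLIntegral_mono' hS fun x hx => setLIntegral_mono' hS fun z hz => ?_
        refine (seg_bound hu x z).trans (setLIntegral_mono' measurableSet_Icc fun t ht => ?_)
        have : z + t • (x - z) ∈ S := hc.add_smul_sub_mem hz hx ht
        simp only [H, Set.indicator_of_mem this]
        gcongr
        exact hr x hx z hz
    _ ≤ _ := lint_seg hS hH
    _ = _ := by
      simp only [H]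
      rw [lintegral_indicator hS, lintegral_const_mul _ (by fun_prop),
        lintegral_finsetSum _ (fun i _ => by fun_prop)]
      ring

theorem poinc_smooth2 {u : R3 → ℝ} (hu : ContDiff ℝ (⊤ : ℕ∞) u) {S : Set R3} (hS : MeasurableSet S)
    (hc : Convex ℝ S) {r : ℝ≥0∞} (hr : ∀ x ∈ S, ∀ z ∈ S, ‖x - z‖ₑ ≤ r) :
    ∫⁻ x in S, ∫⁻ z in S, ‖u x - u z‖ₑ ^ 2
      ≤ 24 * r ^ 2 * volume S * ∑ i, ∫⁻ x in S, ‖pd i u x‖ₑ ^ 2 := by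
  have hm : ∀ i, Measurable (pd i u) := fun i => (contDiff_pd hu i).continuous.measurable
  let H : R3 → ℝ≥0∞ := S.indicator (fun y => r ^ 2 * (3 * ∑ i, ‖pd i u y‖ₑ ^ 2))
  have hH : Measurable H := Measurable.indicator (by fun_prop) hS
  calc _ ≤ ∫⁻ x in S, ∫⁻ z in S, ∫⁻ t in Set.Icc (0:ℝ) 1, H (z + t • (x - z)) := by
        refine setLIntegral_mono' hS fun x hx => setLIntegral_mono' hS fun z hz => ?_
        refine (pow_le_pow_left₀ zero_le (seg_bound hu x z) 2).trans ?_
        refine (jensen_sq' (by fun_prop)).trans (setLIntegral_mono' measurableSet_Icc fun t ht => ?_)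
        have : z + t • (x - z) ∈ S := hc.add_smul_sub_mem hz hx ht
        simp only [H, Set.indicator_of_mem this]
        rw [mul_pow]
        gcongr
        · exact hr x hx z hz
        · exact sum3_sq_le _
    _ ≤ _ := lint_seg hS hH
    _ = _ := by
      simp only [H]
      rw [lintegral_indicator hS, lintegral_const_mul _ (by fun_prop), lintegral_const_mul _ (by fun_prop),
        lintegral_finsetSum _ (fun i _ => by fun_prop)]
      ring

theorem fatou2 {ν : Measure R3} [SFinite ν] {u : R3 → ℝ} {U : ℕ → R3 → ℝ} (hU : ∀ n, Measurable (U n))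
    (h : ∀ᵐ x ∂ν, Tendsto (fun n => U n x) atTop (𝓝 (u x))) (p : ℕ) :
    ∫⁻ x, ∫⁻ z, ‖u x - u z‖ₑ ^ p ∂ν ∂ν
      ≤ liminf (fun n => ∫⁻ x, ∫⁻ z, ‖U n x - U n z‖ₑ ^ p ∂ν ∂ν) atTop := by
  have e1 : ∫⁻ x, ∫⁻ z, ‖u x - u z‖ₑ ^ p ∂ν ∂ν
      = ∫⁻ x, ∫⁻ z, liminf (fun n => ‖U n x - U n z‖ₑ ^ p) atTop ∂ν ∂ν := by
    apply lintegral_congr_ae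
    filter_upwards [h] with x hx
    apply lintegral_congr_ae
    filter_upwards [h] with z hz
    exact (ENNReal.Tendsto.pow (n := p) (hx.sub hz).enorm).liminf_eq.symm
  rw [e1]
  have m1 : ∀ n, Measurable (fun q : R3 × R3 => ‖U n q.1 - U n q.2‖ₑ ^ p) := fun n => by
    have := hU n
    fun_prop
  calc _ ≤ ∫⁻ x, liminf (fun n => ∫⁻ z, ‖U n x - U n z‖ₑ ^ p ∂ν) atTop ∂ν := by
        refine lintegral_mono fun x => lintegral_liminf_le fun n => ?_
        have := hU n
        fun_prop
    _ ≤ _ := lintegral_liminf_le fun n => (m1 n).lintegral_prod_right'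

theorem L2conv.lint {ι : Type*} {l : Filter ι} {f : ι → R3 → ℝ} {f' : R3 → ℝ} (h : L2conv l f f')
    (hf : ∀ n, L2loc (f n)) (hf' : L2loc f') (R : ℝ) :
    Tendsto (fun n => ∫⁻ x in QR R, ‖f n x - f' x‖ₑ ^ 2) l (𝓝 0) := by
  have h1 := h R
  have e : ∀ n, ∫⁻ x in QR R, ‖f n x - f' x‖ₑ ^ 2 = ENNReal.ofReal (∫ x in QR R, (f n x - f' x) ^ 2) := by
    intro n
    rw [ofReal_integral_eq_lintegral_ofReal (((hf n).sub hf') R).integrable_sq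
      (Eventually.of_forall fun x => sq_nonneg _)]
    congr 1; ext x
    rw [← sq_abs, ENNReal.ofReal_pow (abs_nonneg _), Real.enorm_eq_ofReal_abs]
  simp only [e]
  simpa using ENNReal.tendsto_ofReal h1

theorem L2conv.lint1 {ι : Type*} {l : Filter ι} {f : ι → R3 → ℝ} {f' : R3 → ℝ} (h : L2conv l f f')
    (hf : ∀ n, L2loc (f n)) (hf' : L2loc f') (R : ℝ) :
    Tendsto (fun n => ∫⁻ x in QR R, ‖f n x - f' x‖ₑ) l (𝓝 0) := by
  have h1 := h.lint hf hf' R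
  have hb : ∀ n, ∫⁻ x in QR R, ‖f n x - f' x‖ₑ ≤
      (∫⁻ x in QR R, ‖f n x - f' x‖ₑ ^ 2) ^ (1/2:ℝ) * (volume (QR R)) ^ (1/2:ℝ) := by
    intro n
    have := ENNReal.lintegral_mul_le_Lp_mul_Lq (volume.restrict (QR R)) Real.HolderConjugate.two_two
      (f := fun x => ‖f n x - f' x‖ₑ) (((hf n).sub hf') R).1.enorm
      (aemeasurable_const (b := (1:ℝ≥0∞)))
    simpa using this
  have hfin : (volume (QR R)) ^ (1/2:ℝ) ≠ ⊤ :=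
    ENNReal.rpow_ne_top_of_nonneg (by norm_num) measure_closedBall_lt_top.ne
  have h2 := ENNReal.Tendsto.mul_const (b := (volume (QR R)) ^ (1/2:ℝ))
    (((ENNReal.continuous_rpow_const (y := (1/2:ℝ))).tendsto 0).comp h1) (Or.inr hfin)
  simp only [Function.comp_def, one_div] at h2
  rw [ENNReal.zero_rpow_of_pos (by norm_num), zero_mul] at h2
  exact tendsto_of_tendsto_of_tendsto_of_le_of_le tendsto_const_nhds h2 (fun _ => zero_le)
    (fun n => by simpa using hb n)

theorem enorm_sq_le (a b : ℝ) : ‖a‖ₑ ^ 2 ≤ 2 * ‖b‖ₑ ^ 2 + 2 * ‖a - b‖ₑ ^ 2 := by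
  have h : ∀ c : ℝ, ‖c‖ₑ ^ 2 = ENNReal.ofReal (c ^ 2) := fun c => by
    rw [← sq_abs, ENNReal.ofReal_pow (abs_nonneg _), Real.enorm_eq_ofReal_abs]
  rw [h, h, h, show (2:ℝ≥0∞) = ENNReal.ofReal 2 by norm_num, ← ENNReal.ofReal_mul (by norm_num),
    ← ENNReal.ofReal_mul (by norm_num), ← ENNReal.ofReal_add (by positivity) (by positivity)]
  apply ENNReal.ofReal_le_ofReal
  nlinarith [sq_nonneg (b - (a - b))]

theorem liminf_le_of_tendsto' {f g : ℕ → ℝ≥0∞} {L : ℝ≥0∞} (h : ∀ n, f n ≤ g n)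
    (hg : Tendsto g atTop (𝓝 L)) : liminf f atTop ≤ L :=
  (liminf_le_liminf (Eventually.of_forall h)).trans hg.liminf_eq.le

theorem poinc2 {u : R3 → ℝ} {g : Fin 3 → R3 → ℝ} (hu : WD u g) {S : Set R3} (hS : MeasurableSet S)
    (hc : Convex ℝ S) (hb : Bornology.IsBounded S) {r : ℝ≥0∞} (hrt : r ≠ ⊤)
    (hr : ∀ x ∈ S, ∀ z ∈ S, ‖x - z‖ₑ ≤ r) :
    ∫⁻ x in S, ∫⁻ z in S, ‖u x - u z‖ₑ ^ 2
      ≤ 48 * r ^ 2 * volume S * ∑ i, ∫⁻ x in S, ‖g i x‖ₑ ^ 2 := by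
  obtain ⟨R, hR⟩ := hb.subset_closedBall (0 : R3)
  have hSv : volume S ≠ ⊤ := ((measure_mono hR).trans_lt measure_closedBall_lt_top).ne
  have hp : ∀ n i x, pd i (moll n u) x = moll n (g i) x := fun n i x =>
    pd_moll n i hu.hu.locInt (hu.weak i) x
  refine (fatou2 (U := fun n => moll n u) (fun n => (moll_contDiff n hu.hu.locInt).continuous.measurable)
    (ae_restrict_of_ae (moll_ae_tendsto hu.hu.locInt)) 2).trans ?_
  refine liminf_le_of_tendsto' (g := fun n => 24 * r ^ 2 * volume S *
      ∑ i, (2 * (∫⁻ x in S, ‖g i x‖ₑ ^ 2) + 2 * (∫⁻ x in QR R, ‖moll n (g i) x - g i x‖ₑ ^ 2)))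
    (fun n => ?_) ?_
  · refine (poinc_smooth2 (moll_contDiff n hu.hu.locInt) hS hc hr).trans ?_
    gcongr with i
    simp only [hp]
    calc _ ≤ ∫⁻ x in S, (2 * ‖g i x‖ₑ ^ 2 + 2 * ‖moll n (g i) x - g i x‖ₑ ^ 2) :=
          lintegral_mono fun x => enorm_sq_le _ _
      _ = 2 * (∫⁻ x in S, ‖g i x‖ₑ ^ 2) + 2 * (∫⁻ x in S, ‖moll n (g i) x - g i x‖ₑ ^ 2) := by
          rw [lintegral_add_left' (((hu.hg i).aesm.restrict.enorm.pow_const 2).const_mul 2),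
            lintegral_const_mul' _ _ (by norm_num), lintegral_const_mul' _ _ (by norm_num)]
      _ ≤ _ := by gcongr
  · have h1 : Tendsto (fun n => ∑ i, (2 * (∫⁻ x in S, ‖g i x‖ₑ ^ 2)
        + 2 * (∫⁻ x in QR R, ‖moll n (g i) x - g i x‖ₑ ^ 2))) atTop
        (𝓝 (∑ i, (2 * (∫⁻ x in S, ‖g i x‖ₑ ^ 2) + 2 * 0))) := by
      refine tendsto_finsetSum _ fun i _ => tendsto_const_nhds.add ?_
      exact ENNReal.Tendsto.const_mul ((moll_L2conv (hu.hg i)).lint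
        (fun n => moll_l2loc n (hu.hg i)) (hu.hg i) R) (Or.inr (by norm_num))
    have h2 := ENNReal.Tendsto.const_mul (a := 24 * r ^ 2 * volume S) h1
      (Or.inr (ENNReal.mul_ne_top (ENNReal.mul_ne_top (by norm_num) (ENNReal.pow_ne_top hrt)) hSv))
    convert h2 using 2
    simp only [mul_zero, add_zero, ← Finset.mul_sum]
    ring

theorem poinc1 {u : R3 → ℝ} {g : Fin 3 → R3 → ℝ} (hu : WD u g) {S : Set R3} (hS : MeasurableSet S)
    (hc : Convex ℝ S) (hb : Bornology.IsBounded S) {r : ℝ≥0∞} (hrt : r ≠ ⊤)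
    (hr : ∀ x ∈ S, ∀ z ∈ S, ‖x - z‖ₑ ≤ r) :
    ∫⁻ x in S, ∫⁻ z in S, ‖u x - u z‖ₑ
      ≤ 8 * r * volume S * ∑ i, ∫⁻ x in S, ‖g i x‖ₑ := by
  obtain ⟨R, hR⟩ := hb.subset_closedBall (0 : R3)
  have hSv : volume S ≠ ⊤ := ((measure_mono hR).trans_lt measure_closedBall_lt_top).ne
  have hp : ∀ n i x, pd i (moll n u) x = moll n (g i) x := fun n i x =>
    pd_moll n i hu.hu.locInt (hu.weak i) x
  have hf := (fatou2 (U := fun n => moll n u) (fun n => (moll_contDiff n hu.hu.locInt).continuous.measurable)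
    (ae_restrict_of_ae (μ := volume) (s := S) (moll_ae_tendsto hu.hu.locInt)) 1)
  simp only [pow_one] at hf
  refine hf.trans ?_
  refine liminf_le_of_tendsto' (g := fun n => 8 * r * volume S *
      ∑ i, ((∫⁻ x in S, ‖g i x‖ₑ) + (∫⁻ x in QR R, ‖moll n (g i) x - g i x‖ₑ)))
    (fun n => ?_) ?_
  · refine (poinc_smooth1 (moll_contDiff n hu.hu.locInt) hS hc hr).trans ?_
    gcongr with i
    simp only [hp]
    calc _ ≤ ∫⁻ x in S, (‖g i x‖ₑ + ‖moll n (g i) x - g i x‖ₑ) := by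
          refine lintegral_mono fun x => ?_
          refine le_trans (le_of_eq ?_) (enorm_add_le _ _)
          congr 1; ring
      _ = (∫⁻ x in S, ‖g i x‖ₑ) + (∫⁻ x in S, ‖moll n (g i) x - g i x‖ₑ) :=
          lintegral_add_left' (hu.hg i).aesm.restrict.enorm _
      _ ≤ _ := by gcongr
  · have h1 : Tendsto (fun n => ∑ i, ((∫⁻ x in S, ‖g i x‖ₑ)
        + (∫⁻ x in QR R, ‖moll n (g i) x - g i x‖ₑ))) atTop
        (𝓝 (∑ i, ((∫⁻ x in S, ‖g i x‖ₑ) + 0))) := by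
      refine tendsto_finsetSum _ fun i _ => tendsto_const_nhds.add ?_
      exact (moll_L2conv (hu.hg i)).lint1 (fun n => moll_l2loc n (hu.hg i)) (hu.hg i) R
    have h2 := ENNReal.Tendsto.const_mul (a := 8 * r * volume S) h1
      (Or.inr (ENNReal.mul_ne_top (ENNReal.mul_ne_top (by norm_num) hrt) hSv))
    simpa using h2

end

section

theorem enorm_sq_ofReal (c : ℝ) : ‖c‖ₑ ^ 2 = ENNReal.ofReal (c ^ 2) := by
  rw [← sq_abs, ENNReal.ofReal_pow (abs_nonneg _), Real.enorm_eq_ofReal_abs]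

theorem lint_sq_eq {α : Type*} [MeasurableSpace α] {μ : Measure α} {f : α → ℝ} (hf : MemLp f 2 μ) :
    ∫⁻ x, ‖f x‖ₑ ^ 2 ∂μ = ENNReal.ofReal (∫ x, f x ^ 2 ∂μ) := by
  rw [ofReal_integral_eq_lintegral_ofReal hf.integrable_sq (Eventually.of_forall fun x => sq_nonneg _)]
  simp only [enorm_sq_ofReal]

/-- average -/
def avg (S : Set R3) (u : R3 → ℝ) : ℝ := (volume.real S)⁻¹ * ∫ x in S, u x

theorem var_le {S : Set R3} (hv0 : volume S ≠ 0) (hvt : volume S ≠ ⊤) {u : R3 → ℝ}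
    (hu : MemLp u 2 (volume.restrict S)) :
    volume S * ∫⁻ x in S, ‖u x - avg S u‖ₑ ^ 2 ≤ ∫⁻ x in S, ∫⁻ z in S, ‖u x - u z‖ₑ ^ 2 := by
  have hfin : IsFiniteMeasure (volume.restrict S) := ⟨by simpa using hvt.lt_top⟩
  let P : Measure R3 := (volume S)⁻¹ • volume.restrict S
  have hP : IsProbabilityMeasure P := ⟨by simp [P, ENNReal.inv_mul_cancel hv0 hvt]⟩
  have hui : Integrable u (volume.restrict S) := hu.integrable (by norm_num)
  have huP : Integrable u P := hui.smul_measure (ENNReal.inv_ne_top.2 hv0)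
  have ha : avg S u = ∫ x, u x ∂P := by
    simp only [avg, P, integral_smul_measure, smul_eq_mul, ENNReal.toReal_inv, Measure.real]
  have key : ∀ x, volume S * ‖u x - avg S u‖ₑ ^ 2 ≤ ∫⁻ z in S, ‖u x - u z‖ₑ ^ 2 := by
    intro x
    have h1 : u x - avg S u = ∫ z, (u x - u z) ∂P := by
      rw [integral_sub (integrable_const _) huP, ha]; simp
    have h2 : ‖u x - avg S u‖ₑ ^ 2 ≤ ∫⁻ z, ‖u x - u z‖ₑ ^ 2 ∂P := by
      rw [h1]
      refine le_trans ?_ (jensen_sq' (ν := P) (h := fun z => ‖u x - u z‖ₑ) ?_)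
      · gcongr; exact enorm_integral_le_lintegral_enorm _
      · exact (aestronglyMeasurable_const.sub huP.1).enorm
    calc _ ≤ volume S * ∫⁻ z, ‖u x - u z‖ₑ ^ 2 ∂P := by gcongr
      _ = _ := by
        rw [lintegral_smul_measure, smul_eq_mul, ← mul_assoc, ENNReal.mul_inv_cancel hv0 hvt, one_mul]
  rw [← lintegral_const_mul' _ _ hvt]
  exact lintegral_mono key

theorem L2loc.on {f : R3 → ℝ} (hf : L2loc f) {S : Set R3} (hb : Bornology.IsBounded S) :
    MemLp f 2 (volume.restrict S) := by
  obtain ⟨R, hR⟩ := hb.subset_closedBall (0 : R3)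
  exact (hf R).mono_measure (Measure.restrict_mono hR le_rfl)

theorem poincR {u : R3 → ℝ} {g : Fin 3 → R3 → ℝ} (hu : WD u g) {S : Set R3} (hS : MeasurableSet S)
    (hc : Convex ℝ S) (hb : Bornology.IsBounded S) (hv0 : volume S ≠ 0) {r : ℝ} (hr0 : 0 ≤ r)
    (hr : ∀ x ∈ S, ∀ z ∈ S, ‖x - z‖ ≤ r) :
    ∫ x in S, (u x - avg S u) ^ 2 ≤ 48 * r ^ 2 * ∑ i, ∫ x in S, g i x ^ 2 := by
  have hvt : volume S ≠ ⊤ := hb.measure_lt_top.ne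
  have hfin : IsFiniteMeasure (volume.restrict S) := ⟨by simpa using hvt.lt_top⟩
  have h1 := (var_le hv0 hvt (hu.hu.on hb)).trans (poinc2 hu hS hc hb (r := ENNReal.ofReal r)
    ENNReal.ofReal_ne_top (fun x hx z hz => by
      rw [← ofReal_norm]; exact ENNReal.ofReal_le_ofReal (hr x hx z hz)))
  have h2 : 48 * ENNReal.ofReal r ^ 2 * volume S * ∑ i, ∫⁻ x in S, ‖g i x‖ₑ ^ 2
      = volume S * ENNReal.ofReal (48 * r ^ 2 * ∑ i, ∫ x in S, g i x ^ 2) := by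
    rw [Finset.sum_congr rfl fun i _ => lint_sq_eq ((hu.hg i).on hb),
      ← ENNReal.ofReal_sum_of_nonneg (fun i _ => integral_nonneg fun x => sq_nonneg _),
      ← ENNReal.ofReal_pow hr0, show (48:ℝ≥0∞) = ENNReal.ofReal 48 by norm_num,
      ← ENNReal.ofReal_mul (by norm_num), ENNReal.ofReal_mul (p := 48 * r ^ 2) (by positivity)]
    ring
  rw [h2, ENNReal.mul_le_mul_iff_right hv0 hvt] at h1
  rw [lint_sq_eq (f := fun x => u x - avg S u) (((hu.hu.on hb).sub (memLp_const _)))] at h1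
  exact (ENNReal.ofReal_le_ofReal_iff (mul_nonneg (by positivity)
    (Finset.sum_nonneg fun i _ => integral_nonneg fun x => sq_nonneg _))).1 h1

/-- grid cells -/
def cell (δ : ℝ) (z : Fin 3 → ℤ) : Set R3 :=
  Set.pi Set.univ fun i => Set.Ico (z i * δ) (z i * δ + δ)

theorem cell_meas (δ : ℝ) (z) : MeasurableSet (cell δ z) :=
  MeasurableSet.univ_pi fun _ => measurableSet_Ico

theorem cell_convex (δ : ℝ) (z) : Convex ℝ (cell δ z) := convex_pi fun _ _ => convex_Ico _ _

theorem cell_vol {δ : ℝ} (hδ : 0 < δ) (z) : volume (cell δ z) = ENNReal.ofReal (δ ^ 3) := by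
  unfold cell
  rw [volume_pi_pi]
  simp [Fin.prod_const, ENNReal.ofReal_pow hδ.le]

theorem cell_diam {δ : ℝ} (hδ : 0 < δ) {z x y} (hx : x ∈ cell δ z) (hy : y ∈ cell δ z) :
    ‖x - y‖ ≤ δ := by
  rw [pi_norm_le_iff_of_nonneg hδ.le]
  intro i
  have h1 := hx i trivial
  have h2 := hy i trivial
  rw [Set.mem_Ico] at h1 h2
  rw [Real.norm_eq_abs, abs_le, Pi.sub_apply]
  constructor <;> linarith

theorem cell_bdd {δ : ℝ} (hδ : 0 < δ) (z) : Bornology.IsBounded (cell δ z) :=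
  Metric.isBounded_iff.2 ⟨δ, fun x hx y hy => by rw [dist_eq_norm]; exact cell_diam hδ hx hy⟩

theorem mem_cell_iff {δ : ℝ} (hδ : 0 < δ) (z x) : x ∈ cell δ z ↔ ∀ i, z i = ⌊x i / δ⌋ := by
  simp only [cell, Set.mem_pi, Set.mem_univ, true_imp_iff, Set.mem_Ico]
  refine forall_congr' fun i => ?_
  rw [eq_comm, Int.floor_eq_iff, le_div_iff₀ hδ, div_lt_iff₀ hδ, add_mul, one_mul]

theorem cell_disj {δ : ℝ} (hδ : 0 < δ) {z w : Fin 3 → ℤ} (h : z ≠ w) :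
    Disjoint (cell δ z) (cell δ w) := by
  rw [Set.disjoint_left]
  intro x hx hy
  rw [mem_cell_iff hδ] at hx hy
  exact h (funext fun i => (hx i).trans (hy i).symm)

theorem grid {δ : ℝ} (hδ : 0 < δ) (R : ℝ) : ∃ Z : Finset (Fin 3 → ℤ),
    QR R ⊆ (⋃ z ∈ Z, cell δ z) ∧ ∀ z ∈ Z, cell δ z ⊆ QR (R + δ) := by
  have hfin : {z | (cell δ z ∩ QR R).Nonempty}.Finite := by
    refine Set.Finite.subset (Set.Finite.pi' (fun _ : Fin 3 => Set.finite_Icc ⌊-R/δ⌋ ⌊R/δ⌋)) ?_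
    rintro z ⟨x, hx, hx2⟩ i
    rw [mem_cell_iff hδ] at hx
    rw [mem_closedBall_zero_iff] at hx2
    have := abs_le.1 ((norm_le_pi_norm x i).trans hx2)
    rw [hx i, Set.mem_Icc]
    constructor <;> apply Int.floor_mono <;> gcongr <;> linarith
  refine ⟨hfin.toFinset, fun x hx => ?_, fun z hz x hx => ?_⟩
  · simp only [Set.mem_iUnion, exists_prop, Set.Finite.mem_toFinset, Set.mem_setOf_eq]
    have : x ∈ cell δ (fun i => ⌊x i / δ⌋) := (mem_cell_iff hδ _ _).2 fun i => rfl
    exact ⟨_, ⟨x, this, hx⟩, this⟩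
  · simp only [Set.Finite.mem_toFinset, Set.mem_setOf_eq] at hz
    obtain ⟨y, hy, hy2⟩ := hz
    rw [mem_closedBall_zero_iff] at *
    calc ‖x‖ = ‖y + (x - y)‖ := by congr 1; abel
      _ ≤ ‖y‖ + ‖x - y‖ := norm_add_le _ _
      _ ≤ _ := add_le_add hy2 (cell_diam hδ hx hy)

theorem grid_le {δ : ℝ} (hδ : 0 < δ) {R : ℝ} {Z : Finset (Fin 3 → ℤ)}
    (h1 : QR R ⊆ (⋃ z ∈ Z, cell δ z)) (h2 : ∀ z ∈ Z, cell δ z ⊆ QR (R + δ)) {f : R3 → ℝ}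
    (hf : IntegrableOn f (QR (R + δ)) volume) (hf0 : ∀ x, 0 ≤ f x) :
    ∫ x in QR R, f x ≤ ∑ z ∈ Z, ∫ x in cell δ z, f x := by
  rw [← integral_biUnion_finset Z (fun z _ => cell_meas δ z)
    (fun z _ w _ hzw => cell_disj hδ hzw) (fun z hz => hf.mono_set (h2 z hz))]
  exact setIntegral_mono_set (hf.mono_set (Set.iUnion₂_subset h2)) (Eventually.of_forall fun x => hf0 x)
    (Eventually.of_forall h1)

theorem grid_ge {δ : ℝ} (hδ : 0 < δ) {R : ℝ} {Z : Finset (Fin 3 → ℤ)}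
    (h2 : ∀ z ∈ Z, cell δ z ⊆ QR (R + δ)) {f : R3 → ℝ}
    (hf : IntegrableOn f (QR (R + δ)) volume) (hf0 : ∀ x, 0 ≤ f x) :
    ∑ z ∈ Z, ∫ x in cell δ z, f x ≤ ∫ x in QR (R + δ), f x := by
  rw [← integral_biUnion_finset Z (fun z _ => cell_meas δ z)
    (fun z _ w _ hzw => cell_disj hδ hzw) (fun z hz => hf.mono_set (h2 z hz))]
  exact setIntegral_mono_set hf (Eventually.of_forall fun x => hf0 x)
    (Eventually.of_forall (Set.iUnion₂_subset h2))

end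

section

theorem avg_abs_le {S : Set R3} (hv0 : volume S ≠ 0) (hvt : volume S ≠ ⊤) {u : R3 → ℝ} {C : ℝ}
    (hu : ∀ᵐ x, |u x| ≤ C) : |avg S u| ≤ C := by
  have hpos : 0 < volume.real S := ENNReal.toReal_pos hv0 hvt
  have h := norm_setIntegral_le_of_norm_le_const_ae (f := u) (C := C) hvt.lt_top
    (ae_restrict_of_ae hu)
  rw [avg, abs_mul, abs_of_pos (inv_pos.2 hpos), inv_mul_le_iff₀ hpos]
  rw [Real.norm_eq_abs] at h; linarith

theorem avg_sub {S : Set R3} (hv0 : volume S ≠ 0) (hvt : volume S ≠ ⊤) {u : R3 → ℝ}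
    (hu : IntegrableOn u S volume) (c : ℝ) : avg S (fun x => u x - c) = avg S u - c := by
  have hpos : 0 < volume.real S := ENNReal.toReal_pos hv0 hvt
  have hfin : IsFiniteMeasure (volume.restrict S) := ⟨by simpa using hvt.lt_top⟩
  unfold avg
  rw [integral_sub hu (integrable_const _)]
  simp
  field_simp

theorem avg_sq {S : Set R3} (hv0 : volume S ≠ 0) (hvt : volume S ≠ ⊤) {u : R3 → ℝ}
    (hu : MemLp u 2 (volume.restrict S)) : volume.real S * avg S u ^ 2 ≤ ∫ x in S, u x ^ 2 := by
  have hpos : 0 < volume.real S := ENNReal.toReal_pos hv0 hvt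
  have hfin : IsFiniteMeasure (volume.restrict S) := ⟨by simpa using hvt.lt_top⟩
  have hui : Integrable u (volume.restrict S) := hu.integrable (by norm_num)
  set a := avg S u with ha
  have h0 : 0 ≤ ∫ x in S, (u x - a) ^ 2 := integral_nonneg fun x => sq_nonneg _
  have h1 : ∫ x in S, (u x - a) ^ 2 = (∫ x in S, u x ^ 2) - 2 * a * (∫ x in S, u x) + volume.real S * a ^ 2 := by
    have : ∀ x, (u x - a) ^ 2 = u x ^ 2 - 2 * a * u x + a ^ 2 := fun x => by ring
    simp only [this]
    rw [integral_add (f := fun x => u x ^ 2 - 2 * a * u x) (hu.integrable_sq.sub (hui.const_mul _)) (integrable_const _),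
      integral_sub hu.integrable_sq (hui.const_mul _), integral_const_mul]
    simp
  have h2 : ∫ x in S, u x = volume.real S * a := by
    rw [ha, avg]; field_simp
  rw [h1, h2] at h0; nlinarith

theorem int_of_bdd {S : Set R3} (hvt : volume S ≠ ⊤) {f : R3 → ℝ} {C : ℝ}
    (hm : AEStronglyMeasurable f volume) (hC : ∀ᵐ x, |f x| ≤ C) : IntegrableOn f S volume := by
  have hfin : IsFiniteMeasure (volume.restrict S) := ⟨by simpa using hvt.lt_top⟩
  exact Integrable.of_bound hm.restrict C (ae_restrict_of_ae hC)

theorem QR_pos {R : ℝ} (hR : 0 < R) : volume (QR R) ≠ 0 := (Metric.measure_closedBall_pos _ _ hR).ne'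
theorem QR_fin (R : ℝ) : volume (QR R) ≠ ⊤ := measure_closedBall_lt_top.ne

theorem L4 {τ : ℝ} (hτ : 0 < τ) : ∃ C, 0 ≤ C ∧ ∀ (u : R3 → ℝ) (g : Fin 3 → R3 → ℝ), WD u g →
    (∀ᵐ x, |u x| ≤ 1) → ∃ c, |c| ≤ 1 ∧ ∫ x in QR 1, (u x - c) ^ 4 ≤
      τ * (∑ i, ∫ x in QR 2, g i x ^ 2) + C * (∑ i, ∫ x in QR 2, g i x ^ 2) ^ 2 := by
  obtain ⟨δ, hδ, hδ1, hδτ⟩ : ∃ δ : ℝ, 0 < δ ∧ δ ≤ 1 ∧ 1536 * δ ^ 2 ≤ τ := by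
    refine ⟨min 1 (τ / 1536), by positivity, min_le_left _ _, ?_⟩
    have h1 := min_le_left 1 (τ / 1536)
    have h2 := min_le_right 1 (τ / 1536)
    have h3 : 0 < min 1 (τ / 1536) := by positivity
    nlinarith
  obtain ⟨Z, hZ1, hZ2⟩ := grid hδ 1
  refine ⟨8 * Z.card * (48 * 16) ^ 2 / δ ^ 3, by positivity, fun u g hu hb => ?_⟩
  set G := ∑ i, ∫ x in QR 2, g i x ^ 2 with hG
  have hG0 : 0 ≤ G := Finset.sum_nonneg fun i _ => integral_nonneg fun x => sq_nonneg _
  set c := avg (QR 2) u with hc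
  have hc1 : |c| ≤ 1 := avg_abs_le (QR_pos (by norm_num)) (QR_fin 2) hb
  refine ⟨c, hc1, ?_⟩
  have hP : ∫ x in QR 2, (u x - c) ^ 2 ≤ 48 * 16 * G := by
    have := poincR hu (S := QR 2) measurableSet_closedBall (convex_closedBall _ _)
      Metric.isBounded_closedBall (QR_pos (by norm_num)) (r := 4) (by norm_num) (fun x hx z hz => by
        rw [mem_closedBall_zero_iff] at hx hz
        exact (norm_sub_le _ _).trans (by linarith))
    norm_num at this ⊢
    exact this
  have hsub : QR (1 + δ) ⊆ QR 2 := Metric.closedBall_subset_closedBall (by linarith)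
  have hm := hu.hu.aesm
  have hmc : ∀ a : ℝ, AEStronglyMeasurable (fun x => u x - a) volume := fun a =>
    hm.sub aestronglyMeasurable_const
  have hpw : ∀ (a : ℝ) (n : ℕ), AEStronglyMeasurable (fun x => (u x - a) ^ n) volume := fun a n =>
    (hmc a).pow n
  have b2 : ∀ a : ℝ, |a| ≤ 1 → ∀ᵐ x, |u x - a| ≤ 2 := fun a ha => by
    filter_upwards [hb] with x hx
    exact (abs_sub _ _).trans (by linarith)
  have bn : ∀ (a : ℝ) (n : ℕ), |a| ≤ 1 → ∀ᵐ x, |(u x - a) ^ n| ≤ 2 ^ n := fun a n ha => by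
    filter_upwards [b2 a ha] with x hx
    rw [abs_pow]; gcongr
  have hcell : ∀ z ∈ Z, ∫ x in cell δ z, (u x - c) ^ 4 ≤
      1536 * δ ^ 2 * (∑ i, ∫ x in cell δ z, g i x ^ 2) + 8 * (48 * 16 * G) ^ 2 / δ ^ 3 := by
    intro z hz
    have hv : volume (cell δ z) = ENNReal.ofReal (δ ^ 3) := cell_vol hδ z
    have hv0 : volume (cell δ z) ≠ 0 := by rw [hv]; simp; positivity
    have hvt : volume (cell δ z) ≠ ⊤ := by rw [hv]; simp
    have hfin : IsFiniteMeasure (volume.restrict (cell δ z)) := ⟨by simpa using hvt.lt_top⟩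
    have hvr : volume.real (cell δ z) = δ ^ 3 := by
      rw [Measure.real, hv, ENNReal.toReal_ofReal (by positivity)]
    set a := avg (cell δ z) u with ha
    have ha1 : |a| ≤ 1 := avg_abs_le hv0 hvt hb
    have hp := poincR hu (cell_meas δ z) (cell_convex δ z) (cell_bdd hδ z) hv0 hδ.le
      (fun x hx y hy => cell_diam hδ hx hy)
    have hq : δ ^ 3 * (a - c) ^ 2 ≤ 48 * 16 * G := by
      have h := avg_sq hv0 hvt (((hu.hu.sub (continuous_const (y := c)).l2loc).on (cell_bdd hδ z)))
      rw [avg_sub hv0 hvt (int_of_bdd hvt hm hb), hvr] at h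
      refine h.trans (le_trans ?_ hP)
      exact setIntegral_mono_set (int_of_bdd (QR_fin 2) (hpw c 2) (bn c 2 hc1))
        (Eventually.of_forall fun x => sq_nonneg _)
        (Eventually.of_forall ((hZ2 z hz).trans hsub))
    have hq2 : δ ^ 3 * (a - c) ^ 4 ≤ (48 * 16 * G) ^ 2 / δ ^ 3 := by
      rw [le_div_iff₀ (by positivity)]
      calc _ = (δ ^ 3 * (a - c) ^ 2) ^ 2 := by ring
        _ ≤ _ := by gcongr
    calc ∫ x in cell δ z, (u x - c) ^ 4 ≤ ∫ x in cell δ z, (32 * (u x - a) ^ 2 + 8 * (a - c) ^ 4) := by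
          apply integral_mono_ae (int_of_bdd hvt (hpw c 4) (bn c 4 hc1))
            (((int_of_bdd hvt (hpw a 2) (bn a 2 ha1)).const_mul 32).add (integrable_const _))
          filter_upwards [ae_restrict_of_ae (b2 a ha1)] with x hx
          have h1 : (u x - c) ^ 4 ≤ 8 * (u x - a) ^ 4 + 8 * (a - c) ^ 4 := by
            have : u x - c = (u x - a) + (a - c) := by ring
            rw [this]
            generalize u x - a = p
            generalize a - c = q
            nlinarith [sq_nonneg (p ^ 2 - q ^ 2), sq_nonneg (p - q), sq_nonneg (p + q),
              mul_nonneg (sq_nonneg (p - q)) (sq_nonneg (p - q)),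
              mul_nonneg (sq_nonneg (p - q)) (sq_nonneg (p + q)), sq_nonneg (p*q)]
          have h2 : (u x - a) ^ 2 ≤ 4 := by
            have := sq_abs (u x - a); nlinarith [abs_nonneg (u x - a)]
          show _ ≤ 32 * (u x - a) ^ 2 + 8 * (a - c) ^ 4
          nlinarith [sq_nonneg (u x - a)]
      _ = 32 * (∫ x in cell δ z, (u x - a) ^ 2) + δ ^ 3 * (8 * (a - c) ^ 4) := by
          rw [integral_add ((int_of_bdd hvt (hpw a 2) (bn a 2 ha1)).const_mul 32)
            (integrable_const _), integral_const_mul]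
          simp [hvr]
      _ ≤ 32 * (48 * δ ^ 2 * ∑ i, ∫ x in cell δ z, g i x ^ 2) + 8 * ((48 * 16 * G) ^ 2 / δ ^ 3) := by
          linarith
      _ = _ := by ring
  have hgi : ∀ i, IntegrableOn (fun x => g i x ^ 2) (QR (1 + δ)) volume := fun i =>
    ((hu.hg i) (1 + δ)).integrable_sq
  calc ∫ x in QR 1, (u x - c) ^ 4 ≤ ∑ z ∈ Z, ∫ x in cell δ z, (u x - c) ^ 4 :=
        grid_le hδ hZ1 hZ2 (int_of_bdd (QR_fin _) (hpw c 4) (bn c 4 hc1)) (fun x => by positivity)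
    _ ≤ ∑ z ∈ Z, (1536 * δ ^ 2 * (∑ i, ∫ x in cell δ z, g i x ^ 2) + 8 * (48 * 16 * G) ^ 2 / δ ^ 3) :=
        Finset.sum_le_sum hcell
    _ = 1536 * δ ^ 2 * (∑ i, ∑ z ∈ Z, ∫ x in cell δ z, g i x ^ 2)
          + Z.card * (8 * (48 * 16 * G) ^ 2 / δ ^ 3) := by
        rw [Finset.sum_add_distrib, ← Finset.mul_sum, Finset.sum_comm]; simp
    _ ≤ τ * G + Z.card * (8 * (48 * 16 * G) ^ 2 / δ ^ 3) := by
        gcongr ?_ + _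
        refine mul_le_mul hδτ ?_ (Finset.sum_nonneg fun i _ => Finset.sum_nonneg fun z _ =>
          integral_nonneg fun x => sq_nonneg _) hτ.le
        refine Finset.sum_le_sum fun i _ => (grid_ge hδ hZ2 (hgi i) fun x => sq_nonneg _).trans ?_
        exact setIntegral_mono_set ((hu.hg i) 2).integrable_sq
          (Eventually.of_forall fun x => sq_nonneg _) (Eventually.of_forall hsub)
    _ = _ := by ring

/-- Young -/
theorem young4 {v M e δ : ℝ} (hδ : 0 < δ) (he : 0 ≤ e) (hM : M ^ 4 ≤ e ^ 3) :
    |v * M| ≤ (δ⁻¹ ^ 3 * v ^ 4 + 3 * (δ * e)) / 4 := by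
  have hy : ∀ p q : ℝ, 0 ≤ p → 0 ≤ q → 256 * (p * q ^ 3) ≤ (p + 3 * q) ^ 4 := by
    intro p q hp hq
    have : (p + 3 * q) ^ 4 - 256 * (p * q ^ 3) = (p - q) ^ 2 * (p ^ 2 + 14 * p * q + 81 * q ^ 2) := by
      ring
    have h2 : 0 ≤ (p - q) ^ 2 * (p ^ 2 + 14 * p * q + 81 * q ^ 2) := by positivity
    linarith
  have h := hy (δ⁻¹ ^ 3 * v ^ 4) (δ * e) (by positivity) (by positivity)
  have h2 : |v * M| ^ 4 ≤ ((δ⁻¹ ^ 3 * v ^ 4 + 3 * (δ * e)) / 4) ^ 4 := by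
    have e1 : |v * M| ^ 4 = v ^ 4 * M ^ 4 := by
      rw [← abs_pow, mul_pow, abs_of_nonneg (by positivity)]
    have e2 : δ⁻¹ ^ 3 * v ^ 4 * (δ * e) ^ 3 = v ^ 4 * e ^ 3 := by field_simp
    rw [e1, div_pow]
    have : v ^ 4 * M ^ 4 ≤ v ^ 4 * e ^ 3 := by gcongr
    rw [show (4:ℝ) ^ 4 = 256 by norm_num, le_div_iff₀ (by norm_num)]
    linarith
  exact le_of_pow_le_pow_left₀ (by norm_num) (by positivity) h2

end

section

theorem young_int {φ : SkyrmeMap} (h : memX φ) {C0 B δ R : ℝ} (hC0 : 0 ≤ C0) (hδ : 0 < δ) {w v M : R3 → ℝ}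
    (hw : ∀ x, x ∉ QR R → w x = 0) (hwb : ∀ x, |w x| ≤ C0) (hv : AEStronglyMeasurable v volume)
    (hvb : ∀ᵐ x, |v x| ≤ B) (hM : ∀ x, M x ^ 4 ≤ energyDensity φ x ^ 3) :
    |∫ x, w x * (v x * M x)| ≤
      C0 * ((δ⁻¹ ^ 3 * (∫ x in QR R, v x ^ 4) + 3 * (δ * ∫ x in QR R, energyDensity φ x)) / 4) := by
  rw [← setInt_eq_of_supp (R := R) (fun x hx => by simp [hw x hx])]
  have hi1 : IntegrableOn (fun x => v x ^ 4) (QR R) volume := by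
    refine int_of_bdd (C := B ^ 4) (QR_fin R) (hv.pow 4) ?_
    filter_upwards [hvb] with x hx
    rw [abs_pow]; gcongr
  have hi2 : IntegrableOn (energyDensity φ) (QR R) volume := Integrable.integrableOn h
  have hi : IntegrableOn (fun x => C0 * ((δ⁻¹ ^ 3 * v x ^ 4 + 3 * (δ * energyDensity φ x)) / 4)) (QR R) volume :=
    (((hi1.const_mul _).add ((hi2.const_mul δ).const_mul 3)).div_const 4).const_mul C0
  have e : ∫ x in QR R, C0 * ((δ⁻¹ ^ 3 * v x ^ 4 + 3 * (δ * energyDensity φ x)) / 4)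
      = C0 * ((δ⁻¹ ^ 3 * (∫ x in QR R, v x ^ 4) + 3 * (δ * ∫ x in QR R, energyDensity φ x)) / 4) := by
    rw [integral_const_mul, integral_div, integral_add (hi1.const_mul _) ((hi2.const_mul δ).const_mul 3),
      integral_const_mul, integral_const_mul, integral_const_mul]
  rw [← e, ← Real.norm_eq_abs]
  refine norm_integral_le_of_norm_le hi (Eventually.of_forall fun x => ?_)
  rw [Real.norm_eq_abs, abs_mul]
  exact mul_le_mul (hwb x) (young4 hδ (φ.e_nonneg x) (hM x)) (abs_nonneg _) hC0

theorem pd_supp {χ : R3 → ℝ} {R : ℝ} (h : ∀ x, x ∉ QR R → χ x = 0) (i : Fin 3) :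
    ∀ x, x ∉ QR R → pd i χ x = 0 := by
  intro x hx
  have h1 : tsupport χ ⊆ QR R := closure_minimal (fun y hy => by
    by_contra h'; exact hy (h y h')) Metric.isClosed_closedBall
  have h2 : fderiv ℝ χ x = 0 := by
    by_contra h'
    exact hx (h1 (support_fderiv_subset ℝ h'))
  simp [pd, h2]

theorem mul_test_int {χ : R3 → ℝ} (h : IsTestFun χ) {f : R3 → ℝ} (hf : Integrable f volume) :
    Integrable (fun x => χ x * f x) volume := by
  obtain ⟨R, C, hC, hb⟩ := h.exists_bc
  exact hf.bdd_mul (c := C) hb.meas (by simpa using hb.bdd)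

theorem V1 {κ C0 : ℝ} (hκ : 0 < κ) (hC0 : 0 ≤ C0) : ∃ ε > 0, ∀ φ : SkyrmeMap, memX φ →
    (∫ x in QR 2, energyDensity φ x) ≤ ε → ∀ χ : R3 → ℝ, IsTestFun χ → (∀ x, x ∉ QR 1 → χ x = 0) →
    (∀ x, |χ x| ≤ C0) → (∀ i x, |pd i χ x| ≤ C0) →
    |∫ x, χ x * detDen φ x| ≤ κ * ∫ x in QR 2, energyDensity φ x := by
  set δ := κ / (20 * C0 + 1) with hδd
  have hδ : 0 < δ := by positivity
  have hδκ : 20 * C0 * δ ≤ κ := by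
    rw [hδd, mul_div_assoc', div_le_iff₀ (by positivity)]; nlinarith
  obtain ⟨C, hC, hL4⟩ := L4 (τ := δ ^ 4) (by positivity)
  refine ⟨δ ^ 4 / (C + 1), by positivity, fun φ h hE χ hχ hs hb hbp => ?_⟩
  set E := ∫ x in QR 2, energyDensity φ x with hEd
  have hE0 : 0 ≤ E := integral_nonneg fun x => φ.e_nonneg x
  have hCE : C * E ≤ δ ^ 4 := by
    rw [le_div_iff₀ (by positivity)] at hE; nlinarith
  have hG : ∀ a, (∑ i, ∫ x in QR 2, φ.pderiv i x a ^ 2) ≤ E := by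
    intro a
    have hI : ∀ i ∈ Finset.univ, IntegrableOn (fun x => φ.pderiv i x a ^ 2) (QR 2) volume :=
      fun i _ => (SkyrmeMap.pd_memLp h i a).integrable_sq.integrableOn
    rw [← integral_finsetSum _ hI]
    refine setIntegral_mono (integrable_finsetSum _ hI) (Integrable.integrableOn h) fun x => ?_
    exact (φ.gr_sq_le a x).trans (by unfold energyDensity; linarith [φ.ASq_nonneg x])
  have hc : ∀ a, ∃ c, |c| ≤ 1 ∧ ∫ x in QR 1, (φ.toFun x a - c) ^ 4 ≤ 2 * δ ^ 4 * E := by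
    intro a
    obtain ⟨c, h1, h2⟩ := hL4 _ _ (SkyrmeMap.wd h a) (φ.c_bdd' a)
    refine ⟨c, h1, h2.trans ?_⟩
    have := hG a
    set G := ∑ i, ∫ x in QR 2, φ.pderiv i x a ^ 2
    have hG0 : 0 ≤ G := Finset.sum_nonneg fun i _ => integral_nonneg fun x => sq_nonneg _
    have : C * G ^ 2 ≤ C * E ^ 2 := by gcongr
    have : δ ^ 4 * G ≤ δ ^ 4 * E := by gcongr
    nlinarith
  choose c hc1 hc4 using hc
  have hE1 : ∫ x in QR 1, energyDensity φ x ≤ E :=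
    setIntegral_mono_set (Integrable.integrableOn h) (Eventually.of_forall fun x => φ.e_nonneg x)
      (Eventually.of_forall (Metric.closedBall_subset_closedBall (by norm_num)))
  have hvm : ∀ a, AEStronglyMeasurable (fun x => φ.toFun x a - c a) volume := fun a =>
    (φ.c_aesm a).sub aestronglyMeasurable_const
  have hvb : ∀ a, ∀ᵐ x, |φ.toFun x a - c a| ≤ 2 := fun a => by
    filter_upwards [φ.c_bdd' a] with x hx
    exact (abs_sub _ _).trans (by linarith [hc1 a])
  have key : ∀ a (w M : R3 → ℝ), (∀ x, x ∉ QR 1 → w x = 0) → (∀ x, |w x| ≤ C0) →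
      (∀ x, M x ^ 4 ≤ energyDensity φ x ^ 3) →
      |∫ x, w x * ((φ.toFun x a - c a) * M x)| ≤ C0 * (5 * δ * E / 4) := by
    intro a w M h1 h2 h3
    refine (young_int h hC0 hδ h1 h2 (hvm a) (hvb a) h3).trans ?_
    gcongr
    have e1 : δ⁻¹ ^ 3 * (∫ x in QR 1, (φ.toFun x a - c a) ^ 4) ≤ δ⁻¹ ^ 3 * (2 * δ ^ 4 * E) := by
      gcongr; exact hc4 a
    have e2 : δ⁻¹ ^ 3 * (2 * δ ^ 4 * E) = 2 * (δ * E) := by field_simp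
    have e3 : δ * (∫ x in QR 1, energyDensity φ x) ≤ δ * E := by gcongr
    linarith
  have hMc : ∀ a, |∫ x, χ x * φ.Mc a x| ≤ 3 * (C0 * (5 * δ * E / 4)) := by
    intro a
    obtain ⟨s, b, p, q, hs1, hM⟩ := SkyrmeMap.Mc_eq_MM a
    have e : ∫ x, χ x * φ.Mc a x = s * ∫ x, χ x * φ.MM b p q x := by
      rw [← integral_const_mul]; congr 1; ext x; rw [hM]; ring
    rw [e, abs_mul, hs1, one_mul, SkyrmeMap.MM_parts h hχ b p q (c b), abs_neg]
    have e2 : ∀ x, (φ.toFun x b - c b) * ∑ i, pd i χ x * φ.AA p q i x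
        = ∑ i, pd i χ x * ((φ.toFun x b - c b) * φ.AA p q i x) := fun x => by
      rw [Finset.mul_sum]; exact Finset.sum_congr rfl fun i _ => by ring
    simp only [e2]
    rw [integral_finsetSum]
    · refine (Finset.abs_sum_le_sum_abs _ _).trans ?_
      refine (Finset.sum_le_sum fun i _ => key b _ _ (pd_supp hs i) (hbp i)
        (fun x => φ.AA_pow4 p q i x)).trans ?_
      simp
    · intro i _
      exact mul_test_int (hχ.pd i) ((SkyrmeMap.AA_int h p q i).bdd_mul (c := 2) (hvm b) (by simpa using hvb b))
  have hiv : ∀ a, Integrable (fun x => χ x * ((φ.toFun x a - c a) * φ.Mc a x)) volume := fun a =>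
    mul_test_int hχ ((SkyrmeMap.Mc_int h a).bdd_mul (c := 2) (hvm a) (by simpa using hvb a))
  have hic : ∀ a, Integrable (fun x => c a * (χ x * φ.Mc a x)) volume := fun a =>
    (mul_test_int hχ (SkyrmeMap.Mc_int h a)).const_mul _
  have e : ∫ x, χ x * detDen φ x = ∑ a, ((∫ x, χ x * ((φ.toFun x a - c a) * φ.Mc a x))
      + c a * ∫ x, χ x * φ.Mc a x) := by
    simp only [← integral_const_mul]
    rw [Finset.sum_congr rfl fun a _ => (integral_add (hiv a) (hic a)).symm,
      ← integral_finsetSum (f := fun a x => χ x * ((φ.toFun x a - c a) * φ.Mc a x) + c a * (χ x * φ.Mc a x))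
        _ fun a _ => (hiv a).add (hic a)]
    congr 1; ext x
    rw [φ.detDen_eq, Finset.mul_sum]
    exact Finset.sum_congr rfl fun a _ => by ring
  rw [e]
  calc _ ≤ ∑ a, |(∫ x, χ x * ((φ.toFun x a - c a) * φ.Mc a x)) + c a * ∫ x, χ x * φ.Mc a x| :=
        Finset.abs_sum_le_sum_abs _ _
    _ ≤ ∑ a : Fin 4, (4 * (C0 * (5 * δ * E / 4))) := by
        refine Finset.sum_le_sum fun a _ => (abs_add_le _ _).trans ?_
        have h1 := key a χ (φ.Mc a) hs hb (φ.Mc_pow4 a)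
        have h2 := hMc a
        have h3 : |c a * ∫ x, χ x * φ.Mc a x| ≤ |∫ x, χ x * φ.Mc a x| := by
          rw [abs_mul]; exact mul_le_of_le_one_left (abs_nonneg _) (hc1 a)
        linarith
    _ = 20 * C0 * δ * E := by simp; ring
    _ ≤ κ * E := by gcongr

/-- translate of a Skyrme map -/
def SkyrmeMap.tr (φ : SkyrmeMap) (p : R3) : SkyrmeMap where
  toFun x := φ.toFun (x + p)
  pderiv i x := φ.pderiv i (x + p)
  meas := φ.meas.comp (measurable_id.add_const p)
  pderiv_locInt i := by
    have h := φ.pderiv_locInt i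
    rw [locallyIntegrable_iff] at h ⊢
    intro K hK
    have h2 := h _ (hK.image (f := fun x => x + p) (by fun_prop))
    have := (measurePreserving_add_right (volume : Measure R3) p).integrableOn_comp_preimage
      (f := φ.pderiv i) (s := (fun x => x + p) '' K) (measurableEmbedding_addRight p)
    rw [Set.preimage_image_eq _ (add_left_injective p)] at this
    exact this.2 h2
  sphere := (measurePreserving_add_right (volume : Measure R3) p).quasiMeasurePreserving.ae φ.sphere
  weak i a ψ hψ := by
    have ht : IsTestFun (fun x => ψ (x - p)) :=
      ⟨hψ.1.comp (contDiff_id.sub contDiff_const), hψ.2.comp_homeomorph (Homeomorph.subRight p)⟩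
    have := φ.weak i a _ ht
    simp only [fderiv_comp_sub] at this
    rw [← integral_add_right_eq_self _ p, ← integral_add_right_eq_self (fun x => ψ (x - p) * _) p] at this
    simpa using this

theorem SkyrmeMap.tr_memX {φ : SkyrmeMap} (h : memX φ) (p : R3) : memX (φ.tr p) :=
  Integrable.comp_add_right (f := energyDensity φ) h p

theorem SkyrmeMap.tr_e (φ : SkyrmeMap) (p x : R3) :
    energyDensity (φ.tr p) x = energyDensity φ (x + p) := rfl
theorem SkyrmeMap.tr_D (φ : SkyrmeMap) (p x : R3) :
    detDen (φ.tr p) x = detDen φ (x + p) := rfl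

theorem IsTestFun.shift {ψ : R3 → ℝ} (hψ : IsTestFun ψ) (p : R3) : IsTestFun (fun x => ψ (x + p)) :=
  ⟨hψ.1.comp (contDiff_id.add contDiff_const), hψ.2.comp_homeomorph (Homeomorph.addRight p)⟩

theorem pd_shift (ψ : R3 → ℝ) (p x : R3) (i : Fin 3) : pd i (fun x => ψ (x + p)) x = pd i ψ (x + p) := by
  simp [pd, fderiv_comp_add_right]

end

section

theorem corr_int {f g : R3 → ℝ} (hf : Integrable f volume) (hg : Integrable g volume) :
    Integrable (fun y => ∫ x, f x * g (x + y)) volume ∧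
    ∫ y, ∫ x, f x * g (x + y) = (∫ x, f x) * ∫ x, g x := by
  have hp : Integrable (fun z : R3 × R3 => f z.1 * g (z.1 + z.2)) (volume.prod volume) :=
    ((measurePreserving_prod_add (volume : Measure R3) (volume : Measure R3)).integrable_comp
      (hf.mul_prod hg).1).2 (hf.mul_prod hg)
  refine ⟨hp.integral_prod_right, ?_⟩
  rw [← integral_integral_swap (f := fun x y => f x * g (x + y)) hp]
  simp only [integral_const_mul]
  simp_rw [integral_add_left_eq_self (fun y => g y), integral_mul_const]

theorem vanish {κ C0 : ℝ} (hκ : 0 < κ) (hC0 : 0 ≤ C0) : ∃ ε > 0, ∀ φ : SkyrmeMap, memX φ →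
    ∀ θ : R3 → ℝ, ContDiff ℝ (⊤ : ℕ∞) θ → (∀ x, |θ x| ≤ C0) → (∀ i x, |pd i θ x| ≤ C0) →
    (∀ y, ε < (∫ x in QR 2, energyDensity φ (x + y)) → ∀ x ∈ QR 1, θ (x + y) = 0) →
    |∫ x, θ x * detDen φ x| ≤ κ * (64 * energy φ) := by
  have hζ : IsTestFun (rho 0) := ⟨rho_contDiff 0, rho_cs 0⟩
  have hζs : ∀ x, x ∉ QR 1 → rho 0 x = 0 := fun x hx => rho_supp 0 x (by
    rw [mem_closedBall_zero_iff] at hx; norm_num; linarith)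
  obtain ⟨C1, hC1, hp⟩ := hζ.pd_bdd
  obtain ⟨C2, hC2⟩ := hζ.2.exists_bound_of_continuous hζ.1.continuous
  have hC20 : 0 ≤ C2 := (norm_nonneg _).trans (hC2 0)
  obtain ⟨ε, hε, H⟩ := V1 (κ := κ) (C0 := C0 * (C1 + C2)) hκ (by positivity)
  refine ⟨ε, hε, fun φ h θ hθ hb hbp hbad => ?_⟩
  have hθD : Integrable (fun x => θ x * detDen φ x) volume :=
    (SkyrmeMap.det_int h).bdd_mul (c := C0) hθ.continuous.aestronglyMeasurable
      (Eventually.of_forall hb)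
  obtain ⟨i1, e1⟩ := corr_int (rho_integrable 0) hθD
  have hind : Integrable ((QR 2).indicator (fun _ => (1:ℝ))) volume :=
    (integrable_indicator_iff measurableSet_closedBall).2 (integrableOn_const (QR_fin 2))
  obtain ⟨i2, e2⟩ := corr_int hind h
  have e3 : ∫ x : R3, (QR 2).indicator (fun _ => (1:ℝ)) x = 64 := by
    rw [integral_indicator_const _ measurableSet_closedBall, Measure.real,
      Real.volume_pi_closedBall _ (by norm_num)]
    simp; norm_num
  have e4 : ∀ y, ∫ x, (QR 2).indicator (fun _ => (1:ℝ)) x * energyDensity φ (x + y)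
      = ∫ x in QR 2, energyDensity φ (x + y) := by
    intro y
    rw [← integral_indicator measurableSet_closedBall]
    congr 1; ext x
    by_cases hx : x ∈ QR 2 <;> simp [Set.indicator, hx]
  rw [rho_integral, one_mul] at e1
  rw [e3] at e2
  simp only [e4] at i2 e2
  rw [← e1, energy, ← e2, ← integral_const_mul, ← Real.norm_eq_abs]
  refine norm_integral_le_of_norm_le (i2.const_mul κ) (Eventually.of_forall fun y => ?_)
  rw [Real.norm_eq_abs]
  by_cases hy : ε < ∫ x in QR 2, energyDensity φ (x + y)
  · have : ∀ x, rho 0 x * (θ (x + y) * detDen φ (x + y)) = 0 := by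
      intro x
      by_cases hx : x ∈ QR 1
      · simp [hbad y hy x hx]
      · simp [hζs x hx]
    simp only [this, integral_zero, abs_zero]
    exact mul_nonneg hκ.le (integral_nonneg fun x => φ.e_nonneg _)
  · have hθ' : ContDiff ℝ (⊤ : ℕ∞) (fun x => θ (x + y)) := hθ.comp (contDiff_id.add contDiff_const)
    have := H (φ.tr y) (SkyrmeMap.tr_memX h y) (not_lt.1 hy) (fun x => rho 0 x * θ (x + y))
      (hζ.mul_right hθ') (fun x hx => by simp [hζs x hx]) (fun x => by
        rw [abs_mul, mul_comm]
        exact mul_le_mul (hb _) ((hC2 x).trans (by linarith)) (abs_nonneg _) hC0) (fun i x => by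
        rw [pd_mul hζ.1 hθ', pd_shift]
        refine (abs_add_le _ _).trans ?_
        rw [abs_mul, abs_mul]
        have h1 := mul_le_mul (hp i x) (hb (x + y)) (abs_nonneg _) hC1
        have h2 := mul_le_mul (hC2 x) (hbp i (x + y)) (abs_nonneg _) hC20
        rw [Real.norm_eq_abs] at h2
        linarith)
    simp only [SkyrmeMap.tr_D, mul_assoc] at this
    exact this

end

section

theorem exists_bdd_lim (U : Ultrafilter ℕ) {f : ℕ → ℝ} {C : ℝ} (h : ∀ n, |f n| ≤ C) :
    ∃ L, Tendsto f U (𝓝 L) := by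
  have := (isCompact_Icc (a := -C) (b := C)).ultrafilter_le_nhds (U.map f)
    (by rw [Filter.le_principal_iff, Ultrafilter.mem_coe, Ultrafilter.mem_map]
        exact Filter.univ_mem' fun n => abs_le.1 (h n))
  obtain ⟨L, -, hL⟩ := this
  exact ⟨L, hL⟩

/-- weak convergence in L2 -/
def WConv (l : Filter ℕ) (f : ℕ → R3 → ℝ) (f' : R3 → ℝ) : Prop :=
  ∀ g : R3 → ℝ, MemLp g 2 volume → Tendsto (fun n => ∫ x, f n x * g x) l (𝓝 (∫ x, f' x * g x))

theorem weak_lim (U : Ultrafilter ℕ) {f : ℕ → R3 → ℝ} (hf : ∀ n, MemLp (f n) 2 volume) {K : ℝ}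
    (hK : ∀ n, ∫ x, f n x ^ 2 ≤ K) :
    ∃ f' : R3 → ℝ, Measurable f' ∧ MemLp f' 2 volume ∧ WConv U f f' := by
  let H := Lp ℝ 2 (volume : Measure R3)
  let F : ℕ → H := fun n => (hf n).toLp
  have hin : ∀ (p q : R3 → ℝ) (hp : MemLp p 2 volume) (hq : MemLp q 2 volume),
      inner ℝ (hp.toLp p : H) (hq.toLp q : H) = ∫ x, p x * q x := by
    intro p q hp hq
    rw [L2.inner_def]
    apply integral_congr_ae
    filter_upwards [hp.coeFn_toLp, hq.coeFn_toLp] with x h1 h2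
    rw [h1, h2]; simp [mul_comm]
  have hn : ∀ n, ‖F n‖ ≤ √K := by
    intro n
    apply Real.le_sqrt_of_sq_le
    rw [← real_inner_self_eq_norm_sq, hin]
    simpa [sq] using hK n
  let T : ℕ → StrongDual ℝ H := fun n => InnerProductSpace.toDual ℝ H (F n)
  have hc := WeakDual.isCompact_closedBall (𝕜 := ℝ) (E := H) 0 (√K)
  obtain ⟨L, -, hL⟩ := hc.ultrafilter_le_nhds (U.map fun n => StrongDual.toWeakDual (T n)) (by
    rw [Filter.le_principal_iff, Ultrafilter.mem_coe, Ultrafilter.mem_map]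
    refine Filter.univ_mem' fun n => ?_
    simp only [Set.mem_preimage]
    show T n ∈ Metric.closedBall 0 _
    rw [mem_closedBall_zero_iff]
    simpa [T] using hn n)
  have hL' : Tendsto (fun n => StrongDual.toWeakDual (T n)) U (𝓝 L) := hL
  let f0 : H := (InnerProductSpace.toDual ℝ H).symm (WeakDual.toStrongDual L)
  have hL2 : ∀ g : H, Tendsto (fun n => inner ℝ (F n) g) U (𝓝 (inner ℝ f0 g)) := by
    intro g
    have h1 := ((WeakDual.eval_continuous (𝕜 := ℝ) g).tendsto L).comp hL'
    have h2 : inner ℝ f0 g = L g := by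
      rw [← InnerProductSpace.toDual_apply_apply, LinearIsometryEquiv.apply_symm_apply]; rfl
    rw [h2]; exact h1
  refine ⟨f0, (Lp.stronglyMeasurable f0).measurable, Lp.memLp f0, fun g hg => ?_⟩
  have := hL2 (hg.toLp g)
  rw [show inner ℝ f0 (hg.toLp g) = ∫ x, f0 x * g x by
    rw [← hin f0 g (Lp.memLp f0) hg, Lp.toLp_coeFn]] at this
  simpa only [F, hin] using this

def wt (x : R3) : ℝ := ((1 + ‖x‖) ^ 2)⁻¹
theorem wt_pos (x : R3) : 0 < wt x := by unfold wt; positivity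
theorem wt_le (x : R3) : wt x ≤ 1 := by
  unfold wt; apply inv_le_one_of_one_le₀
  nlinarith [norm_nonneg x]
theorem wt_cont : Continuous wt := by
  unfold wt
  refine Continuous.inv₀ (by fun_prop) fun x => by positivity
theorem wt_L2 : MemLp wt 2 volume := by
  rw [memLp_two_iff_integrable_sq wt_cont.aestronglyMeasurable]
  have := integrable_one_add_norm (E := R3) (μ := volume) (r := 4) (by simp; norm_num)
  refine this.congr (Eventually.of_forall fun x => ?_)
  simp only [wt]
  rw [show (-4:ℝ) = ((-4:ℤ):ℝ) by norm_num, Real.rpow_intCast]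
  rw [zpow_neg, inv_pow, ← pow_mul]; norm_cast

theorem weak_lim_loc (U : Ultrafilter ℕ) {u : ℕ → R3 → ℝ} (hu : ∀ n, AEStronglyMeasurable (u n) volume)
    (hb : ∀ n, ∀ᵐ x, |u n x| ≤ 1) :
    ∃ u' : R3 → ℝ, Measurable u' ∧ L2loc u' ∧ ∀ (R : ℝ) (g : R3 → ℝ), MemLp g 2 volume →
      (∀ x, x ∉ QR R → g x = 0) → Tendsto (fun n => ∫ x, u n x * g x) U (𝓝 (∫ x, u' x * g x)) := by
  have hm : ∀ n, MemLp (fun x => wt x * u n x) 2 volume := fun n => by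
    refine wt_L2.mono (wt_cont.aestronglyMeasurable.mul (hu n)) ?_
    filter_upwards [hb n] with x hx
    rw [norm_mul, Real.norm_eq_abs (u n x)]
    exact mul_le_of_le_one_right (norm_nonneg _) hx
  obtain ⟨f, hfm, hf2, hW⟩ := weak_lim U hm (K := ∫ x, wt x ^ 2) (fun n => by
    refine integral_mono_ae (hm n).integrable_sq wt_L2.integrable_sq ?_
    filter_upwards [hb n] with x hx
    show (wt x * u n x) ^ 2 ≤ wt x ^ 2
    rw [mul_pow, ← sq_abs (u n x)]
    exact mul_le_of_le_one_right (sq_nonneg _) (pow_le_one₀ (abs_nonneg _) hx))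
  have hinv : ∀ x, wt x * (wt x)⁻¹ = 1 := fun x => mul_inv_cancel₀ (wt_pos x).ne'
  have hwi : Continuous (fun x => (wt x)⁻¹) := wt_cont.inv₀ fun x => (wt_pos x).ne'
  have hwb : ∀ R : ℝ, ∃ C, ∀ x ∈ QR R, ‖(wt x)⁻¹‖ ≤ C := fun R =>
    (isCompact_closedBall (0 : R3) R).exists_bound_of_continuousOn hwi.continuousOn
  refine ⟨fun x => (wt x)⁻¹ * f x, hwi.measurable.mul hfm, fun R => ?_, fun R g hg hs => ?_⟩
  · obtain ⟨C, hC⟩ := hwb R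
    refine MemLp.of_le_mul (c := C) (hf2.restrict (QR R)) (hwi.measurable.mul hfm).aestronglyMeasurable ?_
    filter_upwards [ae_restrict_mem measurableSet_closedBall] with x hx
    rw [norm_mul]; gcongr; exact hC x hx
  · obtain ⟨C, hC⟩ := hwb R
    have hg2 : MemLp (fun x => (wt x)⁻¹ * g x) 2 volume := by
      refine MemLp.of_le_mul (c := C) hg (hwi.aestronglyMeasurable.mul hg.1) ?_
      refine Eventually.of_forall fun x => ?_
      by_cases hx : x ∈ QR R
      · rw [norm_mul]; gcongr; exact hC x hx
      · simp [hs x hx]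
    have := hW _ hg2
    have e1 : ∀ n x, wt x * u n x * ((wt x)⁻¹ * g x) = u n x * g x := fun n x => by
      linear_combination (u n x * g x) * hinv x
    have e2 : ∀ x, f x * ((wt x)⁻¹ * g x) = (wt x)⁻¹ * f x * g x := fun x => by ring
    simpa only [e1, e2] using this

/-- Rellich -/
theorem rellich (U : Ultrafilter ℕ) {u : ℕ → R3 → ℝ} {g : ℕ → Fin 3 → R3 → ℝ} {u' : R3 → ℝ}
    {g' : Fin 3 → R3 → ℝ} (h : ∀ n, WD (u n) (g n)) (h' : WD u' g') {K : ℝ}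
    (hK : ∀ n i (R : ℝ), ∫ x in QR R, g n i x ^ 2 ≤ K) (hK' : ∀ i (R : ℝ), ∫ x in QR R, g' i x ^ 2 ≤ K)
    (hw : ∀ (R : ℝ) (f : R3 → ℝ), MemLp f 2 volume → (∀ x, x ∉ QR R → f x = 0) →
      Tendsto (fun n => ∫ x, u n x * f x) U (𝓝 (∫ x, u' x * f x))) : L2conv U u u' := by
  intro R
  have hd : ∀ n, WD (fun x => u n x - u' x) (fun i x => g n i x - g' i x) := fun n =>
    ⟨(h n).hu.sub h'.hu, fun i => ((h n).hg i).sub (h'.hg i), fun i ψ hψ => by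
      have h1 := (h n).weak i ψ hψ
      have h2 := h'.weak i ψ hψ
      simp only [mul_sub]
      rw [integral_sub ((hψ.pd i).int_mul (h n).hu) ((hψ.pd i).int_mul h'.hu),
        integral_sub (hψ.int_mul ((h n).hg i)) (hψ.int_mul (h'.hg i)), h1, h2]; ring⟩
  have hK0 : 0 ≤ K := le_trans (integral_nonneg fun x => sq_nonneg _) (hK' 0 1)
  have hcell : ∀ δ > 0, ∀ z, Tendsto (fun n => ∫ x in cell δ z, (u n x - u' x)) U (𝓝 0) := by
    intro δ hδ z
    obtain ⟨R1, hR1⟩ := (cell_bdd hδ z).subset_closedBall (0 : R3)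
    have h1 := hw R1 ((cell δ z).indicator fun _ => (1:ℝ))
      (memLp_indicator_const 2 (cell_meas δ z) 1 (Or.inr (cell_bdd hδ z).measure_lt_top.ne))
      (fun x hx => Set.indicator_of_notMem (fun h => hx (hR1 h)) _)
    have e : ∀ f : R3 → ℝ, ∫ x, f x * (cell δ z).indicator (fun _ => (1:ℝ)) x = ∫ x in cell δ z, f x := by
      intro f
      rw [← integral_indicator (cell_meas δ z)]
      congr 1; ext x; by_cases hx : x ∈ cell δ z <;> simp [Set.indicator, hx]
    simp only [e] at h1
    have hi : ∀ f : R3 → ℝ, L2loc f → IntegrableOn f (cell δ z) volume := fun f hf => by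
      have hfin : IsFiniteMeasure (volume.restrict (cell δ z)) :=
        ⟨by simpa using (cell_bdd hδ z).measure_lt_top⟩
      exact (hf.on (cell_bdd hδ z)).integrable (by norm_num)
    have h2 := h1.sub_const (∫ x in cell δ z, u' x)
    rw [sub_self] at h2
    refine h2.congr fun n => ?_
    rw [integral_sub (hi _ (h n).hu) (hi _ h'.hu)]
  rw [Metric.tendsto_nhds]
  intro ε hε
  obtain ⟨δ, hδ, hδε⟩ : ∃ δ : ℝ, 0 < δ ∧ 576 * K * δ ^ 2 < ε / 2 := by
    refine ⟨min 1 (ε / (4 * (576 * K + 1))), by positivity, ?_⟩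
    have h1 := min_le_left 1 (ε / (4 * (576 * K + 1)))
    have h2 := min_le_right 1 (ε / (4 * (576 * K + 1)))
    have h3 : 0 < min 1 (ε / (4 * (576 * K + 1))) := by positivity
    rw [le_div_iff₀ (by positivity)] at h2
    nlinarith
  obtain ⟨Z, hZ1, hZ2⟩ := grid hδ R
  have hlim : Tendsto (fun n => ∑ z ∈ Z, (δ ^ 3)⁻¹ * (∫ x in cell δ z, (u n x - u' x)) ^ 2) U (𝓝 0) := by
    have := tendsto_finsetSum Z fun z _ => ((hcell δ hδ z).pow 2).const_mul (δ ^ 3)⁻¹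
    simpa using this
  filter_upwards [hlim.eventually (gt_mem_nhds (show 0 < ε / 2 by positivity))] with n hn
  rw [Real.dist_eq, sub_zero, abs_of_nonneg (integral_nonneg fun x => sq_nonneg _)]
  have hc2 : ∀ z, ∫ x in cell δ z, (u n x - u' x) ^ 2 ≤
      48 * δ ^ 2 * (∑ i, ∫ x in cell δ z, (g n i x - g' i x) ^ 2)
        + (δ ^ 3)⁻¹ * (∫ x in cell δ z, (u n x - u' x)) ^ 2 := by
    intro z
    have hv : volume (cell δ z) = ENNReal.ofReal (δ ^ 3) := cell_vol hδ z
    have hv0 : volume (cell δ z) ≠ 0 := by rw [hv]; simp; positivity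
    have hvr : volume.real (cell δ z) = δ ^ 3 := by
      rw [Measure.real, hv, ENNReal.toReal_ofReal (by positivity)]
    have hfin : IsFiniteMeasure (volume.restrict (cell δ z)) :=
      ⟨by simpa using (cell_bdd hδ z).measure_lt_top⟩
    have hp := poincR (hd n) (cell_meas δ z) (cell_convex δ z) (cell_bdd hδ z) hv0 hδ.le
      (fun x hx y hy => cell_diam hδ hx hy)
    set v := fun x => u n x - u' x with hv
    have hv2 : MemLp v 2 (volume.restrict (cell δ z)) := (hd n).hu.on (cell_bdd hδ z)
    have hvi : Integrable v (volume.restrict (cell δ z)) := hv2.integrable (by norm_num)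
    set a := avg (cell δ z) v with ha
    have hI : ∫ x in cell δ z, v x = δ ^ 3 * a := by
      rw [ha, avg, hvr]; field_simp
    have h1 : ∫ x in cell δ z, (v x - a) ^ 2
        = (∫ x in cell δ z, v x ^ 2) - 2 * a * (∫ x in cell δ z, v x) + δ ^ 3 * a ^ 2 := by
      have : ∀ x, (v x - a) ^ 2 = v x ^ 2 - 2 * a * v x + a ^ 2 := fun x => by ring
      simp only [this]
      rw [integral_add (f := fun x => v x ^ 2 - 2 * a * v x) (hv2.integrable_sq.sub (hvi.const_mul _))
        (integrable_const _), integral_sub hv2.integrable_sq (hvi.const_mul _), integral_const_mul]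
      simp [hvr]
    show ∫ x in cell δ z, v x ^ 2 ≤ _ + _ * (∫ x in cell δ z, v x) ^ 2
    have h3 : (δ ^ 3)⁻¹ * (δ ^ 3 * a) ^ 2 = δ ^ 3 * a ^ 2 := by field_simp
    rw [h1, hI] at hp
    rw [hI, h3]
    linarith
  have hgi : ∀ i, ∫ x in QR (R + δ), (g n i x - g' i x) ^ 2 ≤ 4 * K := by
    intro i
    have m1 := (h n).hg i (R + δ)
    have m2 := h'.hg i (R + δ)
    calc _ ≤ ∫ x in QR (R + δ), (2 * g n i x ^ 2 + 2 * g' i x ^ 2) := by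
          refine integral_mono (m1.sub m2).integrable_sq
            ((m1.integrable_sq.const_mul 2).add (m2.integrable_sq.const_mul 2)) fun x => ?_
          show (g n i x - g' i x) ^ 2 ≤ 2 * g n i x ^ 2 + 2 * g' i x ^ 2
          nlinarith [sq_nonneg (g n i x + g' i x)]
      _ = 2 * (∫ x in QR (R + δ), g n i x ^ 2) + 2 * ∫ x in QR (R + δ), g' i x ^ 2 := by
          rw [integral_add (m1.integrable_sq.const_mul 2) (m2.integrable_sq.const_mul 2),
            integral_const_mul, integral_const_mul]
      _ ≤ _ := by linarith [hK n i (R + δ), hK' i (R + δ)]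
  calc ∫ x in QR R, (u n x - u' x) ^ 2 ≤ ∑ z ∈ Z, ∫ x in cell δ z, (u n x - u' x) ^ 2 :=
        grid_le hδ hZ1 hZ2 ((hd n).hu (R + δ)).integrable_sq fun x => sq_nonneg _
    _ ≤ ∑ z ∈ Z, (48 * δ ^ 2 * (∑ i, ∫ x in cell δ z, (g n i x - g' i x) ^ 2)
        + (δ ^ 3)⁻¹ * (∫ x in cell δ z, (u n x - u' x)) ^ 2) := Finset.sum_le_sum fun z _ => hc2 z
    _ = 48 * δ ^ 2 * (∑ i, ∑ z ∈ Z, ∫ x in cell δ z, (g n i x - g' i x) ^ 2)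
        + ∑ z ∈ Z, (δ ^ 3)⁻¹ * (∫ x in cell δ z, (u n x - u' x)) ^ 2 := by
        rw [Finset.sum_add_distrib, ← Finset.mul_sum, Finset.sum_comm]
    _ ≤ 48 * δ ^ 2 * (∑ i : Fin 3, 4 * K) + ∑ z ∈ Z, (δ ^ 3)⁻¹ * (∫ x in cell δ z, (u n x - u' x)) ^ 2 := by
        gcongr with i _
        exact (grid_ge hδ hZ2 ((hd n).hg i (R + δ)).integrable_sq fun x => sq_nonneg _).trans (hgi i)
    _ < ε := by
        simp only [Finset.sum_const, Finset.card_univ, Fintype.card_fin, nsmul_eq_mul]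
        push_cast
        linarith

end

section

namespace SkyrmeMap
theorem ASq_eq (φ : SkyrmeMap) (x : R3) : ASq φ x = ∑ c, ∑ d, ∑ i, φ.AA c d i x ^ 2 := by
  have h : ∀ i j : Fin 3, wedgeSq (φ.pderiv i x) (φ.pderiv j x) =
      ∑ a, ∑ b, (φ.gr a x i * φ.gr b x j - φ.gr b x i * φ.gr a x j) ^ 2 / 2 := by
    intro i j
    rw [wedgeSq_eq]; simp only [Finset.sum_div, gr]
  unfold ASq
  simp_rw [h]
  have e1 : ∀ F : Fin 3 → Fin 3 → Fin 4 → Fin 4 → ℝ, ∑ i, ∑ j, ∑ a, ∑ b, F i j a b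
      = ∑ a, ∑ b, ∑ i, ∑ j, F i j a b := by
    intro F
    have : ∀ i, ∑ j, ∑ a, ∑ b, F i j a b = ∑ a, ∑ b, ∑ j, F i j a b := by
      intro i
      rw [Finset.sum_comm]
      refine Finset.sum_congr rfl fun a _ => ?_
      rw [Finset.sum_comm]
    simp_rw [this]
    rw [Finset.sum_comm]
    refine Finset.sum_congr rfl fun a _ => ?_
    rw [Finset.sum_comm]
  rw [e1]
  refine Finset.sum_congr rfl fun c _ => Finset.sum_congr rfl fun d _ => ?_
  simp only [Fin.sum_univ_three, AA, cr]
  simp only [show (0:Fin 3)+1 = 1 from rfl, show (0:Fin 3)+2 = 2 from rfl, show (1:Fin 3)+1 = 2 from rfl,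
    show (1:Fin 3)+2 = 0 from rfl, show (2:Fin 3)+1 = 0 from rfl, show (2:Fin 3)+2 = 1 from rfl]
  ring

theorem pd_sq_le_e (φ : SkyrmeMap) (i : Fin 3) (a : Fin 4) (x : R3) :
    φ.pderiv i x a ^ 2 ≤ energyDensity φ x := by
  have h1 := gr_sq_le φ a x
  have h2 : φ.gr a x i ^ 2 ≤ ∑ i, φ.gr a x i ^ 2 :=
    Finset.single_le_sum (f := fun i => φ.gr a x i ^ 2) (fun _ _ => sq_nonneg _) (Finset.mem_univ i)
  have h3 := ASq_nonneg φ x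
  unfold energyDensity
  change φ.gr a x i ^ 2 ≤ _
  linarith

theorem AA_sq_le_e (φ : SkyrmeMap) (c d : Fin 4) (i : Fin 3) (x : R3) :
    φ.AA c d i x ^ 2 ≤ energyDensity φ x := by
  have h1 := AA_sq_le φ c d i x
  have h3 := gradSq_nonneg φ x
  unfold energyDensity
  linarith

theorem pd_sq_int_le {φ : SkyrmeMap} (h : memX φ) (i : Fin 3) (a : Fin 4) :
    ∫ x, φ.pderiv i x a ^ 2 ≤ energy φ :=
  integral_mono ((pd_memLp h i a).integrable_sq) h (fun x => pd_sq_le_e φ i a x)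

theorem AA_sq_int_le {φ : SkyrmeMap} (h : memX φ) (c d : Fin 4) (i : Fin 3) :
    ∫ x, φ.AA c d i x ^ 2 ≤ energy φ :=
  integral_mono ((AA_memLp h c d i).integrable_sq) h (fun x => AA_sq_le_e φ c d i x)

theorem e_eq_sum (φ : SkyrmeMap) (x : R3) : energyDensity φ x =
    (∑ a, ∑ i, φ.pderiv i x a ^ 2) + ∑ c, ∑ d, ∑ i, φ.AA c d i x ^ 2 := by
  unfold energyDensity
  rw [← gr_sq_sum, ASq_eq]; rfl
end SkyrmeMap

/-- weak lower semicontinuity for finitely many functions -/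
theorem lsc_sum (U : Ultrafilter ℕ) {ι : Type*} (s : Finset ι) {f : ι → ℕ → R3 → ℝ} {f' : ι → R3 → ℝ}
    (hf : ∀ j n, MemLp (f j n) 2 volume) (hf' : ∀ j, MemLp (f' j) 2 volume)
    (hw : ∀ j, WConv U (f j) (f' j)) {S : Set R3} (hS : MeasurableSet S) {c : ℝ}
    (hc : ∀ᶠ n in (U : Filter ℕ), ∑ j ∈ s, ∫ x in S, f j n x ^ 2 ≤ c) :
    ∑ j ∈ s, ∫ x in S, f' j x ^ 2 ≤ c := by
  have h1 : ∀ j, Tendsto (fun n => ∫ x, f j n x * S.indicator (f' j) x) U (𝓝 (∫ x in S, f' j x ^ 2)) := by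
    intro j
    have := hw j (S.indicator (f' j)) ((hf' j).indicator hS)
    convert this using 2
    rw [← integral_indicator hS]
    congr 1; ext x
    by_cases hx : x ∈ S <;> simp [hx, sq]
  have h2 : Tendsto (fun n => ∑ j ∈ s, (2 * ∫ x, f j n x * S.indicator (f' j) x) - ∑ j ∈ s, ∫ x in S, f' j x ^ 2) U
      (𝓝 (∑ j ∈ s, (2 * ∫ x in S, f' j x ^ 2) - ∑ j ∈ s, ∫ x in S, f' j x ^ 2)) :=
    (tendsto_finsetSum _ fun j _ => (h1 j).const_mul 2).sub_const _
  have h3 : ∑ j ∈ s, (2 * ∫ x in S, f' j x ^ 2) - ∑ j ∈ s, ∫ x in S, f' j x ^ 2 ≤ c := by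
    refine le_of_tendsto h2 ?_
    filter_upwards [hc] with n hn
    refine le_trans ?_ hn
    rw [← Finset.sum_sub_distrib]
    refine Finset.sum_le_sum fun j _ => ?_
    have e : ∫ x, f j n x * S.indicator (f' j) x = ∫ x in S, f j n x * f' j x := by
      rw [← integral_indicator hS]
      congr 1; ext x
      by_cases hx : x ∈ S <;> simp [hx]
    rw [e, ← integral_const_mul]
    have i1 : IntegrableOn (fun x => f j n x * f' j x) S := ((hf j n).integrable_mul (hf' j)).integrableOn
    have i2 : IntegrableOn (fun x => f' j x ^ 2) S := (hf' j).integrable_sq.integrableOn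
    have i3 : IntegrableOn (fun x => f j n x ^ 2) S := (hf j n).integrable_sq.integrableOn
    rw [← integral_sub (f := fun x => 2 * (f j n x * f' j x)) (i1.const_mul 2) i2]
    refine integral_mono ((i1.const_mul 2).sub i2) i3 fun x => ?_
    change 2 * (f j n x * f' j x) - f' j x ^ 2 ≤ f j n x ^ 2
    nlinarith [sq_nonneg (f j n x - f' j x)]
  rw [← Finset.mul_sum] at h3
  linarith

theorem BC.memLp {R C : ℝ} {w u : R3 → ℝ} (h : BC R C w) (hu : L2loc u) :
    MemLp (fun x => w x * u x) 2 volume := by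
  have h1 : MemLp (fun x => w x * u x) 2 (volume.restrict (QR R)) := by
    refine MemLp.of_le_mul (c := C) (hu R) (h.meas.restrict.mul (hu R).1) ?_
    filter_upwards [ae_restrict_of_ae h.bdd] with x hx
    rw [norm_mul]
    exact mul_le_mul_of_nonneg_right hx (norm_nonneg _)
  rw [← memLp_indicator_iff_restrict (s := QR R) measurableSet_closedBall] at h1
  have e : (fun x => w x * u x) = (QR R).indicator (fun x => w x * u x) := by
    funext x
    by_cases hx : x ∈ QR R
    · rw [Set.indicator_of_mem hx]
    · rw [Set.indicator_of_notMem hx, h.supp x hx, zero_mul]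
  rw [e]; exact h1

theorem one_l2loc : L2loc (fun _ => (1:ℝ)) := continuous_const.l2loc

theorem BC.memLp1 {R C : ℝ} {w : R3 → ℝ} (h : BC R C w) : MemLp w 2 volume := by
  simpa using h.memLp one_l2loc

/-- strong times weak -/
theorem sw_tendsto (U : Ultrafilter ℕ) {u g : ℕ → R3 → ℝ} {u' g' : R3 → ℝ}
    (hu : L2conv U u u') (hul : ∀ n, L2loc (u n)) (hu'l : L2loc u')
    (hg : ∀ n, MemLp (g n) 2 volume) {K : ℝ} (hK : ∀ n, ∫ x, g n x ^ 2 ≤ K) (hw : WConv U g g')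
    {R C : ℝ} (hC : 0 ≤ C) {w : R3 → ℝ} (hbc : BC R C w) :
    Tendsto (fun n => ∫ x, w x * (u n x * g n x)) U (𝓝 (∫ x, w x * (u' x * g' x))) := by
  have h1 := L2conv.tendsto_zero (K := K) hC hu hul hu'l (fun n => L2loc_of_memLp (hg n))
    (fun n => le_trans (setIntegral_le_integral (hg n).integrable_sq (ae_of_all _ fun x => sq_nonneg _)) (hK n))
    (fun _ => hbc)
  have h2 := h1.add (hw _ (hbc.memLp hu'l))
  rw [zero_add] at h2
  have e2 : ∫ x, w x * (u' x * g' x) = ∫ x, g' x * (w x * u' x) := by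
    congr 1; ext x; ring
  rw [e2]
  refine h2.congr fun n => ?_
  rw [← integral_add]
  · congr 1; ext x; ring
  · exact hbc.integrable_mul ((hul n).sub hu'l) (L2loc_of_memLp (hg n))
  · exact (hg n).integrable_mul (hbc.memLp hu'l)

theorem ae_eq_of_test {f g : R3 → ℝ} (hf : LocallyIntegrable f volume) (hg : LocallyIntegrable g volume)
    (h : ∀ ψ : R3 → ℝ, IsTestFun ψ → ∫ x, ψ x * f x = ∫ x, ψ x * g x) : ∀ᵐ x, f x = g x :=
  ae_eq_of_integral_contDiff_smul_eq hf hg fun ψ h1 h2 => h ψ ⟨h1, h2⟩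

/-- convergence of Skyrme maps -/
structure SConv (U : Ultrafilter ℕ) (ψ : ℕ → SkyrmeMap) (φ : SkyrmeMap) : Prop where
  str : ∀ a, L2conv U (fun n x => (ψ n).toFun x a) (fun x => φ.toFun x a)
  wg : ∀ i a, WConv U (fun n x => (ψ n).pderiv i x a) (fun x => φ.pderiv i x a)
  wA : ∀ c d i, WConv U (fun n => (ψ n).AA c d i) (φ.AA c d i)

open SkyrmeMap in
theorem compactness (U : Ultrafilter ℕ) (ψ : ℕ → SkyrmeMap) (hX : ∀ n, memX (ψ n)) {E0 : ℝ}
    (hE : ∀ n, energy (ψ n) ≤ E0) : ∃ φ : SkyrmeMap, memX φ ∧ SConv U ψ φ := by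
  have hpK : ∀ n i a, ∫ x, (ψ n).pderiv i x a ^ 2 ≤ E0 := fun n i a => (pd_sq_int_le (hX n) i a).trans (hE n)
  have hAK : ∀ n c d i, ∫ x, (ψ n).AA c d i x ^ 2 ≤ E0 := fun n c d i => (AA_sq_int_le (hX n) c d i).trans (hE n)
  choose u hum hul huw using fun a : Fin 4 => weak_lim_loc U (u := fun n x => (ψ n).toFun x a)
    (fun n => c_aesm (ψ n) a) (fun n => c_bdd' (ψ n) a)
  choose g hgm hgl hgw using fun (i : Fin 3) (a : Fin 4) => weak_lim U (f := fun n x => (ψ n).pderiv i x a)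
    (fun n => pd_memLp (hX n) i a) (fun n => hpK n i a)
  choose B hBm hBl hBw using fun (c d : Fin 4) (i : Fin 3) => weak_lim U (f := fun n => (ψ n).AA c d i)
    (fun n => AA_memLp (hX n) c d i) (fun n => hAK n c d i)
  have hwd : ∀ a, WD (u a) (fun i => g i a) := by
    intro a
    refine ⟨hul a, fun i => L2loc_of_memLp (hgl i a), fun i χ hχ => ?_⟩
    obtain ⟨R, C, hC, hbc⟩ := (hχ.pd i).exists_bc
    obtain ⟨R', C', hC', hbc'⟩ := hχ.exists_bc
    have t1 := huw a R _ hbc.memLp1 hbc.supp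
    have t2 := (hgw i a _ hbc'.memLp1).neg
    have t3 : Tendsto (fun n => -∫ x, (ψ n).pderiv i x a * χ x) U (𝓝 (∫ x, u a x * _root_.pd i χ x)) := by
      refine t1.congr fun n => ?_
      have := ((wd (hX n) a).weak i χ hχ)
      simp_rw [mul_comm _ (χ _), mul_comm _ (_root_.pd i χ _)]
      exact this
    have := tendsto_nhds_unique t3 t2
    simp_rw [mul_comm _ (u a _), mul_comm _ (g i a _)]
    exact this
  have hgK : ∀ i a, ∫ x, g i a x ^ 2 ≤ E0 := by
    intro i a
    have := lsc_sum U (Finset.univ : Finset Unit) (f := fun _ n x => (ψ n).pderiv i x a) (f' := fun _ => g i a)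
      (fun _ n => pd_memLp (hX n) i a) (fun _ => hgl i a) (fun _ => hgw i a) MeasurableSet.univ
      (c := E0) (Eventually.of_forall fun n => by simpa using hpK n i a)
    simpa using this
  have hstr : ∀ a, L2conv U (fun n x => (ψ n).toFun x a) (u a) := by
    intro a
    refine rellich U (fun n => wd (hX n) a) (hwd a) (K := E0) (fun n i R => ?_) (fun i R => ?_) (huw a)
    · exact (setIntegral_le_integral (pd_memLp (hX n) i a).integrable_sq (ae_of_all _ fun x => sq_nonneg _)).trans (hpK n i a)
    · exact (setIntegral_le_integral (hgl i a).integrable_sq (ae_of_all _ fun x => sq_nonneg _)).trans (hgK i a)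
  have hsph : ∀ᵐ x, ∑ a, u a x * u a x = 1 := by
    refine ae_eq_of_test (g := fun _ => (1:ℝ)) ?_ ?_ ?_
    · have : ∀ a, LocallyIntegrable (fun x => u a x * u a x) volume := by
        intro a
        rw [locallyIntegrable_iff]
        intro k hk
        obtain ⟨R, hR⟩ := hk.isBounded.subset_closedBall 0
        exact IntegrableOn.mono_set ((hul a R).integrable_mul (hul a R)) hR
      exact locallyIntegrable_finsetSum _ fun a _ => this a
    · exact continuous_const.locallyIntegrable
    intro χ hχ
    obtain ⟨R, C, hC, hbc⟩ := hχ.exists_bc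
    have t1 : ∀ a, Tendsto (fun n => ∫ x, χ x * ((ψ n).toFun x a * (ψ n).toFun x a)) U
        (𝓝 (∫ x, χ x * (u a x * u a x))) := by
      intro a
      have hl : ∀ n, L2loc (fun x => (ψ n).toFun x a) := fun n => (wd (hX n) a).hu
      have a1 := L2conv.tendsto hC (hstr a) hl (hul a) (hul a) hbc
      have a2 := L2conv.tendsto_zero (g := fun n x => (ψ n).toFun x a) (K := (volume (QR R)).toReal) hC (hstr a) hl (hul a) hl
        (fun n => ?_) (fun _ => hbc)
      · have := a1.add a2
        rw [add_zero] at this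
        refine this.congr fun n => ?_
        rw [← integral_add]
        · congr 1; ext x; ring
        · exact hbc.integrable_mul (hl n) (hul a)
        · exact hbc.integrable_mul ((hl n).sub (hul a)) (hl n)
      · have : ∫ x in QR R, (ψ n).toFun x a ^ 2 ≤ ∫ x in QR R, (1:ℝ) := by
          refine integral_mono_ae ((hl n R).integrable_sq) (integrableOn_const (by exact measure_closedBall_lt_top.ne)) ?_
          filter_upwards [ae_restrict_of_ae (c_bdd' (ψ n) a)] with x hx
          rw [← sq_abs]; exact pow_le_one₀ (abs_nonneg _) hx
        simpa [Measure.real] using this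
    have t2 := tendsto_finsetSum Finset.univ fun a _ => t1 a
    have t3 : Tendsto (fun n => ∑ a, ∫ x, χ x * ((ψ n).toFun x a * (ψ n).toFun x a)) U (𝓝 (∫ x, χ x * 1)) := by
      refine tendsto_const_nhds.congr fun n => ?_
      rw [← integral_finsetSum]
      · refine integral_congr_ae ?_
        filter_upwards [(ψ n).sphere] with x hx
        rw [← Finset.mul_sum]
        congr 1; exact hx.symm
      · intro a _
        exact hbc.integrable_mul (wd (hX n) a).hu (wd (hX n) a).hu
    have := tendsto_nhds_unique t2 t3
    rw [← this, ← integral_finsetSum]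
    · simp_rw [Finset.mul_sum]
    · intro a _
      exact hbc.integrable_mul (hul a) (hul a)
  let φ : SkyrmeMap :=
    { toFun := fun x a => u a x
      pderiv := fun i x a => g i a x
      meas := measurable_pi_lambda _ hum
      pderiv_locInt := fun i => by
        rw [locallyIntegrable_iff]
        intro k hk
        refine Integrable.of_eval fun a => ?_
        exact (locallyIntegrable_iff.1 (L2loc_of_memLp (hgl i a)).locInt) k hk
      sphere := hsph
      weak := fun i a χ hχ => (hwd a).weak i χ hχ }
  have hAeq : ∀ c d i, ∀ᵐ x, φ.AA c d i x = B c d i x := by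
    intro c d i
    refine ae_eq_of_test ?_ (L2loc_of_memLp (hBl c d i)).locInt ?_
    · rw [locallyIntegrable_iff]
      intro k hk
      obtain ⟨R, hR⟩ := hk.isBounded.subset_closedBall 0
      refine IntegrableOn.mono_set ?_ hR
      have l := fun i a => (L2loc_of_memLp (hgl i a)) R
      exact ((l (i+1) c).integrable_mul (l (i+2) d)).sub ((l (i+2) c).integrable_mul (l (i+1) d))
    intro χ hχ
    obtain ⟨R, C, hC, hbc⟩ := hχ.exists_bc
    have t1 := hBw c d i _ hbc.memLp1
    have t2 : ∀ j l : Fin 3, Tendsto (fun n => ∫ x, _root_.pd j χ x * ((ψ n).toFun x c * (ψ n).pderiv l x d)) U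
      (𝓝 (∫ x, _root_.pd j χ x * (u c x * g l d x))) := by
      intro j l
      obtain ⟨R, C, hC, hbc⟩ := (hχ.pd j).exists_bc
      exact sw_tendsto U (hstr c) (fun n => (wd (hX n) c).hu) (hul c) (fun n => pd_memLp (hX n) l d)
        (fun n => hpK n l d) (hgw l d) hC hbc
    have t3 := (t2 (i+2) (i+1)).sub (t2 (i+1) (i+2))
    have e := dc_cr (hwd c) (hwd d) hχ i
    rw [← e] at t3
    have t4 : Tendsto (fun n => ∫ x, (ψ n).AA c d i x * χ x) U (𝓝 (∫ x, χ x * φ.AA c d i x)) := by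
      refine t3.congr fun n => ?_
      rw [← dc_cr (wd (hX n) c) (wd (hX n) d) hχ i]
      congr 1; ext x; rw [mul_comm]; rfl
    rw [tendsto_nhds_unique t4 t1]
    congr 1; ext x; ring
  have hAl : ∀ c d i, MemLp (φ.AA c d i) 2 volume := fun c d i =>
    (memLp_congr_ae (hAeq c d i)).2 (hBl c d i)
  refine ⟨φ, ?_, ⟨hstr, hgw, fun c d i => ?_⟩⟩
  · have : energyDensity φ = fun x => (∑ a, ∑ i, φ.pderiv i x a ^ 2) + ∑ c, ∑ d, ∑ i, φ.AA c d i x ^ 2 := by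
      ext x; exact e_eq_sum φ x
    unfold memX
    rw [this]
    refine Integrable.add ?_ ?_
    · exact integrable_finsetSum _ fun a _ => integrable_finsetSum _ fun i _ => (hgl i a).integrable_sq
    · exact integrable_finsetSum _ fun c _ => integrable_finsetSum _ fun d _ =>
        integrable_finsetSum _ fun i _ => (hAl c d i).integrable_sq
  · intro q hq
    have := hBw c d i q hq
    convert this using 2
    refine integral_congr_ae ?_
    filter_upwards [hAeq c d i] with x hx
    rw [hx]

end

section

namespace SkyrmeMap
/-- all square terms of the energy density -/
def ff (φ : SkyrmeMap) : (Fin 4 × Fin 3) ⊕ (Fin 4 × Fin 4 × Fin 3) → R3 → ℝ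
  | .inl (a, i) => fun x => φ.pderiv i x a
  | .inr (c, d, i) => φ.AA c d i

theorem e_eq_ff (φ : SkyrmeMap) (x : R3) : energyDensity φ x = ∑ j, φ.ff j x ^ 2 := by
  rw [e_eq_sum, Fintype.sum_sum_type, Fintype.sum_prod_type, Fintype.sum_prod_type]
  simp only [Fintype.sum_prod_type]; rfl

theorem ff_memLp {φ : SkyrmeMap} (h : memX φ) (j) : MemLp (φ.ff j) 2 volume := by
  rcases j with ⟨a, i⟩ | ⟨c, d, i⟩
  · exact pd_memLp h i a
  · exact AA_memLp h c d i

theorem setInt_e {φ : SkyrmeMap} (h : memX φ) (S : Set R3) :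
    ∫ x in S, energyDensity φ x = ∑ j, ∫ x in S, φ.ff j x ^ 2 := by
  simp_rw [e_eq_ff]
  exact integral_finsetSum _ fun j _ => (ff_memLp h j).integrable_sq.integrableOn
end SkyrmeMap
open SkyrmeMap

theorem SConv.lsc {U : Ultrafilter ℕ} {ψ : ℕ → SkyrmeMap} {φ : SkyrmeMap} (h : SConv U ψ φ)
    (hX : ∀ n, memX (ψ n)) (hφ : memX φ) {S : Set R3} (hS : MeasurableSet S) {c : ℝ}
    (hc : ∀ᶠ n in (U : Filter ℕ), ∫ x in S, energyDensity (ψ n) x ≤ c) :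
    ∫ x in S, energyDensity φ x ≤ c := by
  rw [setInt_e hφ]
  refine lsc_sum U Finset.univ (f := fun j n => (ψ n).ff j) (fun j n => ff_memLp (hX n) j)
    (fun j => ff_memLp hφ j) ?_ hS ?_
  · rintro (⟨a, i⟩ | ⟨c, d, i⟩)
    · exact h.wg i a
    · exact h.wA c d i
  · filter_upwards [hc] with n hn
    rwa [setInt_e (hX n)] at hn

theorem SConv.MM_tendsto {U : Ultrafilter ℕ} {ψ : ℕ → SkyrmeMap} {φ : SkyrmeMap} (h : SConv U ψ φ)
    (hX : ∀ n, memX (ψ n)) (hφ : memX φ) {E0 : ℝ} (hE : ∀ n, energy (ψ n) ≤ E0)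
    {χ : R3 → ℝ} (hχ : IsTestFun χ) (b c d : Fin 4) :
    Tendsto (fun n => ∫ x, χ x * (ψ n).MM b c d x) U (𝓝 (∫ x, χ x * φ.MM b c d x)) := by
  have key : ∀ φ : SkyrmeMap, memX φ → ∫ x, χ x * φ.MM b c d x =
      - ∑ i, ∫ x, _root_.pd i χ x * (φ.toFun x b * φ.AA c d i x) := by
    intro φ hφ
    rw [MM_parts hφ hχ b c d 0, ← integral_finsetSum]
    · congr 2; ext x
      rw [sub_zero, Finset.mul_sum]
      exact Finset.sum_congr rfl fun i _ => by ring
    · intro i _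
      obtain ⟨R, C, hC, hbc⟩ := (hχ.pd i).exists_bc
      exact hbc.integrable_mul (wd hφ b).hu (L2loc_of_memLp (AA_memLp hφ c d i))
  rw [key φ hφ]
  simp_rw [fun n => key (ψ n) (hX n)]
  refine (tendsto_finsetSum _ fun i _ => ?_).neg
  obtain ⟨R, C, hC, hbc⟩ := (hχ.pd i).exists_bc
  exact sw_tendsto U (h.str b) (fun n => (wd (hX n) b).hu) (wd hφ b).hu
    (fun n => AA_memLp (hX n) c d i) (fun n => (AA_sq_int_le (hX n) c d i).trans (hE n)) (h.wA c d i) hC hbc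

theorem moll_supp (n : ℕ) {f : R3 → ℝ} {R : ℝ} (h : ∀ x, x ∉ QR R → f x = 0) :
    ∀ x, x ∉ QR (R + 1) → moll n f x = 0 := by
  intro x hx
  unfold moll
  refine integral_eq_zero_of_ae (Eventually.of_forall fun t => ?_)
  change rho n t * f (x - t) = 0
  by_cases ht : (1:ℝ) / (n + 1) ≤ ‖t‖
  · rw [rho_supp n t ht, zero_mul]
  · rw [h (x - t), mul_zero]
    intro hxt
    apply hx
    have h1 : ‖x - t‖ ≤ R := by simpa [QR] using hxt
    have h2 : ‖t‖ ≤ 1 := by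
      refine (not_le.1 ht).le.trans ?_
      rw [div_le_one (by positivity)]
      have : (0:ℝ) ≤ n := Nat.cast_nonneg n
      linarith
    have h3 : ‖x‖ ≤ ‖x - t‖ + ‖t‖ := by simpa using norm_add_le (x - t) t
    have : ‖x‖ ≤ R + 1 := by linarith
    simpa [QR] using this

theorem young_key {φ : SkyrmeMap} (h : memX φ) {E0 : ℝ} (hE : energy φ ≤ E0) {C R δ : ℝ} (hδ : 0 < δ)
    {p η M : R3 → ℝ} (hp : AEStronglyMeasurable p volume) (hη : AEStronglyMeasurable η volume)
    (hpb : ∀ᵐ x, |p x| ≤ C) (hηb : ∀ᵐ x, |η x| ≤ C) (hps : ∀ x, x ∉ QR R → p x = 0)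
    (hηs : ∀ x, x ∉ QR R → η x = 0) (hM : ∀ x, M x ^ 4 ≤ energyDensity φ x ^ 3)
    (hMi : Integrable M volume) :
    |(∫ x, p x * M x) - ∫ x, η x * M x| ≤
      (δ⁻¹ ^ 3 * (4 * C ^ 2 * ∫ x in QR R, (p x - η x) ^ 2) + 3 * (δ * E0)) / 4 := by
  have i1 : Integrable (fun x => p x * M x) volume := hMi.bdd_mul hp (by simpa using hpb)
  have i2 : Integrable (fun x => η x * M x) volume := hMi.bdd_mul hη (by simpa using hηb)
  have hvb : ∀ᵐ x, |p x - η x| ≤ 2 * C := by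
    filter_upwards [hpb, hηb] with x h1 h2
    have := abs_sub (p x) (η x)
    linarith
  have e1 : (∫ x, p x * M x) - ∫ x, η x * M x =
      ∫ x, (QR R).indicator (fun _ => (1:ℝ)) x * ((p x - η x) * M x) := by
    rw [← integral_sub i1 i2]
    congr 1; ext x
    by_cases hx : x ∈ QR R
    · simp [hx]; ring
    · simp [hx, hps x hx, hηs x hx]
  have hv := hp.sub hη
  have y := young_int h (C0 := 1) (B := 2 * C) (R := R) zero_le_one hδ
    (w := (QR R).indicator (fun _ => (1:ℝ))) (v := fun x => p x - η x) (M := M)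
    (fun x hx => by simp [hx]) (fun x => by
      by_cases hx : x ∈ QR R <;> simp [hx]) hv hvb hM
  rw [e1]
  refine y.trans ?_
  rw [one_mul]
  have hL : L2loc (fun x => p x - η x) := L2loc_of_bdd hv hvb
  have b1 : ∫ x in QR R, (p x - η x) ^ 4 ≤ 4 * C ^ 2 * ∫ x in QR R, (p x - η x) ^ 2 := by
    rw [← integral_const_mul]
    refine integral_mono_of_nonneg (Eventually.of_forall fun x => by positivity) ((hL R).integrable_sq.const_mul _) ?_
    filter_upwards [ae_restrict_of_ae hvb] with x hx
    have : (p x - η x) ^ 2 ≤ 4 * C ^ 2 := by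
      rw [← sq_abs]
      calc |p x - η x| ^ 2 ≤ (2 * C) ^ 2 := pow_le_pow_left₀ (abs_nonneg _) hx 2
        _ = 4 * C ^ 2 := by ring
    change (p x - η x) ^ 4 ≤ 4 * C ^ 2 * (p x - η x) ^ 2
    calc (p x - η x) ^ 4 = (p x - η x) ^ 2 * (p x - η x) ^ 2 := by ring
      _ ≤ _ := mul_le_mul_of_nonneg_right this (sq_nonneg _)
  have b2 : ∫ x in QR R, energyDensity φ x ≤ E0 :=
    (setIntegral_le_integral h (ae_of_all _ fun x => e_nonneg φ x)).trans hE
  have := mul_le_mul_of_nonneg_left b1 (show (0:ℝ) ≤ δ⁻¹ ^ 3 by positivity)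
  have := mul_le_mul_of_nonneg_left b2 hδ.le
  linarith

theorem SConv.uM_tendsto {U : Ultrafilter ℕ} {ψ : ℕ → SkyrmeMap} {φ : SkyrmeMap} (h : SConv U ψ φ)
    (hX : ∀ n, memX (ψ n)) (hφ : memX φ) {E0 : ℝ} (hE : ∀ n, energy (ψ n) ≤ E0)
    {χ : R3 → ℝ} (hχ : IsTestFun χ) (a b c d : Fin 4) :
    Tendsto (fun n => ∫ x, (χ x * (ψ n).toFun x a) * (ψ n).MM b c d x) U
      (𝓝 (∫ x, (χ x * φ.toFun x a) * φ.MM b c d x)) := by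
  obtain ⟨R, C, hC, hbc⟩ := hχ.exists_bc
  set E1 := max E0 (energy φ) with hE1
  have hE1φ : energy φ ≤ E1 := le_max_right _ _
  have hE1n : ∀ n, energy (ψ n) ≤ E1 := fun n => (hE n).trans (le_max_left _ _)
  have hE1p : 0 ≤ E1 := le_trans (integral_nonneg fun x => e_nonneg φ x) hE1φ
  set p' : R3 → ℝ := fun x => χ x * φ.toFun x a with hp'
  have pm : ∀ φ : SkyrmeMap, AEStronglyMeasurable (fun x => χ x * φ.toFun x a) volume :=
    fun φ => hbc.meas.mul (c_aesm φ a)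
  have pb : ∀ φ : SkyrmeMap, ∀ᵐ x, |χ x * φ.toFun x a| ≤ C := fun φ => by
    filter_upwards [hbc.bdd, c_bdd' φ a] with x h1 h2
    rw [abs_mul]
    calc |χ x| * |φ.toFun x a| ≤ C * 1 := mul_le_mul h1 h2 (abs_nonneg _) hC
      _ = C := mul_one C
  have ps : ∀ φ : SkyrmeMap, ∀ x, x ∉ QR (R + 1) → χ x * φ.toFun x a = 0 := fun φ x hx => by
    rw [hbc.supp x, zero_mul]
    intro h'; exact hx (Metric.closedBall_subset_closedBall (by linarith) h')
  have ps0 : ∀ x, x ∉ QR R → p' x = 0 := fun x hx => by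
    simp only [hp']; rw [hbc.supp x hx, zero_mul]
  have pl : ∀ φ : SkyrmeMap, L2loc (fun x => χ x * φ.toFun x a) := fun φ => L2loc_of_bdd (pm φ) (pb φ)
  have ht : ∀ m, IsTestFun (moll m p') := fun m => by
    refine ⟨moll_contDiff m (pl φ).locInt, ?_⟩
    exact HasCompactSupport.intro (K := QR (R+1)) (isCompact_closedBall _ _) (moll_supp m ps0)
  rw [Metric.tendsto_nhds]
  intro τ hτ
  obtain ⟨δ, hδ, hδE⟩ : ∃ δ : ℝ, 0 < δ ∧ 3 * (δ * E1) ≤ τ / 2 := by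
    refine ⟨τ / (6 * (E1 + 1)), by positivity, ?_⟩
    have : τ / (6 * (E1 + 1)) * E1 ≤ τ / 6 := by
      rw [div_mul_eq_mul_div, div_le_div_iff₀ (by positivity) (by positivity)]
      nlinarith
    linarith
  set K := δ⁻¹ ^ 3 * (4 * C ^ 2) with hK
  have hK0 : 0 ≤ K := by positivity
  have m1 := moll_L2conv (pl φ) (R + 1)
  obtain ⟨m, hm⟩ := ((m1.const_mul K).eventually (gt_mem_nhds (show K * 0 < τ / 8 by simp; positivity))).exists
  set η := moll m p' with hη
  have ηb : ∀ᵐ x, |η x| ≤ C := Eventually.of_forall (moll_bound m (pl φ).locInt (pb φ))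
  have ηm : AEStronglyMeasurable η volume := (ht m).1.continuous.aestronglyMeasurable
  have yφ := young_key hφ hE1φ hδ (pm φ) ηm (pb φ) ηb (ps φ) (moll_supp m ps0) (φ.MM_pow4 b c d) (MM_int hφ b c d)
  have yn := fun n => young_key (hX n) (hE1n n) hδ (pm (ψ n)) ηm (pb (ψ n)) ηb (ps (ψ n)) (moll_supp m ps0)
    ((ψ n).MM_pow4 b c d) (MM_int (hX n) b c d)
  have t1 := (h.MM_tendsto hX hφ hE (ht m) b c d)
  have t2 := Metric.tendsto_nhds.1 t1 (τ / 8) (by positivity)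
  have t3 := ((h.str a (R+1)).const_mul (K * C ^ 2)).eventually
    (gt_mem_nhds (show K * C ^ 2 * 0 < τ / 8 by simp; positivity))
  filter_upwards [t2, t3] with n h2 h3
  have hm' : K * ∫ x in QR (R+1), (p' x - η x) ^ 2 < τ / 8 := by
    have e : ∀ x, (p' x - η x) ^ 2 = (η x - p' x) ^ 2 := fun x => by ring
    simp_rw [e]
    exact hm
  have hn : ∫ x in QR (R+1), (χ x * (ψ n).toFun x a - η x) ^ 2 ≤
      2 * (C ^ 2 * ∫ x in QR (R+1), ((ψ n).toFun x a - φ.toFun x a) ^ 2) + 2 * ∫ x in QR (R+1), (p' x - η x) ^ 2 := by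
    have i1 := ((((wd (hX n) a).hu.sub (wd hφ a).hu) (R+1)).integrable_sq.const_mul (C ^ 2)).const_mul 2
    have i2 := ((((pl φ).sub ((ht m).1.continuous.l2loc)) (R+1)).integrable_sq).const_mul 2
    have i3 := ((((pl (ψ n)).sub ((ht m).1.continuous.l2loc)) (R+1)).integrable_sq)
    rw [← integral_const_mul, ← integral_const_mul, ← integral_const_mul, ← integral_add i1 i2]
    refine integral_mono_ae i3 (i1.add i2) ?_
    filter_upwards [ae_restrict_of_ae hbc.bdd] with x hx
    change (χ x * (ψ n).toFun x a - η x) ^ 2 ≤ 2 * (C ^ 2 * ((ψ n).toFun x a - φ.toFun x a) ^ 2) + 2 * (χ x * φ.toFun x a - η x) ^ 2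
    have hx2 : χ x ^ 2 ≤ C ^ 2 := by rw [← sq_abs]; exact pow_le_pow_left₀ (abs_nonneg _) hx 2
    have := mul_le_mul_of_nonneg_right hx2 (sq_nonneg ((ψ n).toFun x a - φ.toFun x a))
    nlinarith [sq_nonneg (χ x * ((ψ n).toFun x a - φ.toFun x a) - (χ x * φ.toFun x a - η x))]
  have hn' := mul_le_mul_of_nonneg_left hn hK0
  have yn' := yn n
  rw [Real.dist_eq] at h2 ⊢
  rw [abs_lt] at h2 ⊢
  rw [abs_le] at yφ yn'
  have r1 : δ⁻¹ ^ 3 * (4 * C ^ 2 * ∫ x in QR (R + 1), (χ x * φ.toFun x a - η x) ^ 2) < τ / 8 := by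
    rw [← mul_assoc]; exact hm'
  have r2 : δ⁻¹ ^ 3 * (4 * C ^ 2 * ∫ x in QR (R + 1), (χ x * (ψ n).toFun x a - η x) ^ 2) < τ / 2 := by
    rw [← mul_assoc]
    refine lt_of_le_of_lt hn' ?_
    nlinarith
  constructor <;> linarith [yφ.1, yφ.2, yn'.1, yn'.2, h2.1, h2.2]

theorem SConv.det_tendsto {U : Ultrafilter ℕ} {ψ : ℕ → SkyrmeMap} {φ : SkyrmeMap} (h : SConv U ψ φ)
    (hX : ∀ n, memX (ψ n)) (hφ : memX φ) {E0 : ℝ} (hE : ∀ n, energy (ψ n) ≤ E0)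
    {χ : R3 → ℝ} (hχ : IsTestFun χ) :
    Tendsto (fun n => ∫ x, χ x * detDen (ψ n) x) U (𝓝 (∫ x, χ x * detDen φ x)) := by
  choose s b c d hs hM using Mc_eq_MM
  obtain ⟨R, C, hC, hbc⟩ := hχ.exists_bc
  have key : ∀ φ : SkyrmeMap, memX φ → ∫ x, χ x * detDen φ x =
      ∑ a, s a * ∫ x, (χ x * φ.toFun x a) * φ.MM (b a) (c a) (d a) x := by
    intro φ hφ
    simp_rw [← integral_const_mul]
    rw [← integral_finsetSum]
    · congr 1; ext x
      rw [detDen_eq, Finset.mul_sum]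
      refine Finset.sum_congr rfl fun a _ => ?_
      rw [hM]; ring
    · intro a _
      refine ((MM_int hφ _ _ _).bdd_mul (c := C) (hbc.meas.mul (c_aesm φ a)) ?_).const_mul _
      filter_upwards [hbc.bdd, c_bdd' φ a] with x h1 h2
      simp only [norm_eq_abs, Pi.mul_apply, abs_mul]
      calc |χ x| * |φ.toFun x a| ≤ C * 1 := mul_le_mul h1 h2 (abs_nonneg _) hC
        _ = C := mul_one C
  rw [key φ hφ]
  simp_rw [fun n => key (ψ n) (hX n)]
  exact tendsto_finsetSum _ fun a _ => (h.uM_tendsto hX hφ hE hχ a _ _ _).const_mul _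

end

section

theorem avg_diff {v : R3 → ℝ} {h : Fin 3 → R3 → ℝ} (hv : WD v h) {S T1 T2 : Set R3} (hS : MeasurableSet S)
    (hc : Convex ℝ S) (hb : Bornology.IsBounded S) {ρ : ℝ} (hρ : 0 ≤ ρ)
    (hr : ∀ x ∈ S, ∀ z ∈ S, ‖x - z‖ ≤ ρ) (hS0 : 0 < volume.real S)
    (h1 : T1 ⊆ S) (h2 : T2 ⊆ S) 
    (hv1 : volume.real S ≤ 8 * volume.real T1) (hv2 : volume.real S ≤ 8 * volume.real T2) :
    |avg T1 v - avg T2 v| ≤ 512 * ρ * ((volume.real S)⁻¹ * ∑ l, ∫ x in S, |h l x|) := by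
  have hSt : volume S ≠ ⊤ := hb.measure_lt_top.ne
  have p1 : 0 < volume.real T1 := by linarith
  have p2 : 0 < volume.real T2 := by linarith
  have hf : ∀ T ⊆ S, IsFiniteMeasure (volume.restrict T) := fun T hT =>
    ⟨by simpa using (measure_mono hT).trans_lt hb.measure_lt_top⟩
  have := hf T1 h1
  have := hf T2 h2
  have := hf S subset_rfl
  have vi : ∀ T ⊆ S, IntegrableOn v T := fun T hT => by
    have := hf T hT
    exact (hv.hu.on (hb.subset hT)).integrable (by norm_num)
  have hi : ∀ l, IntegrableOn (h l) S := fun l => ((hv.hg l).on hb).integrable (by norm_num)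
  have e : avg T1 v - avg T2 v = (volume.real T1)⁻¹ * (volume.real T2)⁻¹ * ∫ x in T1, ∫ z in T2, (v x - v z) := by
    have e1 : ∀ x, ∫ z in T2, (v x - v z) = volume.real T2 * v x - ∫ z in T2, v z := by
      intro x
      rw [integral_sub (integrable_const _) (vi T2 h2)]
      simp
    simp_rw [e1]
    rw [integral_sub ((vi T1 h1).const_mul _) (integrable_const _), integral_const_mul]
    simp only [integral_const, measureReal_restrict_apply_univ, smul_eq_mul, avg]
    field_simp
  have pb := poinc1 hv hS hc hb (r := ENNReal.ofReal ρ) ENNReal.ofReal_ne_top (fun x hx z hz => by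
    rw [← ofReal_norm]; exact ENNReal.ofReal_le_ofReal (hr x hx z hz))
  have e2 : ∑ l, ∫⁻ x in S, ‖h l x‖ₑ = ENNReal.ofReal (∑ l, ∫ x in S, |h l x|) := by
    rw [ENNReal.ofReal_sum_of_nonneg fun l _ => integral_nonneg fun x => abs_nonneg _]
    refine Finset.sum_congr rfl fun l _ => ?_
    rw [ofReal_integral_eq_lintegral_ofReal (hi l).abs (ae_of_all _ fun x => abs_nonneg _)]
    simp_rw [Real.enorm_eq_ofReal_abs]
  have b1 : ‖∫ x in T1, ∫ z in T2, (v x - v z)‖ₑ ≤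
      ENNReal.ofReal (8 * ρ * volume.real S * ∑ l, ∫ x in S, |h l x|) := by
    calc ‖∫ x in T1, ∫ z in T2, (v x - v z)‖ₑ ≤ ∫⁻ x in T1, ‖∫ z in T2, (v x - v z)‖ₑ :=
          enorm_integral_le_lintegral_enorm _
      _ ≤ ∫⁻ x in T1, ∫⁻ z in T2, ‖v x - v z‖ₑ := lintegral_mono fun x => enorm_integral_le_lintegral_enorm _
      _ ≤ ∫⁻ x in T1, ∫⁻ z in S, ‖v x - v z‖ₑ := lintegral_mono fun x => lintegral_mono_set h2
      _ ≤ ∫⁻ x in S, ∫⁻ z in S, ‖v x - v z‖ₑ := lintegral_mono_set h1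
      _ ≤ _ := pb
      _ = _ := by
        rw [e2, ENNReal.ofReal_mul (by positivity), ENNReal.ofReal_mul (by positivity),
          ENNReal.ofReal_mul (by norm_num), Measure.real, ENNReal.ofReal_toReal hSt]
        norm_num
  have hsum : 0 ≤ ∑ l, ∫ x in S, |h l x| := Finset.sum_nonneg fun l _ => integral_nonneg fun x => abs_nonneg _
  rw [Real.enorm_eq_ofReal_abs, ENNReal.ofReal_le_ofReal_iff (by positivity)] at b1
  rw [e, abs_mul, abs_of_pos (by positivity)]
  have q1 : (volume.real T1)⁻¹ ≤ 8 * (volume.real S)⁻¹ := by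
    rw [← div_eq_mul_inv, inv_le_comm₀ p1 (by positivity), inv_div]; linarith
  have q2 : (volume.real T2)⁻¹ ≤ 8 * (volume.real S)⁻¹ := by
    rw [← div_eq_mul_inv, inv_le_comm₀ p2 (by positivity), inv_div]; linarith
  calc _ ≤ (8 * (volume.real S)⁻¹) * (8 * (volume.real S)⁻¹) * (8 * ρ * volume.real S * ∑ l, ∫ x in S, |h l x|) := by
        gcongr
    _ = _ := by field_simp; ring

/-- linear functional -/
def lin (c : Fin 3 → ℝ) : R3 →L[ℝ] ℝ := ∑ l, c l • ContinuousLinearMap.proj l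
theorem lin_apply (c : Fin 3 → ℝ) (x : R3) : lin c x = ∑ l, c l * x l := by
  simp [lin]
theorem lin_single (c : Fin 3 → ℝ) (i : Fin 3) : lin c (Pi.single i 1) = c i := by
  rw [lin_apply]; simp [Pi.single_apply]

theorem WD.sub_lin {u : R3 → ℝ} {g : Fin 3 → R3 → ℝ} (h : WD u g) (c : Fin 3 → ℝ) :
    WD (fun x => u x - lin c x) (fun i x => g i x - c i) := by
  have hcd : ContDiff ℝ (⊤ : ℕ∞) (fun x => lin c x) := (lin c).contDiff
  refine ⟨h.hu.sub hcd.continuous.l2loc, fun i => (h.hg i).sub continuous_const.l2loc, fun i ψ hψ => ?_⟩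
  obtain ⟨R, C, hC, hbc⟩ := hψ.exists_bc
  obtain ⟨R', C', hC', hbc'⟩ := (hψ.pd i).exists_bc
  simp_rw [mul_sub]
  rw [integral_sub (hbc'.integrable_mul1 h.hu) (hbc'.integrable_mul1 hcd.continuous.l2loc),
    integral_sub (hbc.integrable_mul1 (h.hg i)) (hbc.integrable_mul1 continuous_const.l2loc), h.weak i ψ hψ]
  have := integral_mul_fderiv_eq_neg_fderiv_mul_of_integrable (μ := volume) (f := fun x => lin c x) (g := ψ) (v := Pi.single i 1)
    ?_ ?_ ?_ (fun x _ => hcd.differentiable (by simp) x) (fun x _ => hψ.1.differentiable (by simp) x)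
  · simp only [ContinuousLinearMap.fderiv, lin_single] at this
    have e1 : ∫ x, _root_.pd i ψ x * lin c x = ∫ x, lin c x * fderiv ℝ ψ x (Pi.single i 1) := by
      congr 1; ext x; rw [mul_comm]
    have e2 : ∫ x, ψ x * c i = ∫ x, c i * ψ x := by congr 1; ext x; rw [mul_comm]
    rw [e1, e2, this]; ring
  · simp only [ContinuousLinearMap.fderiv, lin_single]
    have := (hbc.integrable_mul1 (one_l2loc)).const_mul (c i)
    simpa using this
  · have := hbc'.integrable_mul1 hcd.continuous.l2loc
    simpa [mul_comm] using this
  · have := hbc.integrable_mul1 hcd.continuous.l2loc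
    simpa [mul_comm] using this

theorem cb_vol (x : R3) {r : ℝ} (hr : 0 < r) : volume.real (Metric.closedBall x r) = 8 * r ^ 3 := by
  rw [Measure.real, Real.volume_pi_closedBall _ hr.le, ENNReal.toReal_ofReal (by positivity)]
  simp; ring

theorem avg_lin (c : Fin 3 → ℝ) (x : R3) {r : ℝ} (hr : 0 < r) :
    avg (Metric.closedBall x r) (fun y => lin c y) = lin c x := by
  have hi : IntegrableOn (fun y => lin c y) (Metric.closedBall x r) :=
    (lin c).continuous.continuousOn.integrableOn_compact (isCompact_closedBall _ _)
  have h : ∫ y in Metric.closedBall x r, lin c y = ∫ y in Metric.closedBall x r, lin c (x + x - y) := by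
    have mp := (Measure.measurePreserving_sub_left volume (x + x))
    have := mp.setIntegral_preimage_emb (MeasurableEquiv.subLeft (x+x)).measurableEmbedding
      (fun y => lin c y) (Metric.closedBall x r)
    rw [← this]
    congr 2
    ext y
    simp only [Set.mem_preimage, Metric.mem_closedBall, dist_eq_norm]
    have : x + x - y - x = -(y - x) := by abel
    rw [this, norm_neg]
  have hf : IsFiniteMeasure (volume.restrict (Metric.closedBall x r)) := ⟨by simpa using measure_closedBall_lt_top⟩
  have e : ∀ y, lin c (x + x - y) = 2 * lin c x - lin c y := fun y => by
    rw [map_sub, map_add]; ring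
  simp_rw [e] at h
  rw [integral_sub (integrable_const _) hi] at h
  simp only [integral_const, measureReal_restrict_apply_univ, smul_eq_mul] at h
  have hp : 0 < volume.real (Metric.closedBall x r) := by rw [cb_vol x hr]; positivity
  unfold avg
  rw [inv_mul_eq_iff_eq_mul₀ hp.ne']
  linarith

/-- mean oscillation at a point -/
def osc (G : R3 → R3) (r : ℝ) (x : R3) : ℝ :=
  (8 * r ^ 3)⁻¹ * ∫ y in Metric.closedBall x r, ‖G y - G x‖

theorem avg_step {u : R3 → ℝ} {g : Fin 3 → R3 → ℝ} (h : WD u g) {r : ℝ} (hr : 0 < r) {x x0 : R3}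
    (hx : dist x x0 ≤ r / 2) :
    |avg (Metric.closedBall x (r/2)) u - avg (Metric.closedBall x0 r) u - lin (fun l => g l x0) (x - x0)|
      ≤ 3072 * r * osc (fun y l => g l y) r x0 := by
  have hv := h.sub_lin (fun l => g l x0)
  have hsub : Metric.closedBall x (r/2) ⊆ Metric.closedBall x0 r :=
    Metric.closedBall_subset_closedBall' (by linarith)
  have d := avg_diff hv (S := Metric.closedBall x0 r) (T1 := Metric.closedBall x (r/2)) (T2 := Metric.closedBall x0 r)
    Metric.isClosed_closedBall.measurableSet (convex_closedBall _ _) Metric.isBounded_closedBall (ρ := 2 * r)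
    (by positivity) (fun a ha b hb => by
      rw [← dist_eq_norm]
      have := dist_triangle_right a b x0
      rw [Metric.mem_closedBall] at ha hb
      linarith) (by rw [cb_vol _ hr]; positivity) hsub subset_rfl
      (by rw [cb_vol _ hr, cb_vol _ (by positivity)]; apply le_of_eq; ring)
      (by rw [cb_vol _ hr]; nlinarith [pow_pos hr 3])
  have ai : ∀ (z : R3) (s : ℝ), 0 < s → avg (Metric.closedBall z s) (fun x => u x - lin (fun l => g l x0) x) =
      avg (Metric.closedBall z s) u - lin (fun l => g l x0) z := by
    intro z s hs
    rw [← avg_lin _ z hs]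
    unfold avg
    have hf : IsFiniteMeasure (volume.restrict (Metric.closedBall z s)) := ⟨by simpa using measure_closedBall_lt_top⟩
    rw [integral_sub, mul_sub]
    · exact (h.hu.on Metric.isBounded_closedBall).integrable (by norm_num)
    · exact (lin _).continuous.continuousOn.integrableOn_compact (isCompact_closedBall _ _)
  rw [ai _ _ (by positivity), ai _ _ hr, cb_vol _ hr] at d
  rw [map_sub]
  have hf : IsFiniteMeasure (volume.restrict (Metric.closedBall x0 r)) := ⟨by simpa using measure_closedBall_lt_top⟩
  have hi : ∀ l, IntegrableOn (fun y => g l y - g l x0) (Metric.closedBall x0 r) := fun l =>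
    ((hv.hg l).on Metric.isBounded_closedBall).integrable (by norm_num)
  have hI : IntegrableOn (fun y => (fun l => g l y) - (fun l => g l x0)) (Metric.closedBall x0 r) :=
    Integrable.of_eval fun l => hi l
  have s1 : ∑ l, ∫ y in Metric.closedBall x0 r, |g l y - g l x0| ≤
      3 * ∫ y in Metric.closedBall x0 r, ‖(fun l => g l y) - (fun l => g l x0)‖ := by
    calc _ ≤ ∑ l : Fin 3, ∫ y in Metric.closedBall x0 r, ‖(fun l => g l y) - (fun l => g l x0)‖ := by
          refine Finset.sum_le_sum fun l _ => ?_
          refine integral_mono (hi l).abs hI.norm fun y => ?_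
          exact norm_le_pi_norm ((fun l => g l y) - (fun l => g l x0)) l
      _ = _ := by simp
  calc _ = _ := by congr 1; ring
    _ ≤ _ := d
    _ ≤ 512 * (2 * r) * ((8 * r ^ 3)⁻¹ * (3 * ∫ y in Metric.closedBall x0 r, ‖(fun l => g l y) - (fun l => g l x0)‖)) := by
      gcongr
    _ = _ := by unfold osc; ring

end

section

theorem avg_lim {u : R3 → ℝ} {g : Fin 3 → R3 → ℝ} (h : WD u g) {x : R3} {η : ℝ} {i : ℕ}
    (hl : Tendsto (fun j : ℕ => avg (Metric.closedBall x ((1/2)^j)) u) atTop (𝓝 (u x)))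
    (ho : ∀ j ≥ i, osc (fun y l => g l y) ((1/2)^j) x ≤ η) :
    |avg (Metric.closedBall x ((1/2)^i)) u - u x| ≤ 6144 * (1/2)^i * η := by
  have := dist_le_of_le_geometric_two_of_tendsto₀ (C := 6144 * (1/2)^i * η)
    (f := fun n : ℕ => avg (Metric.closedBall x ((1/2)^(i+n))) u) (a := u x) ?_ ?_
  · simpa [Real.dist_eq] using this
  · intro n
    have hs := avg_step h (r := (1/2)^(i+n)) (by positivity) (x := x) (x0 := x) (by rw [dist_self]; positivity)
    rw [sub_self, map_zero, sub_zero] at hs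
    have e : ((1:ℝ)/2)^(i+(n+1)) = (1/2)^(i+n)/2 := by rw [← add_assoc, pow_succ]; ring
    rw [Real.dist_eq, abs_sub_comm, e]
    refine hs.trans ?_
    calc _ ≤ 3072 * (1/2:ℝ)^(i+n) * η := by
          gcongr
          exact ho _ (by omega)
      _ = _ := by rw [pow_add, one_div, inv_pow 2 n]; field_simp; ring
  · have := hl.comp (tendsto_add_atTop_nat i)
    refine this.congr fun n => ?_
    simp [Function.comp, add_comm]

theorem exists_dyadic {d : ℝ} (hd : 0 < d) {N : ℕ} (hN : d ≤ (1/2)^(N+1)) :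
    ∃ i ≥ N, d ≤ (1/2:ℝ)^(i+1) ∧ (1/2:ℝ)^i ≤ 4 * d := by
  classical
  have hex : ∃ k, (1/2:ℝ)^k < d := exists_pow_lt_of_lt_one hd (by norm_num)
  have h1 := Nat.find_spec hex
  set k := Nat.find hex with hk
  have hkN : N + 2 ≤ k := by
    by_contra hlt
    have : (1/2:ℝ)^(N+1) ≤ (1/2:ℝ)^k := pow_le_pow_of_le_one (by norm_num) (by norm_num) (by omega)
    linarith
  refine ⟨k - 2, by omega, ?_, ?_⟩
  · have := Nat.find_min hex (m := k - 2 + 1) (by omega)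
    linarith
  · have e : (1/2:ℝ)^k = (1/2)^(k-2) / 4 := by
      conv_lhs => rw [show k = (k - 2) + 2 by omega, pow_add]
      norm_num; ring
    linarith

theorem ae_meas {p : R3 → Prop} (h : ∀ᵐ x, p x) : ∃ Z : Set R3, MeasurableSet Z ∧ (∀ᵐ x, x ∈ Z) ∧ ∀ x ∈ Z, p x := by
  obtain ⟨t, h1, h2, h3⟩ := exists_measurable_superset_of_null (ae_iff.1 h)
  refine ⟨tᶜ, h2.compl, ?_, fun x hx => ?_⟩
  · rw [ae_iff]; simpa using h3
  · by_contra hn; exact hx (h1 hn)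

theorem diff_of_unif {u : R3 → ℝ} {g : Fin 3 → R3 → ℝ} (h : WD u g) {E : Set R3}
    (hl : ∀ x ∈ E, Tendsto (fun j : ℕ => avg (Metric.closedBall x ((1/2)^j)) u) atTop (𝓝 (u x)))
    (ho : ∀ η > 0, ∃ N : ℕ, ∀ x ∈ E, ∀ j ≥ N, osc (fun y l => g l y) ((1/2)^j) x ≤ η) :
    ∀ x ∈ E, HasFDerivWithinAt u (lin (fun l => g l x)) E x := by
  intro x0 hx0
  rw [hasFDerivWithinAt_iff_isLittleO, Asymptotics.isLittleO_iff]
  intro c hc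
  obtain ⟨N, hN⟩ := ho (c / 50000) (by positivity)
  have hnb : Metric.closedBall x0 ((1/2)^(N+1)) ∈ 𝓝 x0 := Metric.closedBall_mem_nhds _ (by positivity)
  filter_upwards [nhdsWithin_le_nhds hnb, self_mem_nhdsWithin] with x hx hxE
  by_cases hxx : x = x0
  · simp [hxx]
  rw [Metric.mem_closedBall, dist_eq_norm] at hx
  have hd : 0 < ‖x - x0‖ := norm_pos_iff.2 (sub_ne_zero.2 hxx)
  obtain ⟨i, hiN, hi1, hi2⟩ := exists_dyadic hd hx
  have a1 := avg_lim h (hl x hxE) (η := c / 50000) (i := i+1) (fun j hj => hN x hxE j (by omega))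
  have a2 := avg_lim h (hl x0 hx0) (η := c / 50000) (i := i) (fun j hj => hN x0 hx0 j (by omega))
  have e : ((1:ℝ)/2)^(i+1) = (1/2)^i/2 := by rw [pow_succ]; ring
  have a3 := avg_step h (r := (1/2)^i) (by positivity) (x := x) (x0 := x0) (by rw [dist_eq_norm, ← e]; exact hi1)
  have a4 : 3072 * (1/2)^i * osc (fun y l => g l y) ((1/2)^i) x0 ≤ 3072 * (1/2)^i * (c / 50000) := by
    gcongr
    exact hN x0 hx0 i hiN
  rw [e] at a1
  rw [Real.norm_eq_abs]
  have hp : (0:ℝ) < (1/2)^i := by positivity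
  have key : |u x - u x0 - lin (fun l => g l x0) (x - x0)| ≤ 12288 * (1/2)^i * (c/50000) := by
    rw [abs_le] at a1 a2 a3 ⊢
    constructor <;> nlinarith [a1.1, a1.2, a2.1, a2.2, a3.1, a3.2, a4]
  refine key.trans ?_
  have := mul_le_mul_of_nonneg_left hi2 hc.le
  nlinarith [mul_pos hc hd]

theorem osc_meas {G : R3 → R3} (hG : Measurable G) (r : ℝ) : StronglyMeasurable (osc G r) := by
  have e : osc G r = fun x => (8 * r ^ 3)⁻¹ * ∫ y, (Metric.closedBall x r).indicator (fun y => ‖G y - G x‖) y := by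
    ext x
    unfold osc
    rw [integral_indicator Metric.isClosed_closedBall.measurableSet]
  rw [e]
  refine StronglyMeasurable.const_mul ?_ _
  have hm : Measurable (fun p : R3 × R3 => {q : R3 × R3 | dist q.2 q.1 ≤ r}.indicator (fun q => ‖G q.2 - G q.1‖) p) := by
    refine Measurable.indicator ?_ ?_
    · exact ((hG.comp measurable_snd).sub (hG.comp measurable_fst)).norm
    · exact (isClosed_le (continuous_snd.dist continuous_fst) continuous_const).measurableSet
  exact hm.stronglyMeasurable.integral_prod_right'  (ν := volume)

theorem lusin_meas {u : R3 → ℝ} {g : Fin 3 → R3 → ℝ} (h : WD u g) (hg : ∀ l, Measurable (g l)) :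
    ∃ E : ℕ × ℕ → Set R3, (∀ k, MeasurableSet (E k)) ∧ (∀ᵐ x, ∃ k, x ∈ E k) ∧
      ∀ k, ∀ x ∈ E k, HasFDerivWithinAt u (lin (fun l => g l x)) (E k) x := by
  have hG : Measurable (fun y l => g l y) := measurable_pi_lambda _ hg
  have hGl : LocallyIntegrable (fun y l => g l y) volume := by
    rw [locallyIntegrable_iff]
    intro k hk
    refine Integrable.of_eval fun a => ?_
    exact (locallyIntegrable_iff.1 (h.hg a).locInt) k hk
  have htend : Tendsto (fun j : ℕ => ((1:ℝ)/2)^j) atTop (𝓝[>] 0) := by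
    rw [tendsto_nhdsWithin_iff]
    exact ⟨tendsto_pow_atTop_nhds_zero_of_lt_one (by norm_num) (by norm_num),
      Eventually.of_forall fun j => by simp⟩
  have hmem : ∀ x : R3, ∀ᶠ j : ℕ in atTop, x ∈ Metric.closedBall x (1 * ((1:ℝ)/2)^j) := fun x =>
    Eventually.of_forall fun j => Metric.mem_closedBall_self (by positivity)
  have l1 := IsUnifLocDoublingMeasure.ae_tendsto_average (μ := (volume : Measure R3)) h.hu.locInt 1
  have l2 := IsUnifLocDoublingMeasure.ae_tendsto_average_norm_sub (μ := (volume : Measure R3)) hGl 1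
  have l1' : ∀ᵐ x, Tendsto (fun j : ℕ => avg (Metric.closedBall x ((1/2)^j)) u) atTop (𝓝 (u x)) := by
    filter_upwards [l1] with x hx
    refine (hx (fun _ => x) _ htend (hmem x)).congr fun j => ?_
    rw [setAverage_eq]; rfl
  have l2' : ∀ᵐ x, Tendsto (fun j : ℕ => osc (fun y l => g l y) ((1/2)^j) x) atTop (𝓝 0) := by
    filter_upwards [l2] with x hx
    refine (hx (fun _ => x) _ htend (hmem x)).congr fun j => ?_
    rw [setAverage_eq, cb_vol _ (by positivity)]; rfl
  obtain ⟨Z, hZm, hZa, hZ⟩ := ae_meas l1'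
  have eg : ∀ k : ℕ × ℕ, ∃ t ⊆ QR k.1, MeasurableSet t ∧ volume t ≤ ENNReal.ofReal (1 / (k.2 + 1)) ∧
      TendstoUniformlyOn (fun (j : ℕ) x => osc (fun y l => g l y) ((1/2)^j) x) (fun _ => (0:ℝ)) atTop (QR k.1 \ t) := by
    intro k
    exact tendstoUniformlyOn_of_ae_tendsto (fun j => osc_meas hG _) stronglyMeasurable_const
      Metric.isClosed_closedBall.measurableSet measure_closedBall_lt_top.ne
      (by filter_upwards [l2'] with x hx _ using hx) (by positivity)
  choose t ht1 ht2 ht3 ht4 using eg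
  refine ⟨fun k => (QR k.1 \ t k) ∩ Z, fun k => ((Metric.isClosed_closedBall.measurableSet).diff (ht2 k)).inter hZm, ?_, ?_⟩
  · have hz : ∀ k : ℕ, volume (⋂ m : ℕ, t (k, m)) = 0 := by
      intro k
      refine le_antisymm (ge_of_tendsto' (f := fun m : ℕ => ENNReal.ofReal (1 / ((m:ℝ) + 1))) (x := atTop) ?_ fun m => ?_) zero_le
      · have := ENNReal.tendsto_ofReal tendsto_one_div_add_atTop_nhds_zero_nat
        simpa using this
      · exact (measure_mono (Set.iInter_subset _ m)).trans (ht3 (k, m))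
    have hz' : ∀ᵐ x : R3, ∀ k : ℕ, x ∉ ⋂ m : ℕ, t (k, m) := by
      rw [ae_all_iff]; intro k; exact measure_eq_zero_iff_ae_notMem.1 (hz k)
    filter_upwards [hz', hZa] with x hx hxZ
    obtain ⟨k, hk⟩ := exists_nat_ge ‖x‖
    have := hx k
    rw [Set.mem_iInter] at this
    push Not at this
    obtain ⟨m, hm⟩ := this
    exact ⟨(k, m), ⟨by simpa [QR] using hk, hm⟩, hxZ⟩
  · intro k
    refine diff_of_unif h (fun x hx => hZ x hx.2) fun η hη => ?_
    obtain ⟨N, hN⟩ := eventually_atTop.1 (Metric.tendstoUniformlyOn_iff.1 (ht4 k) η hη)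
    refine ⟨N, fun x hx j hj => ?_⟩
    have := hN j hj x hx.1
    rw [dist_comm, Real.dist_eq, sub_zero] at this
    exact (le_abs_self _).trans this.le

theorem lusin {u : R3 → ℝ} {g : Fin 3 → R3 → ℝ} (h : WD u g) :
    ∃ E : ℕ × ℕ → Set R3, (∀ k, MeasurableSet (E k)) ∧ (∀ᵐ x, ∃ k, x ∈ E k) ∧
      ∀ k, ∀ x ∈ E k, HasFDerivWithinAt u (lin (fun l => g l x)) (E k) x := by
  have hga : ∀ l, AEStronglyMeasurable (g l) volume := fun l => (h.hg l).aesm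
  have hae : ∀ᵐ x, ∀ l, g l x = (hga l).mk (g l) x := ae_all_iff.2 fun l => (hga l).ae_eq_mk
  have h' : WD u (fun l => (hga l).mk (g l)) := by
    refine ⟨h.hu, fun l R => ?_, fun i ψ hψ => ?_⟩
    · exact (memLp_congr_ae (ae_restrict_of_ae (hga l).ae_eq_mk)).1 (h.hg l R)
    · rw [h.weak i ψ hψ]
      congr 1
      refine integral_congr_ae ?_
      filter_upwards [hae] with x hx
      rw [hx i]
  obtain ⟨Z, hZm, hZa, hZ⟩ := ae_meas hae
  obtain ⟨E, hE1, hE2, hE3⟩ := lusin_meas h' (fun l => (hga l).stronglyMeasurable_mk.measurable)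
  refine ⟨fun k => E k ∩ Z, fun k => (hE1 k).inter hZm, ?_, fun k x hx => ?_⟩
  · filter_upwards [hE2, hZa] with x ⟨k, hk⟩ hz
    exact ⟨k, hk, hz⟩
  · have := (hE3 k x hx.1).mono (Set.inter_subset_left (t := Z))
    convert this using 2
    ext l; exact hZ x hx.2 l

end

section

theorem area_pieces {p : R3 → R3} {p' : R3 → R3 →L[ℝ] R3} {E : ℕ → Set R3} {S : Set R3}
    (hE : ∀ k, MeasurableSet (E k)) (hS : MeasurableSet S) (hSE : S ⊆ ⋃ k, E k)
    (hd : ∀ k, ∀ x ∈ E k, HasFDerivWithinAt p (p' x) (E k) x)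
    (h0 : ∀ x ∈ S, (p' x).det ≠ 0) :
    ∃ P : ℕ × ℕ → Set R3, (∀ m, MeasurableSet (P m)) ∧ Pairwise (Function.onFun Disjoint P) ∧
      S = ⋃ m, P m ∧ (∀ m, Set.InjOn p (P m)) ∧
      (∀ m, ∀ x ∈ P m, HasFDerivWithinAt p (p' x) (P m) x) := by
  classical
  set Q : ℕ → Set R3 := fun k => S ∩ disjointed E k with hQ
  have hQE : ∀ k, Q k ⊆ E k := fun k x hx => disjointed_subset E k hx.2
  have hQm : ∀ k, MeasurableSet (Q k) := fun k => hS.inter (MeasurableSet.disjointed hE k)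
  have hQd : ∀ k, ∀ x ∈ Q k, HasFDerivWithinAt p (p' x) (Q k) x := fun k x hx =>
    (hd k x (hQE k hx)).mono (hQE k)
  let r : (R3 →L[ℝ] R3) → NNReal := fun A =>
    if h : A.det ≠ 0 then ‖((A.toContinuousLinearEquivOfDetNeZero h).symm : R3 →L[ℝ] R3)‖₊⁻¹ / 2 else 1
  have rpos : ∀ A, r A ≠ 0 := by
    intro A
    simp only [r]
    split_ifs with h
    · have := (A.toContinuousLinearEquivOfDetNeZero h).nnnorm_symm_pos
      positivity
    · simp
  choose t A h1 h2 h3 h4 h5 using fun k =>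
    exists_partition_approximatesLinearOn_of_hasFDerivWithinAt p (Q k) p' (hQd k) r rpos
  refine ⟨fun m => Q m.1 ∩ t m.1 m.2, fun m => (hQm _).inter (h2 _ _), ?_, ?_, ?_, ?_⟩
  · rintro ⟨k, n⟩ ⟨k', n'⟩ hne
    by_cases hk : k = k'
    · subst hk
      have : n ≠ n' := fun h => hne (by rw [h])
      exact (h1 k this).mono Set.inter_subset_right Set.inter_subset_right
    · have := disjoint_disjointed E hk
      exact this.mono (fun x hx => hx.1.2) (fun x hx => hx.1.2)
  · ext x
    simp only [Set.mem_iUnion]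
    constructor
    · intro hx
      have : x ∈ ⋃ k, disjointed E k := by rw [iUnion_disjointed]; exact hSE hx
      obtain ⟨k, hk⟩ := Set.mem_iUnion.1 this
      have hxQ : x ∈ Q k := ⟨hx, hk⟩
      obtain ⟨n, hn⟩ := Set.mem_iUnion.1 (h3 k hxQ)
      exact ⟨(k, n), hxQ, hn⟩
    · rintro ⟨m, hm⟩
      exact hm.1.1
  · rintro ⟨k, n⟩
    rcases (Q k).eq_empty_or_nonempty with he | hne
    · simp [he]
    obtain ⟨y, hy, hAy⟩ := h5 k hne n
    have hdet : (A k n).det ≠ 0 := by rw [hAy]; exact h0 y hy.1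
    have hap := h4 k n
    have hr : r (A k n) = ‖(((A k n).toContinuousLinearEquivOfDetNeZero hdet).symm : R3 →L[ℝ] R3)‖₊⁻¹ / 2 := by
      simp only [r, dif_pos hdet]
    rw [hr] at hap
    have hap' : ApproximatesLinearOn p (((A k n).toContinuousLinearEquivOfDetNeZero hdet : R3 ≃L[ℝ] R3) : R3 →L[ℝ] R3)
       (Q k ∩ t k n) (‖(((A k n).toContinuousLinearEquivOfDetNeZero hdet).symm : R3 →L[ℝ] R3)‖₊⁻¹ / 2) := hap
    refine hap'.injOn (Or.inr ?_)
    refine NNReal.half_lt_self ?_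
    have := ((A k n).toContinuousLinearEquivOfDetNeZero hdet).nnnorm_symm_pos
    positivity
  · rintro ⟨k, n⟩ x hx
    exact (hQd k x hx.1).mono Set.inter_subset_left

theorem area_pos {p : R3 → R3} {p' : R3 → R3 →L[ℝ] R3} {E : ℕ → Set R3} {S : Set R3} {J : R3 → ℝ}
    (hp : Measurable p)
    (hE : ∀ k, MeasurableSet (E k)) (hS : MeasurableSet S) (hSE : S ⊆ ⋃ k, E k)
    (hd : ∀ k, ∀ x ∈ E k, HasFDerivWithinAt p (p' x) (E k) x)
    (hJm : Measurable J) (hJ : ∀ x ∈ S, (p' x).det = J x) (h0 : ∀ x ∈ S, J x ≠ 0)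
    (hJi : IntegrableOn J S) :
    ∃ N : R3 → ℝ, Integrable N ∧ (∀ᵐ z, ∃ n : ℤ, N z = n) ∧
      ∀ g : R3 → ℝ, Measurable g → ∫ x in S, g (p x) * |J x| = ∫ z, g z * N z := by
  obtain ⟨P, P1, P2, P3, P4, P5⟩ := area_pieces hE hS hSE hd (fun x hx => by rw [hJ x hx]; exact h0 x hx)
  have hPS : ∀ m, P m ⊆ S := fun m => by rw [P3]; exact Set.subset_iUnion P m
  have hIm : ∀ m, MeasurableSet (p '' P m) := fun m =>
    measurable_image_of_fderivWithin (P1 m) (P5 m) (P4 m)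
  set M : R3 → ℝ≥0∞ := fun z => ∑' m, (p '' P m).indicator (fun _ => (1:ℝ≥0∞)) z with hM
  have hMm : Measurable M := Measurable.tsum fun m => measurable_const.indicator (hIm m)
  have hJe : Measurable fun x => ENNReal.ofReal |J x| := by fun_prop
  have key : ∀ g : R3 → ℝ≥0∞, Measurable g →
      ∫⁻ x in S, ENNReal.ofReal |J x| * g (p x) = ∫⁻ z, M z * g z := by
    intro g hg
    have e1 : ∫⁻ x in S, ENNReal.ofReal |J x| * g (p x) = ∑' m, ∫⁻ x in P m, ENNReal.ofReal |J x| * g (p x) := by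
      conv_lhs => rw [P3]
      exact lintegral_iUnion P1 P2 _
    rw [e1]
    simp only [hM]
    simp_rw [← ENNReal.tsum_mul_right]
    rw [lintegral_tsum (f := fun m z => (p '' P m).indicator (fun _ => (1:ℝ≥0∞)) z * g z)
      (fun m => ((measurable_const.indicator (hIm m)).mul hg).aemeasurable)]
    congr 1; ext m
    have := lintegral_image_eq_lintegral_abs_det_fderiv_mul volume (P1 m) (P5 m) (P4 m) g
    rw [← lintegral_indicator (hIm m)] at this
    trans ∫⁻ x in P m, ENNReal.ofReal |(p' x).det| * g (p x)
    · refine setLIntegral_congr_fun (P1 m) fun x hx => ?_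
      simp only [hJ x (hPS m hx)]
    · rw [← this]
      congr 1; ext z
      by_cases hz : z ∈ p '' P m <;> simp [hz]
  have hMi : ∫⁻ z, M z ≠ ∞ := by
    have := key (fun _ => 1) measurable_const
    simp only [mul_one] at this
    rw [← this]
    have h := hJi.2
    rw [HasFiniteIntegral] at h
    simp_rw [← ofReal_norm, Real.norm_eq_abs] at h
    exact h.ne
  have hMt : ∀ᵐ z, M z < ∞ := ae_lt_top hMm hMi
  have hmeas : ((volume.restrict S).withDensity fun x => ENNReal.ofReal |J x|).map p = volume.withDensity M := by
    ext T hT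
    rw [Measure.map_apply hp hT, withDensity_apply _ (hp hT), withDensity_apply _ hT]
    have := key (T.indicator 1) (measurable_one.indicator hT)
    rw [← lintegral_indicator (hp hT), ← lintegral_indicator hT]
    refine Eq.trans ?_ (this.trans ?_)
    · congr 1; ext x
      by_cases hx : p x ∈ T
      · simp [Set.indicator, hx]
      · simp [Set.indicator, hx]
    · congr 1; ext x
      by_cases hx : x ∈ T <;> simp [hx]
  refine ⟨fun z => (M z).toReal, integrable_toReal_of_lintegral_ne_top hMm.aemeasurable hMi, ?_, ?_⟩
  · have hfin : ∑' m, volume (p '' P m) ≠ ∞ := by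
      have : ∫⁻ z, M z = ∑' m, volume (p '' P m) := by
        simp only [hM]
        rw [lintegral_tsum (fun m => (measurable_const.indicator (hIm m)).aemeasurable)]
        congr 1; ext m
        rw [lintegral_indicator (hIm m)]; simp
      rw [← this]; exact hMi
    filter_upwards [ae_finite_setOfPred_mem hfin] with z hz
    refine ⟨hz.toFinset.card, ?_⟩
    have : M z = ∑ m ∈ hz.toFinset, (1:ℝ≥0∞) := by
      simp only [hM]
      rw [tsum_eq_sum (s := hz.toFinset)]
      · refine Finset.sum_congr rfl fun m hm => ?_
        have : z ∈ p '' P m := by simpa using hm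
        rw [Set.indicator_of_mem this]
      · intro m hm
        have : z ∉ p '' P m := by simpa using hm
        rw [Set.indicator_of_notMem this]
    rw [this]; simp
  · intro g hg
    have i1 := integral_withDensity_eq_integral_toReal_smul (μ := volume) hMm hMt g
    rw [← hmeas, integral_map hp.aemeasurable hg.aestronglyMeasurable,
      integral_withDensity_eq_integral_toReal_smul hJe (by simp)] at i1
    simp only [smul_eq_mul, ENNReal.toReal_ofReal (abs_nonneg _)] at i1
    simp_rw [mul_comm (g _)]
    exact i1

theorem area {p : R3 → R3} {p' : R3 → R3 →L[ℝ] R3} {E : ℕ → Set R3} {A : Set R3}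
    (hp : Measurable p) (hE : ∀ k, MeasurableSet (E k)) (hA : MeasurableSet A)
    (hEc : ∀ᵐ x, ∃ k, x ∈ E k)
    (hd : ∀ k, ∀ x ∈ E k, HasFDerivWithinAt p (p' x) (E k) x)
    (hJi : Integrable fun x => (p' x).det) :
    ∃ N : R3 → ℝ, Integrable N ∧ (∀ᵐ z, ∃ n : ℤ, N z = n) ∧
      ∀ g : R3 → ℝ, Measurable g → (∃ C, ∀ z, |g z| ≤ C) →
        ∫ x in A, g (p x) * (p' x).det = ∫ z, g z * N z := by
  set J := hJi.aestronglyMeasurable.mk _ with hJdef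
  have hJm : Measurable J := hJi.aestronglyMeasurable.stronglyMeasurable_mk.measurable
  have hJJ : ∀ᵐ x, (p' x).det = J x := hJi.aestronglyMeasurable.ae_eq_mk
  have hJi' : Integrable J := hJi.congr hJJ
  obtain ⟨Z, Z1, Z2, Z3⟩ := ae_meas (hJJ.and hEc)
  have mk : ∀ B : Set R3, MeasurableSet B → (∀ x ∈ B, J x ≠ 0) →
    ∃ N : R3 → ℝ, Integrable N ∧ (∀ᵐ z, ∃ n : ℤ, N z = n) ∧
      ∀ g : R3 → ℝ, Measurable g → ∫ x in A ∩ B, g (p x) * |J x| = ∫ z, g z * N z := by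
    intro B hB hB0
    obtain ⟨N, a, b, c⟩ := area_pos (S := A ∩ B ∩ Z) hp hE ((hA.inter hB).inter Z1) (fun x hx => Set.mem_iUnion.2 (Z3 x hx.2).2)
      hd hJm (fun x hx => (Z3 x hx.2).1) (fun x hx => hB0 x hx.1.2) hJi'.integrableOn
    refine ⟨N, a, b, fun g hg => (c g hg).symm ▸ ?_⟩
    refine setIntegral_congr_set ?_
    filter_upwards [Z2] with x hx
    refine propext ⟨fun h => ⟨h, hx⟩, fun h => h.1⟩
  have mp : MeasurableSet {x | 0 < J x} := measurableSet_lt measurable_const hJm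
  have mn : MeasurableSet {x | J x < 0} := measurableSet_lt hJm measurable_const
  obtain ⟨N1, a1, b1, c1⟩ := mk {x | 0 < J x} mp (fun x hx => ne_of_gt hx)
  obtain ⟨N2, a2, b2, c2⟩ := mk {x | J x < 0} mn (fun x hx => ne_of_lt hx)
  refine ⟨fun z => N1 z - N2 z, a1.sub a2, ?_, ?_⟩
  · filter_upwards [b1, b2] with z ⟨n, hn⟩ ⟨m, hm⟩
    exact ⟨n - m, by push_cast; rw [hn, hm]⟩
  · rintro g hg ⟨C, hC⟩
    have ib : ∀ {f : R3 → ℝ}, Integrable f → Integrable fun z => g z * f z := fun hf =>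
      hf.bdd_mul hg.aestronglyMeasurable (c := C) (Eventually.of_forall fun x => by simpa using hC x)
    have ibp : ∀ {f : R3 → ℝ}, Integrable f → Integrable fun z => g (p z) * f z := fun hf =>
      hf.bdd_mul (hg.comp hp).aestronglyMeasurable (c := C) (Eventually.of_forall fun x => by simpa using hC (p x))
    simp_rw [mul_sub]
    rw [integral_sub (ib a1) (ib a2), ← c1 g hg, ← c2 g hg, ← integral_indicator (hA.inter mp), ← integral_indicator (hA.inter mn),
      ← integral_sub, ← integral_indicator hA]
    · refine integral_congr_ae ?_
      filter_upwards [hJJ] with x hx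
      by_cases hxA : x ∈ A
      · rcases lt_trichotomy (J x) 0 with h | h | h
        · simp [Set.indicator, hxA, hx, h, abs_of_neg h, not_lt.2 h.le]
        · simp [Set.indicator, hxA, hx, h]
        · simp [Set.indicator, hxA, hx, h, abs_of_pos h, not_lt.2 h.le]
      · simp [Set.indicator, hxA]
    · exact (ibp hJi'.abs).indicator (hA.inter mp)
    · exact (ibp hJi'.abs).indicator (hA.inter mn)

end

section

def q3 (z : R3) : ℝ := ∑ i, z i ^ 2
def UB : Set R3 := {z | q3 z < 1}

theorem q3_cont : Continuous q3 := by unfold q3; fun_prop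
theorem UB_open : IsOpen UB := isOpen_lt q3_cont continuous_const

theorem pd_moll_pt (n : ℕ) {u : R3 → ℝ} (i : Fin 3) (hu : LocallyIntegrable u volume) (x : R3) :
    IsTestFun (fun t => rho n (x - t)) ∧
    pd i (moll n u) x = - ∫ t, pd i (fun t => rho n (x - t)) t * u t := by
  have h1 : HasFDerivAt (moll n u) _ x := (rho_cs n).hasFDerivAt_convolution_left
    (ContinuousLinearMap.lsmul ℝ ℝ) ((rho_contDiff n).of_le (by simp)) hu x
  have h2 : pd i (moll n u) x = ∫ t, fderiv ℝ (rho n) (x - t) (Pi.single i 1) * u t := by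
    show fderiv ℝ (moll n u) x _ = _
    rw [h1.fderiv, convolution_eq_swap]
    rw [ContinuousLinearMap.integral_apply]
    · rfl
    · have := (HasCompactSupport.fderiv (𝕜 := ℝ) (rho_cs n)).convolutionExists_left
        ((ContinuousLinearMap.lsmul ℝ ℝ : ℝ →L[ℝ] ℝ →L[ℝ] ℝ).precompL R3)
        ((rho_contDiff n).continuous_fderiv (by simp)) hu x
      exact (convolutionExistsAt_iff_integrable_swap).1 this
  let ψ : R3 → ℝ := fun t => rho n (x - t)
  have hψ : IsTestFun ψ := by
    refine ⟨(rho_contDiff n).comp (contDiff_const.sub contDiff_id), ?_⟩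
    exact (rho_cs n).comp_homeomorph (Homeomorph.subLeft x)
  have h3 : ∀ t, pd i ψ t = - fderiv ℝ (rho n) (x - t) (Pi.single i 1) := by
    intro t
    have hd : HasFDerivAt (rho n) (fderiv ℝ (rho n) (x - t)) (x - t) :=
      ((rho_contDiff n).differentiable (by simp) _).hasFDerivAt
    have h4 : HasFDerivAt ψ _ t := hd.comp t ((hasFDerivAt_id t).const_sub x)
    show fderiv ℝ ψ t _ = _
    rw [h4.fderiv]; simp
  refine ⟨hψ, ?_⟩
  show _ = - ∫ t, pd i ψ t * u t
  simp only [h3, neg_mul, integral_neg, neg_neg]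
  exact h2

theorem q3_near {x t : R3} {η : ℝ} (hη : η ≤ 1) (hx : q3 x ≤ 1) (h : ‖x - t‖ < η) :
    q3 t ≤ q3 x + 9 * η := by
  have h0 : 0 ≤ η := (norm_nonneg _).trans h.le
  have hq : ∀ i, x i ^ 2 ≤ 1 := fun i =>
    (Finset.single_le_sum (f := fun i => x i ^ 2) (fun j _ => sq_nonneg _) (Finset.mem_univ i)).trans hx
  have hk : ∀ i, t i ^ 2 ≤ x i ^ 2 + 3 * η := by
    intro i
    have h1 : |x i - t i| ≤ η := (norm_le_pi_norm (x - t) i).trans h.le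
    have h2 : |x i| ≤ 1 := (sq_le_one_iff_abs_le_one _).1 (hq i)
    rw [abs_le] at h1 h2
    have : t i = x i - (x i - t i) := by ring
    generalize x i - t i = d at *
    rw [this]
    have : d ^ 2 ≤ η := by nlinarith
    have : -(x i * d) ≤ η := by
      have := abs_le.1 (show |x i * d| ≤ η by
        rw [abs_mul]
        have a : |x i| ≤ 1 := abs_le.2 h2
        have b : |d| ≤ η := abs_le.2 h1
        nlinarith [abs_nonneg (x i), abs_nonneg d])
      linarith
    nlinarith
  unfold q3
  simp only [Fin.sum_univ_three]
  linarith [hk 0, hk 1, hk 2]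

theorem star_const {f : R3 → ℝ} (hf : Differentiable ℝ f) {r : ℝ}
    (h : ∀ x, q3 x < r → ∀ i, pd i f x = 0) {x : R3} (hx : q3 x < r) : f x = f 0 := by
  have hd : ∀ x, q3 x < r → fderiv ℝ f x = 0 := by
    intro y hy
    refine ContinuousLinearMap.ext fun v => ?_
    have hv : v = ∑ i, v i • (Pi.single i 1 : R3) := (pi_eq_sum_univ' v)
    rw [hv, map_sum]
    refine Finset.sum_eq_zero fun i _ => ?_
    rw [map_smul]
    have := h y hy i
    rw [show fderiv ℝ f y (Pi.single i 1) = 0 from this, smul_zero]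
  have h1 : ∀ t : ℝ, HasDerivAt (fun t : ℝ => f (t • x)) (fderiv ℝ f (t • x) x) t := by
    intro t
    have := (hf (t • x)).hasFDerivAt.comp_hasDerivAt t ((hasDerivAt_id t).smul_const x)
    simp only [one_smul] at this
    exact this
  have hq : ∀ t ∈ Set.Icc (0:ℝ) 1, q3 (t • x) < r := by
    intro t ht
    have : q3 (t • x) = t ^ 2 * q3 x := by simp [q3, mul_pow, Finset.mul_sum]
    have h0 : 0 ≤ q3 x := Finset.sum_nonneg fun i _ => sq_nonneg _
    have : t ^ 2 ≤ 1 := by nlinarith [ht.1, ht.2]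
    nlinarith
  have := constant_of_has_deriv_right_zero (a := 0) (b := 1) (f := fun t : ℝ => f (t • x))
    (fun t _ => (h1 t).continuousAt.continuousWithinAt) (fun t ht => by
      have := (h1 t).hasDerivWithinAt (s := Set.Ici t)
      rwa [hd _ (hq t ⟨ht.1, ht.2.le⟩)] at this) 1 (by simp)
  simpa using this

theorem constancy {N : R3 → ℝ} (hN : Integrable N) (hZ : ∀ᵐ z, ∃ n : ℤ, N z = n)
    (h : ∀ ε, 0 < ε → ∀ f : R3 → ℝ, IsTestFun f → (∀ z, 1 - ε ≤ q3 z → f z = 0) →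
      ∀ j, ∫ z, pd j f z * N z = 0) :
    ∃ c : ℤ, ∀ᵐ z, z ∈ UB → N z = c := by
  have key : ∀ δ : ℝ, 0 < δ → ∃ n0 : ℕ, ∀ n ≥ n0, ∀ x, q3 x < 1 - δ → moll n N x = moll n N 0 := by
    intro δ hδ
    obtain ⟨n0, hn0⟩ := exists_nat_gt (18 / δ)
    refine ⟨n0, fun n hn x hx => ?_⟩
    refine star_const ((moll_contDiff n hN.locallyIntegrable).differentiable (by simp)) (r := 1 - δ) ?_ hx
    intro y hy i
    obtain ⟨a, b⟩ := pd_moll_pt n i hN.locallyIntegrable y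
    rw [b, h (δ/2) (by positivity) _ a ?_ i, neg_zero]
    intro z hz
    refine rho_supp n _ ?_
    by_contra hc
    push Not at hc
    have hn' : (n0:ℝ) ≤ n := by exact_mod_cast hn
    have e1 : (1:ℝ)/(n+1) ≤ 1 := by
      rw [div_le_one (by positivity)]; linarith [Nat.cast_nonneg (α := ℝ) n]
    have e2 := q3_near e1 (by linarith) hc
    have e3 : 9 * ((1:ℝ)/(n+1)) < δ/2 := by
      rw [mul_one_div, div_lt_iff₀ (by positivity)]
      rw [div_lt_iff₀ hδ] at hn0
      nlinarith
    linarith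
  have hae := moll_ae_tendsto hN.locallyIntegrable
  obtain ⟨x0, hx0, ⟨c, hc⟩, ht0⟩ : ∃ x0 ∈ UB, (∃ n : ℤ, N x0 = n) ∧ Tendsto (fun n => moll n N x0) atTop (𝓝 (N x0)) := by
    have hpos : volume UB ≠ 0 := (UB_open.measure_pos volume ⟨0, by simp [UB, q3]⟩).ne'
    by_contra hc
    push Not at hc
    apply hpos
    have : ∀ᵐ z, z ∉ UB := by
      filter_upwards [hZ, hae] with z ⟨n, hn⟩ h2 h3
      exact hc z h3 ⟨n, hn⟩ h2
    simpa [ae_iff] using this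
  refine ⟨c, ?_⟩
  filter_upwards [hae] with x hx hxU
  rw [← hc]
  obtain ⟨n0, h0⟩ := key ((1 - max (q3 x) (q3 x0))/2) (by
    have : max (q3 x) (q3 x0) < 1 := max_lt hxU hx0
    linarith)
  refine tendsto_nhds_unique hx (ht0.congr' ?_)
  filter_upwards [eventually_ge_atTop n0] with n hn
  have hm : max (q3 x) (q3 x0) < 1 := max_lt hxU hx0
  rw [h0 n hn x (by linarith [le_max_left (q3 x) (q3 x0)]), h0 n hn x0 (by linarith [le_max_right (q3 x) (q3 x0)])]

end

section

/-- projection to the last three coordinates -/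
def tl (y : R4) : R3 := fun j => y j.succ

theorem tl_contDiff : ContDiff ℝ (⊤ : ℕ∞) tl := by
  unfold tl; fun_prop

def tlL : R4 →L[ℝ] R3 := ContinuousLinearMap.pi fun j => ContinuousLinearMap.proj j.succ

theorem pd4_tl {f : R3 → ℝ} {s : ℝ → ℝ} (hf : Differentiable ℝ f) (hs : Differentiable ℝ s) (y : R4) :
    (∀ j : Fin 3, pd4 j.succ (fun y => f (tl y) * s (y 0)) y = pd j f (tl y) * s (y 0)) ∧
    pd4 0 (fun y => f (tl y) * s (y 0)) y = f (tl y) * deriv s (y 0) := by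
  have h1 : HasFDerivAt (fun y => f (tl y)) ((fderiv ℝ f (tl y)).comp tlL) y :=
    (hf (tl y)).hasFDerivAt.comp y tlL.hasFDerivAt
  have h2 : HasFDerivAt (fun y : R4 => s (y 0)) (deriv s (y 0) • (ContinuousLinearMap.proj 0 : R4 →L[ℝ] ℝ)) y := by
    have := (hs (y 0)).hasDerivAt.comp_hasFDerivAt y (ContinuousLinearMap.proj (R := ℝ) (φ := fun _ : Fin 4 => ℝ) 0).hasFDerivAt
    exact this
  have h3 := h1.mul h2
  have h4 : fderiv ℝ (fun y => f (tl y) * s (y 0)) y = _ := h3.fderiv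
  have e0 : tlL (Pi.single 0 1) = 0 := by
    ext j; simp [tlL, Fin.succ_ne_zero]
  have ej : ∀ j : Fin 3, tlL (Pi.single j.succ 1) = Pi.single j 1 := by
    intro j; ext i; simp [tlL, Pi.single_apply]
  constructor
  · intro j
    show fderiv ℝ _ y _ = _
    rw [h4]
    simp only [add_apply, smul_apply, ContinuousLinearMap.comp_apply, ej]
    simp
    rw [mul_comm]
  · show fderiv ℝ _ y _ = _
    rw [h4]
    simp only [add_apply, smul_apply, ContinuousLinearMap.comp_apply, e0]
    simp

theorem nsq_tl (y : R4) : nsq y = y 0 ^ 2 + q3 (tl y) := by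
  simp [nsq, dot, q3, tl, Fin.sum_univ_succ]; ring

theorem pd_zero_of_supp {f : R3 → ℝ} {r : ℝ} (h : ∀ z, r ≤ q3 z → f z = 0) {z : R3} (hz : r < q3 z)
    (j : Fin 3) : pd j f z = 0 := by
  have : f =ᶠ[𝓝 z] fun _ => 0 := by
    have : ∀ᶠ w in 𝓝 z, r < q3 w := (q3_cont.tendsto z).eventually (lt_mem_nhds hz)
    filter_upwards [this] with w hw
    exact h w hw.le
  show fderiv ℝ f z _ = 0
  rw [this.fderiv_eq]; simp

/-- smooth step -/
def stp (σ e t : ℝ) : ℝ := Real.smoothTransition ((σ * t / e + 1) / 2)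
theorem stp_contDiff (σ e : ℝ) : ContDiff ℝ (⊤ : ℕ∞) (stp σ e) := by
  unfold stp
  exact Real.smoothTransition.contDiff.comp (by fun_prop)
theorem stp_zero {σ e t : ℝ} (he : 0 < e) (h : σ * t ≤ -e) : stp σ e t = 0 := by
  apply Real.smoothTransition.zero_of_nonpos
  have : σ * t / e ≤ -1 := by rw [div_le_iff₀ he]; linarith
  linarith
theorem stp_one {σ e t : ℝ} (he : 0 < e) (h : e ≤ σ * t) : stp σ e t = 1 := by
  apply Real.smoothTransition.one_of_one_le
  have : 1 ≤ σ * t / e := by rw [le_div_iff₀ he]; linarith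
  linarith
theorem stp_deriv {σ e t : ℝ} (he : 0 < e) (h : e < |σ * t|) : deriv (stp σ e) t = 0 := by
  have hc : Continuous fun t : ℝ => σ * t := by fun_prop
  rcases lt_abs.1 h with h | h
  · have : stp σ e =ᶠ[𝓝 t] fun _ => 1 := by
      filter_upwards [(hc.tendsto t).eventually (lt_mem_nhds h)] with w hw
      exact stp_one he hw.le
    rw [this.deriv_eq]; simp
  · have : stp σ e =ᶠ[𝓝 t] fun _ => 0 := by
      filter_upwards [(hc.tendsto t).eventually (gt_mem_nhds (show σ * t < -e by linarith))] with w hw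
      exact stp_zero he hw.le
    rw [this.deriv_eq]; simp

namespace SkyrmeMap

def pj (φ : SkyrmeMap) (x : R3) : R3 := tl (φ.toFun x)
def pj' (φ : SkyrmeMap) (x : R3) : R3 →L[ℝ] R3 :=
  ContinuousLinearMap.pi fun j => lin (fun l => φ.pderiv l x j.succ)

theorem pj_meas (φ : SkyrmeMap) : Measurable φ.pj := tl_contDiff.continuous.measurable.comp φ.meas

theorem pj'_det (φ : SkyrmeMap) (x : R3) : (φ.pj' x).det = φ.Mc 0 x := by
  have : (φ.pj' x).det = LinearMap.det (φ.pj' x : R3 →ₗ[ℝ] R3) := rfl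
  rw [this, ← LinearMap.det_toMatrix', Matrix.det_fin_three]
  simp only [LinearMap.toMatrix'_apply, ContinuousLinearMap.coe_coe, pj', ContinuousLinearMap.pi_apply]
  simp [lin_apply, Pi.single_apply, Fin.sum_univ_succ, Mc, MM, m3, cr, gr]
  ring

def hemi (φ : SkyrmeMap) (σ : ℝ) : Set R3 := {x | 0 < σ * φ.toFun x 0}
theorem hemi_meas (φ : SkyrmeMap) (σ : ℝ) : MeasurableSet (φ.hemi σ) :=
  measurableSet_lt measurable_const (((measurable_pi_apply 0).comp φ.meas).const_mul σ)

theorem area' {φ : SkyrmeMap} (h : memX φ) {A : Set R3} (hA : MeasurableSet A) :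
    ∃ N : R3 → ℝ, Integrable N ∧ (∀ᵐ z, ∃ n : ℤ, N z = n) ∧
      ∀ g : R3 → ℝ, Measurable g → (∃ C, ∀ z, |g z| ≤ C) →
        ∫ x in A, g (φ.pj x) * φ.Mc 0 x = ∫ z, g z * N z := by
  choose E E1 E2 E3 using fun j : Fin 3 => lusin (wd h j.succ)
  obtain ⟨w, hw⟩ := exists_surjective_nat (Fin 3 → ℕ × ℕ)
  have e1 : ∀ᵐ x, ∃ n, x ∈ ⋂ j, E j (w n j) := by
    have := ae_all_iff.2 E2
    filter_upwards [this] with x hx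
    choose k hk using hx
    obtain ⟨n, rfl⟩ := hw k
    exact ⟨n, Set.mem_iInter.2 hk⟩
  have e2 : ∀ n, ∀ x ∈ ⋂ j, E j (w n j), HasFDerivWithinAt φ.pj (φ.pj' x) (⋂ j, E j (w n j)) x := by
    intro n x hx
    rw [Set.mem_iInter] at hx
    rw [hasFDerivWithinAt_pi']
    intro j
    exact (E3 j _ x (hx j)).mono (Set.iInter_subset _ j)
  have e3 : Integrable fun x => (φ.pj' x).det := by
    simp only [pj'_det]; exact Mc_int h 0
  obtain ⟨N, a, b, c⟩ := area (A := A)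
    φ.pj_meas (fun n => MeasurableSet.iInter fun j => E1 j _) hA e1 e2 e3
  refine ⟨N, a, b, fun g hg hC => ?_⟩
  rw [← c g hg hC]
  simp only [pj'_det]

theorem hemi_zero {φ : SkyrmeMap} (h : memX φ) {σ : ℝ} (hσ : |σ| = 1) {ε : ℝ} (hε : 0 < ε) {f : R3 → ℝ}
    (hf : IsTestFun f) (hs : ∀ z, 1 - ε ≤ q3 z → f z = 0) (j : Fin 3) :
    ∫ x in φ.hemi σ, _root_.pd j f (φ.pj x) * φ.Mc 0 x = 0 := by
  set e := √ε / 2 with he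
  have hsq : 0 < √ε := Real.sqrt_pos.2 hε
  have he0 : 0 < e := by positivity
  have hF : ContDiff ℝ (⊤ : ℕ∞) (fun y : R4 => f (tl y) * stp σ e (y 0)) :=
    (hf.1.comp tl_contDiff).mul ((stp_contDiff σ e).comp (by fun_prop))
  have k := K' h hF j.succ 0
  rw [← integral_indicator (φ.hemi_meas σ), ← k]
  refine integral_congr_ae ?_
  filter_upwards [φ.sphere] with x hx
  rw [nsq_tl] at hx
  obtain ⟨p1, p2⟩ := pd4_tl (hf.1.differentiable (by simp)) ((stp_contDiff σ e).differentiable (by simp)) (φ.toFun x)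
  rw [p1, p2]
  by_cases hq : 1 - ε < q3 (tl (φ.toFun x))
  · have z1 := pd_zero_of_supp hs hq j
    have z2 := hs _ hq.le
    rw [z1, z2]
    simp [Set.indicator, pj, z1]
  · push Not at hq
    have h0 : ε ≤ φ.toFun x 0 ^ 2 := by linarith
    have h1 : √ε ≤ |φ.toFun x 0| := by
      rw [← Real.sqrt_sq_eq_abs]; exact Real.sqrt_le_sqrt h0
    have h2 : e < |σ * φ.toFun x 0| := by rw [abs_mul, hσ, one_mul]; linarith
    rw [stp_deriv he0 h2, mul_zero, zero_mul, sub_zero]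
    rcases lt_abs.1 h2 with h3 | h3
    · rw [stp_one he0 h3.le, mul_one, Set.indicator_of_mem]
      · rfl
      · show 0 < σ * φ.toFun x 0
        linarith
    · rw [stp_zero he0 (by linarith), mul_zero, zero_mul, Set.indicator_of_notMem]
      show ¬ (0 < σ * φ.toFun x 0)
      linarith

theorem hemi_area {φ : SkyrmeMap} (h : memX φ) {σ : ℝ} (hσ : |σ| = 1) : ∃ c : ℤ,
    ∀ g : R3 → ℝ, Measurable g → (∃ C, ∀ z, |g z| ≤ C) → (∀ z ∉ UB, g z = 0) →
        ∫ x in φ.hemi σ, g (φ.pj x) * φ.Mc 0 x = c * ∫ z, g z := by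
  obtain ⟨N, a, b, c⟩ := area' h (φ.hemi_meas σ)
  obtain ⟨d, hd⟩ := constancy a b (fun ε hε f hf hs j => by
    rw [← c (_root_.pd j f) (IsTestFun.pd hf j).1.continuous.measurable, hemi_zero h hσ hε hf hs j]
    exact (IsTestFun.pd hf j).1.continuous.bounded_above_of_compact_support (IsTestFun.pd hf j).2)
  refine ⟨d, fun g hg hC h0 => ?_⟩
  rw [c g hg hC, ← integral_const_mul]
  refine integral_congr_ae ?_
  filter_upwards [hd] with z hz
  by_cases hzU : z ∈ UB
  · rw [hz hzU, mul_comm]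
  · simp [h0 z hzU]

end SkyrmeMap

end

section

theorem q3_toLp (z : R3) : q3 z = ‖WithLp.toLp 2 z‖ ^ 2 := by
  rw [EuclideanSpace.norm_sq_eq]; simp [q3]

theorem int_q3 (f : ℝ → ℝ) : ∫ z : R3, f (√(q3 z)) = 4 * π * ∫ y in Set.Ioi (0:ℝ), y ^ 2 * f y := by
  have h := (PiLp.volume_preserving_toLp (Fin 3)).integral_comp
    (MeasurableEquiv.toLp 2 (Fin 3 → ℝ)).measurableEmbedding (fun w => f ‖w‖)
  have e : ∀ z : R3, √(q3 z) = ‖WithLp.toLp 2 z‖ := fun z => by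
    rw [q3_toLp, Real.sqrt_sq (norm_nonneg _)]
  simp_rw [e]
  rw [h, integral_fun_norm_addHaar]
  have hv : (volume : Measure (EuclideanSpace ℝ (Fin 3))).real (Metric.ball 0 1) = π * 4 / 3 := by
    rw [Measure.real, EuclideanSpace.volume_ball_fin_three]
    simp
    positivity
  rw [hv]
  simp
  ring

theorem sph_null : ∀ᵐ z : R3, q3 z ≠ 1 := by
  have h := Measure.addHaar_sphere (volume : Measure (EuclideanSpace ℝ (Fin 3))) 0 1
  have h2 := (PiLp.volume_preserving_toLp (Fin 3)).measure_preimage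
    (s := Metric.sphere (0 : EuclideanSpace ℝ (Fin 3)) 1) Metric.isClosed_sphere.measurableSet.nullMeasurableSet
  rw [h] at h2
  rw [ae_iff]
  convert h2 using 2
  ext z
  simp only [q3_toLp, ne_eq, not_not, Set.mem_setOf_eq, Set.mem_preimage, mem_sphere_zero_iff_norm]
  exact pow_eq_one_iff_of_nonneg (norm_nonneg _) two_ne_zero

theorem one_dim : ∫ y in Set.Ioi (0:ℝ), y ^ 2 * √(1 - y ^ 2) = π / 16 := by
  have e1 : ∫ y in Set.Ioi (0:ℝ), y ^ 2 * √(1 - y ^ 2) = ∫ y in Set.Ioc (0:ℝ) 1, y ^ 2 * √(1 - y ^ 2) := by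
    refine setIntegral_eq_of_subset_of_forall_sdiff_eq_zero measurableSet_Ioi Set.Ioc_subset_Ioi_self ?_
    rintro y ⟨hy1, hy2⟩
    have : 1 < y := by
      by_contra hc; exact hy2 ⟨hy1, not_lt.1 hc⟩
    rw [Real.sqrt_eq_zero_of_nonpos (by nlinarith), mul_zero]
  rw [e1, ← intervalIntegral.integral_of_le zero_le_one]
  have h := intervalIntegral.integral_comp_mul_deriv (a := 0) (b := π/2) (f := Real.sin) (f' := Real.cos)
    (g := fun y => y ^ 2 * √(1 - y ^ 2)) (fun x _ => Real.hasDerivAt_sin x) Real.continuous_cos.continuousOn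
    (by fun_prop)
  rw [Real.sin_zero, Real.sin_pi_div_two] at h
  rw [← h]
  have e2 : ∫ x in (0:ℝ)..(π/2), ((fun y => y ^ 2 * √(1 - y ^ 2)) ∘ Real.sin) x * Real.cos x
      = ∫ x in (0:ℝ)..(π/2), Real.sin x ^ 2 * Real.cos x ^ 2 := by
    refine intervalIntegral.integral_congr fun x hx => ?_
    rw [Set.uIcc_of_le (by positivity)] at hx
    have hc : 0 ≤ Real.cos x := Real.cos_nonneg_of_mem_Icc ⟨by linarith [hx.1, Real.pi_pos], hx.2⟩
    have : 1 - Real.sin x ^ 2 = Real.cos x ^ 2 := by linarith [Real.sin_sq_add_cos_sq x]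
    simp only [Function.comp, this, Real.sqrt_sq hc]
    ring
  rw [e2, integral_sin_sq_mul_cos_sq]
  rw [show 4 * (π/2) = 2 * π by ring]
  simp
  ring

theorem omega_int : ∫ z : R3, √(1 - q3 z) = π ^ 2 / 4 := by
  have h := int_q3 (fun y => √(1 - y ^ 2))
  have e : ∀ z : R3, √(q3 z) ^ 2 = q3 z := fun z =>
    Real.sq_sqrt (Finset.sum_nonneg fun i _ => sq_nonneg _)
  simp only [e, one_dim] at h
  rw [h]; ring

namespace SkyrmeMap

theorem pd4_coord (a b : Fin 4) (y : R4) : pd4 a (fun y => y b) y = if a = b then 1 else 0 := by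
  show fderiv ℝ (fun y : R4 => y b) y _ = _
  rw [show (fun y : R4 => y b) = (ContinuousLinearMap.proj b : R4 →L[ℝ] ℝ) from rfl, ContinuousLinearMap.fderiv]
  simp [Pi.single_apply, eq_comm]

theorem pd4_mul (a : Fin 4) (b c : Fin 4) (y : R4) :
    pd4 a (fun y => y b * y c) y = y b * (if a = c then 1 else 0) + y c * (if a = b then 1 else 0) := by
  have hb : HasFDerivAt (fun y : R4 => y b) (ContinuousLinearMap.proj b : R4 →L[ℝ] ℝ) y :=
    (ContinuousLinearMap.proj b : R4 →L[ℝ] ℝ).hasFDerivAt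
  have hc : HasFDerivAt (fun y : R4 => y c) (ContinuousLinearMap.proj c : R4 →L[ℝ] ℝ) y :=
    (ContinuousLinearMap.proj c : R4 →L[ℝ] ℝ).hasFDerivAt
  have := (hb.mul hc).fderiv
  show fderiv ℝ (fun y : R4 => y b * y c) y _ = _
  have e : fderiv ℝ (fun y : R4 => y b * y c) y = _ := this
  rw [e]
  simp [Pi.single_apply, eq_comm]

theorem Mc0_int_zero {φ : SkyrmeMap} (h : memX φ) : ∫ x, φ.Mc 0 x = 0 := by
  have := K' h (F := fun y : R4 => y 1) (by fun_prop) 1 0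
  simpa [pd4_coord] using this

theorem coord_Mc_int {φ : SkyrmeMap} (h : memX φ) (a b : Fin 4) : Integrable fun x => φ.toFun x a * φ.Mc b x :=
  φ.comp_mul_int (G := fun y => y a) (by fun_prop) (Mc_int h b)

theorem Mc_diag {φ : SkyrmeMap} (h : memX φ) (a : Fin 4) :
    ∫ x, φ.toFun x a * φ.Mc a x = ∫ x, φ.toFun x 0 * φ.Mc 0 x := by
  by_cases ha : a = 0
  · rw [ha]
  have := K' h (F := fun y : R4 => y 0 * y a) (by fun_prop) a 0
  simp only [pd4_mul, ha, Ne.symm ha, if_false, if_true, mul_one, mul_zero, add_zero, zero_add] at this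
  rw [integral_sub (coord_Mc_int h 0 0) (coord_Mc_int h a a)] at this
  linarith

theorem det_int_eq {φ : SkyrmeMap} (h : memX φ) : ∫ x, detDen φ x = 4 * ∫ x, φ.toFun x 0 * φ.Mc 0 x := by
  simp_rw [detDen_eq]
  rw [integral_finsetSum _ fun a _ => coord_Mc_int h a a]
  simp [Mc_diag h]

theorem eq_zero_null {φ : SkyrmeMap} (h : memX φ) : ∫ x in {x | φ.toFun x 0 = 0}, φ.Mc 0 x = 0 := by
  have hm : MeasurableSet {x | φ.toFun x 0 = 0} :=
    measurableSet_eq_fun ((measurable_pi_apply 0).comp φ.meas) measurable_const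
  obtain ⟨N, a, b, c⟩ := area' h hm
  have hs : MeasurableSet {z | q3 z = 1} := measurableSet_eq_fun q3_cont.measurable measurable_const
  have := c ({z | q3 z = 1}.indicator fun _ => 1) (measurable_const.indicator hs)
    ⟨1, fun z => by by_cases hz : q3 z = 1 <;> simp [Set.indicator, hz]⟩
  trans ∫ x in {x | φ.toFun x 0 = 0}, ({z | q3 z = 1}.indicator fun _ => (1:ℝ)) (φ.pj x) * φ.Mc 0 x
  · refine setIntegral_congr_ae hm ?_
    filter_upwards [φ.sphere] with x hx hx0
    rw [nsq_tl, show φ.toFun x 0 = 0 from hx0] at hx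
    have : φ.pj x ∈ {z | q3 z = 1} := by
      show q3 (tl _) = 1
      linarith
    rw [Set.indicator_of_mem this, one_mul]
  · rw [this]
    refine integral_eq_zero_of_ae ?_
    filter_upwards [sph_null] with z hz
    simp [Set.indicator, hz]

theorem int_split (φ : SkyrmeMap) {f : R3 → ℝ} (hf : Integrable f) :
    ∫ x, f x = (∫ x in φ.hemi 1, f x) + (∫ x in φ.hemi (-1), f x) + ∫ x in {x | φ.toFun x 0 = 0}, f x := by
  have hm : MeasurableSet {x | φ.toFun x 0 = 0} :=
    measurableSet_eq_fun ((measurable_pi_apply 0).comp φ.meas) measurable_const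
  rw [← integral_indicator (φ.hemi_meas 1), ← integral_indicator (φ.hemi_meas (-1)), ← integral_indicator hm,
    ← integral_add (hf.indicator (φ.hemi_meas 1)) (hf.indicator (φ.hemi_meas (-1))), ← integral_add]
  · congr 1; ext x
    rcases lt_trichotomy (φ.toFun x 0) 0 with h | h | h
    · simp [Set.indicator, hemi, h, h.ne, not_lt.2 h.le]
    · simp [Set.indicator, hemi, h]
    · simp [Set.indicator, hemi, h, h.ne', not_lt.2 h.le]
  · exact (hf.indicator (φ.hemi_meas 1)).add (hf.indicator (φ.hemi_meas (-1)))
  · exact hf.indicator hm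

theorem hemi_UB (φ : SkyrmeMap) {σ : ℝ} : ∀ᵐ x, x ∈ φ.hemi σ → φ.pj x ∈ UB := by
  filter_upwards [φ.sphere] with x hx hxm
  rw [nsq_tl] at hx
  have : φ.toFun x 0 ≠ 0 := by
    intro h0
    have : 0 < σ * φ.toFun x 0 := hxm
    rw [h0] at this; simp at this
  have : 0 < φ.toFun x 0 ^ 2 := by positivity
  show q3 (tl _) < 1
  linarith

theorem degree_int {φ : SkyrmeMap} (h : memX φ) : ∃ n : ℤ, degree φ = n := by
  obtain ⟨c1, h1⟩ := hemi_area h (σ := 1) (by simp)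
  obtain ⟨c2, h2⟩ := hemi_area h (σ := -1) (by simp)
  have hUm : MeasurableSet UB := UB_open.measurableSet
  -- indicator of the ball
  have gi : Measurable (UB.indicator fun _ => (1:ℝ)) := measurable_const.indicator hUm
  have gb : ∃ C, ∀ z, |UB.indicator (fun _ => (1:ℝ)) z| ≤ C :=
    ⟨1, fun z => by by_cases hz : z ∈ UB <;> simp [hz]⟩
  have g0 : ∀ z ∉ UB, UB.indicator (fun _ => (1:ℝ)) z = 0 := fun z hz => Set.indicator_of_notMem hz _
  have e1 : ∀ σ, ∫ x in φ.hemi σ, UB.indicator (fun _ => (1:ℝ)) (φ.pj x) * φ.Mc 0 x = ∫ x in φ.hemi σ, φ.Mc 0 x := by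
    intro σ
    refine setIntegral_congr_ae (φ.hemi_meas σ) ?_
    filter_upwards [φ.hemi_UB (σ := σ)] with x hx hxm
    rw [Set.indicator_of_mem (hx hxm), one_mul]
  have vpos : 0 < ∫ z : R3, UB.indicator (fun _ => (1:ℝ)) z := by
    rw [integral_indicator hUm]
    simp only [integral_const, smul_eq_mul, mul_one, measureReal_restrict_apply_univ]
    refine ENNReal.toReal_pos (UB_open.measure_pos volume ⟨0, by simp [UB, q3]⟩).ne' ?_
    refine ((measure_mono (t := QR 1) ?_).trans_lt measure_closedBall_lt_top).ne
    intro z hz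
    simp only [QR, mem_closedBall_zero_iff]
    rw [pi_norm_le_iff_of_nonneg zero_le_one]
    intro i
    refine (sq_le_one_iff_abs_le_one _).1 ?_
    exact (Finset.single_le_sum (f := fun i => z i ^ 2) (fun j _ => sq_nonneg _) (Finset.mem_univ i)).trans (le_of_lt hz)
  have hsum : (c1:ℝ) + c2 = 0 := by
    have a := φ.int_split (Mc_int h 0)
    rw [Mc0_int_zero h, eq_zero_null h, ← e1 1, ← e1 (-1), h1 _ gi gb g0, h2 _ gi gb g0] at a
    have : ((c1:ℝ) + c2) * ∫ z : R3, UB.indicator (fun _ => (1:ℝ)) z = 0 := by linarith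
    exact (mul_eq_zero.1 this).resolve_right vpos.ne'
  have wi : Measurable fun z : R3 => √(1 - q3 z) := (by have := q3_cont; fun_prop : Continuous fun z : R3 => √(1 - q3 z)).measurable
  have wb : ∃ C, ∀ z : R3, |√(1 - q3 z)| ≤ C := ⟨1, fun z => by
    rw [abs_of_nonneg (Real.sqrt_nonneg _), Real.sqrt_le_left zero_le_one]
    have : 0 ≤ q3 z := Finset.sum_nonneg fun i _ => sq_nonneg _
    linarith⟩
  have w0 : ∀ z ∉ UB, √(1 - q3 z) = 0 := fun z hz => by
    have : ¬ q3 z < 1 := hz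
    exact Real.sqrt_eq_zero_of_nonpos (by linarith)
  have f1 : ∫ x in φ.hemi 1, φ.toFun x 0 * φ.Mc 0 x = ∫ x in φ.hemi 1, √(1 - q3 (φ.pj x)) * φ.Mc 0 x := by
    refine setIntegral_congr_ae (φ.hemi_meas 1) ?_
    filter_upwards [φ.sphere] with x hx hxm
    rw [nsq_tl] at hx
    have : 0 < 1 * φ.toFun x 0 := hxm
    rw [pj, ← hx, add_sub_cancel_right, Real.sqrt_sq (by linarith)]
  have f2 : ∫ x in φ.hemi (-1), φ.toFun x 0 * φ.Mc 0 x = - ∫ x in φ.hemi (-1), √(1 - q3 (φ.pj x)) * φ.Mc 0 x := by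
    rw [← integral_neg]
    refine setIntegral_congr_ae (φ.hemi_meas (-1)) ?_
    filter_upwards [φ.sphere] with x hx hxm
    rw [nsq_tl] at hx
    have : 0 < -1 * φ.toFun x 0 := hxm
    rw [pj, ← hx, add_sub_cancel_right, ← neg_sq, Real.sqrt_sq (by linarith)]
    ring
  have f3 : ∫ x in {x | φ.toFun x 0 = 0}, φ.toFun x 0 * φ.Mc 0 x = 0 := by
    have hm : MeasurableSet {x | φ.toFun x 0 = 0} :=
      measurableSet_eq_fun ((measurable_pi_apply 0).comp φ.meas) measurable_const
    rw [setIntegral_congr_fun hm (g := fun _ => (0:ℝ))]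
    · simp
    · intro x hx
      simp only [show φ.toFun x 0 = 0 from hx, zero_mul]
  have a := φ.int_split (coord_Mc_int h 0 0)
  rw [f1, f2, f3, h1 _ wi wb w0, h2 _ wi wb w0, omega_int] at a
  refine ⟨c1, ?_⟩
  rw [degree, det_int_eq h, a]
  have : (c2:ℝ) = -c1 := by linarith
  rw [this]
  field_simp
  ring

end SkyrmeMap

end

section

/-- angle profile -/
def hF (A t : ℝ) : ℝ := A * Real.smoothTransition (t - 1)
def hC (A t : ℝ) : ℝ := Real.cos (hF A t)
def hS (A t : ℝ) : ℝ := Real.sin (hF A t) / √t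

theorem hF_contDiff (A : ℝ) : ContDiff ℝ (⊤ : ℕ∞) (hF A) := by
  unfold hF
  exact contDiff_const.mul (Real.smoothTransition.contDiff.comp (by fun_prop))
theorem hF_zero {A t : ℝ} (h : t ≤ 1) : hF A t = 0 := by
  rw [hF, Real.smoothTransition.zero_of_nonpos (by linarith), mul_zero]
theorem hF_one {A t : ℝ} (h : 2 ≤ t) : hF A t = A := by
  rw [hF, Real.smoothTransition.one_of_one_le (by linarith), mul_one]
theorem hC_contDiff (A : ℝ) : ContDiff ℝ (⊤ : ℕ∞) (hC A) := Real.contDiff_cos.comp (hF_contDiff A)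
theorem hS_zero {A t : ℝ} (h : t ≤ 1) : hS A t = 0 := by simp [hS, hF_zero h]
theorem hS_contDiff (A : ℝ) : ContDiff ℝ (⊤ : ℕ∞) (hS A) := by
  rw [contDiff_iff_contDiffAt]
  intro t
  by_cases ht : t < 1
  · have : hS A =ᶠ[𝓝 t] fun _ => 0 := by
      filter_upwards [gt_mem_nhds ht] with w hw
      exact hS_zero hw.le
    exact contDiffAt_const.congr_of_eventuallyEq this
  · have ht0 : t ≠ 0 := by linarith
    unfold hS
    refine ContDiffAt.div ((Real.contDiff_sin.comp (hF_contDiff A)).contDiffAt) (Real.contDiffAt_sqrt ht0) ?_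
    exact (Real.sqrt_pos.2 (by linarith)).ne'

theorem hF'_of {A t : ℝ} (h : t ≤ 1 ∨ 2 < t) : deriv (hF A) t = 0 := by
  have hc : Continuous (deriv (hF A)) := (hF_contDiff A).continuous_deriv (by simp)
  rcases h with h | h
  · have hE : ∀ s < 1, deriv (hF A) s = 0 := by
      intro s hs
      have : hF A =ᶠ[𝓝 s] fun _ => 0 := by
        filter_upwards [gt_mem_nhds hs] with w hw
        exact hF_zero hw.le
      rw [this.deriv_eq]; simp
    have : closure (Set.Iio (1:ℝ)) ⊆ {s | deriv (hF A) s = 0} :=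
      closure_minimal (fun s hs => hE s hs) (isClosed_eq hc continuous_const)
    rw [closure_Iio] at this
    exact this h
  · have : hF A =ᶠ[𝓝 t] fun _ => A := by
      filter_upwards [lt_mem_nhds h] with w hw
      exact hF_one hw.le
    rw [this.deriv_eq]; simp

theorem hC_deriv (A t : ℝ) : deriv (hC A) t = - Real.sin (hF A t) * deriv (hF A) t :=
  (((hF_contDiff A).differentiable (by simp) t).hasDerivAt.cos).deriv

theorem hS_deriv (A : ℝ) {t : ℝ} (ht : 0 < t) :
    hS A t + 2 * t * deriv (hS A) t = 2 * √t * Real.cos (hF A t) * deriv (hF A) t := by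
  have h1 := ((hF_contDiff A).differentiable (by simp) t).hasDerivAt.sin
  have h2 := h1.div (Real.hasDerivAt_sqrt ht.ne') (Real.sqrt_pos.2 ht).ne'
  have h3 : deriv (hS A) t = _ := h2.deriv
  have hs := Real.sq_sqrt ht.le
  have hp := Real.sqrt_pos.2 ht
  rw [h3, hS]
  generalize √t = r at *
  subst hs
  field_simp
  ring

/-- hedgehog -/
def hh (A : ℝ) (x : R3) : R4 := Fin.cons (hC A (q3 x)) (fun j => hS A (q3 x) * x j)
def hh' (A : ℝ) (i : Fin 3) (x : R3) : R4 :=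
  Fin.cons (2 * x i * deriv (hC A) (q3 x))
    (fun j => 2 * x i * deriv (hS A) (q3 x) * x j + hS A (q3 x) * (if i = j then 1 else 0))

theorem q3_contDiff : ContDiff ℝ (⊤ : ℕ∞) q3 := by unfold q3; fun_prop

theorem pd_q3 (i : Fin 3) (x : R3) : HasFDerivAt q3 (lin fun l => 2 * x l) x := by
  have h : ∀ l : Fin 3, HasFDerivAt (fun x : R3 => x l ^ 2) ((2 * x l) • (ContinuousLinearMap.proj l : R3 →L[ℝ] ℝ)) x := by
    intro l
    have := ((ContinuousLinearMap.proj l : R3 →L[ℝ] ℝ).hasFDerivAt (x := x)).pow 2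
    simpa using this
  have := HasFDerivAt.fun_sum (u := Finset.univ) fun l _ => h l
  exact this

theorem hh_contDiff (A : ℝ) (a : Fin 4) : ContDiff ℝ (⊤ : ℕ∞) (fun x => hh A x a) := by
  refine Fin.cases ?_ (fun j => ?_) a
  · exact (hC_contDiff A).comp q3_contDiff
  · show ContDiff ℝ _ fun x => hS A (q3 x) * x j
    exact ((hS_contDiff A).comp q3_contDiff).mul (by fun_prop)

theorem pd_hh (A : ℝ) (i : Fin 3) (a : Fin 4) (x : R3) : pd i (fun x => hh A x a) x = hh' A i x a := by
  have hq := pd_q3 i x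
  show fderiv ℝ (fun x => hh A x a) x _ = _
  refine Fin.cases ?_ (fun j => ?_) a
  · have h1 : HasFDerivAt (fun x => hh A x 0) _ x := ((hC_contDiff A).differentiable (by simp) (q3 x)).hasDerivAt.comp_hasFDerivAt x hq
    rw [h1.fderiv]
    simp [hh', lin_single]; ring
  · have h1 : HasFDerivAt (fun x => hS A (q3 x)) _ x := ((hS_contDiff A).differentiable (by simp) (q3 x)).hasDerivAt.comp_hasFDerivAt x hq
    have h2 : HasFDerivAt (fun x => hh A x j.succ) _ x := h1.mul ((ContinuousLinearMap.proj j : R3 →L[ℝ] ℝ).hasFDerivAt (x := x))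
    rw [h2.fderiv]
    simp [hh', lin_single, Pi.single_apply, eq_comm]; ring

theorem hh'_cont (A : ℝ) (i : Fin 3) (a : Fin 4) : Continuous fun x => hh' A i x a := by
  have : (fun x => hh' A i x a) = pd i (fun x => hh A x a) := by ext x; rw [pd_hh]
  rw [this]
  exact (contDiff_pd (hh_contDiff A a) i).continuous

theorem hh_sphere (A : ℝ) (x : R3) : nsq (hh A x) = 1 := by
  have : nsq (hh A x) = hC A (q3 x) ^ 2 + hS A (q3 x) ^ 2 * q3 x := by
    simp [nsq, dot, hh, Fin.sum_univ_succ, q3]; ring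
  rw [this]
  have h0 : 0 ≤ q3 x := Finset.sum_nonneg fun i _ => sq_nonneg _
  by_cases hq : q3 x ≤ 1
  · rw [hS_zero hq, hC, hF_zero hq]; simp
  · have hp : 0 < q3 x := by linarith
    rw [hS, div_pow, Real.sq_sqrt h0, div_mul_cancel₀ _ hp.ne', hC]
    exact Real.cos_sq_add_sin_sq _

def hedge (A : ℝ) : SkyrmeMap where
  toFun := hh A
  pderiv := hh' A
  meas := measurable_pi_iff.2 fun a => (hh_contDiff A a).continuous.measurable
  pderiv_locInt := fun i => (continuous_pi fun a => hh'_cont A i a).locallyIntegrable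
  sphere := Eventually.of_forall (hh_sphere A)
  weak := by
    intro i a ψ hψ
    have hu := hh_contDiff A a
    have := integral_mul_fderiv_eq_neg_fderiv_mul_of_integrable (μ := volume) (f := fun x => hh A x a) (g := ψ) (v := Pi.single i 1)
      ?_ ?_ ?_ (fun x _ => hu.differentiable (by simp) x) (fun x _ => hψ.1.differentiable (by simp) x)
    · simp_rw [mul_comm (fderiv ℝ ψ _ _)]
      rw [this]
      simp_rw [mul_comm (ψ _), ← pd_hh]
    · exact ((contDiff_pd hu i).continuous.mul hψ.1.continuous).integrable_of_hasCompactSupport hψ.2.mul_left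
    · exact (hu.continuous.mul (IsTestFun.pd hψ i).1.continuous).integrable_of_hasCompactSupport (IsTestFun.pd hψ i).2.mul_left
    · exact (hu.continuous.mul hψ.1.continuous).integrable_of_hasCompactSupport hψ.2.mul_left

end

section

theorem hS_one {A t : ℝ} (hA : Real.sin A = 0) (h : 2 ≤ t) : hS A t = 0 := by
  simp [hS, hF_one h, hA]

theorem hh'_zero {A : ℝ} (hA : Real.sin A = 0) (i : Fin 3) {x : R3} (h : 2 < q3 x) : hh' A i x = 0 := by
  have h1 : deriv (hS A) (q3 x) = 0 := by
    have : hS A =ᶠ[𝓝 (q3 x)] fun _ => 0 := by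
      filter_upwards [lt_mem_nhds h] with w hw
      exact hS_one hA hw.le
    rw [this.deriv_eq]; simp
  have h2 := hS_one hA h.le
  have h3 : deriv (hC A) (q3 x) = 0 := by rw [hC_deriv, hF'_of (Or.inr h), mul_zero]
  funext a
  refine Fin.cases ?_ (fun j => ?_) a
  · simp [hh', h3]
  · simp [hh', h1, h2]

theorem hedge_memX {A : ℝ} (hA : Real.sin A = 0) : memX (hedge A) := by
  have hc : ∀ i a, Continuous fun x => (hedge A).pderiv i x a := fun i a => hh'_cont A i a
  have hcont : Continuous (energyDensity (hedge A)) := by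
    unfold energyDensity gradSq ASq wedgeSq nsq dot
    have := hc
    fun_prop
  refine hcont.integrable_of_hasCompactSupport ?_
  refine HasCompactSupport.of_support_subset_isCompact (K := QR 2) (isCompact_closedBall _ _) ?_
  intro x hx
  by_contra hxK
  apply hx
  have hq : 2 < q3 x := by
    by_contra hq
    push Not at hq
    apply hxK
    simp only [QR, mem_closedBall_zero_iff]
    rw [pi_norm_le_iff_of_nonneg zero_le_two]
    intro i
    have : x i ^ 2 ≤ 2 :=
      (Finset.single_le_sum (f := fun i => x i ^ 2) (fun j _ => sq_nonneg _) (Finset.mem_univ i)).trans hq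
    rw [Real.norm_eq_abs]
    exact abs_le_of_sq_le_sq (by linarith) (by norm_num)
  have : ∀ i, (hedge A).pderiv i x = 0 := fun i => hh'_zero hA i hq
  simp [energyDensity, gradSq, ASq, wedgeSq, nsq, dot, this]

theorem hedge_det (A : ℝ) (x : R3) :
    detDen (hedge A) x = 2 * Real.sin (hF A (q3 x)) ^ 2 * deriv (hF A) (q3 x) / √(q3 x) := by
  have e : detDen (hedge A) x = hS A (q3 x) ^ 2 * (hC A (q3 x) * (hS A (q3 x) + 2 * q3 x * deriv (hS A) (q3 x))
      - 2 * deriv (hC A) (q3 x) * hS A (q3 x) * q3 x) := by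
    rw [SkyrmeMap.detDen_eq]
    simp [SkyrmeMap.Mc, SkyrmeMap.MM, m3, cr, SkyrmeMap.gr, Fin.sum_univ_four, Fin.sum_univ_three, hedge]
    have t0 : ∀ (c : ℝ) (f : Fin 3 → ℝ), (Fin.cons c f : R4) 0 = c := fun _ _ => rfl
    have t1 : ∀ (c : ℝ) (f : Fin 3 → ℝ), (Fin.cons c f : R4) 1 = f 0 := fun _ _ => rfl
    have t2 : ∀ (c : ℝ) (f : Fin 3 → ℝ), (Fin.cons c f : R4) 2 = f 1 := fun _ _ => rfl
    have t3 : ∀ (c : ℝ) (f : Fin 3 → ℝ), (Fin.cons c f : R4) 3 = f 2 := fun _ _ => rfl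
    simp only [hh, hh', t0, t1, t2, t3]
    generalize hS A (q3 x) = s
    generalize hC A (q3 x) = c
    generalize deriv (hS A) (q3 x) = s'
    generalize deriv (hC A) (q3 x) = c'
    simp [q3, Fin.sum_univ_three]
    ring
  by_cases hq : q3 x ≤ 1
  · rw [e, hS_zero hq, hF_zero hq]; simp
  · have hp : 0 < q3 x := by linarith
    rw [e, hS_deriv A hp, hC_deriv, hS, hC]
    have hr := Real.sqrt_pos.2 hp
    have hs := Real.sq_sqrt hp.le
    have := Real.sin_sq_add_cos_sq (hF A (q3 x))
    generalize √(q3 x) = r at *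
    generalize deriv (hF A) (q3 x) = f'
    generalize Real.sin (hF A (q3 x)) = S at *
    generalize Real.cos (hF A (q3 x)) = C at *
    rw [← hs]
    field_simp
    linear_combination (S^2*f') * this

theorem hedge_degree (k : ℤ) : degree (hedge (k * π)) = k := by
  set A : ℝ := k * π with hA
  let H : ℝ → ℝ := fun r => (hF A (r ^ 2) / 2 - Real.sin (2 * hF A (r ^ 2)) / 4) - A / 2
  have hs2 : Real.sin (2 * A) = 0 := by
    rw [hA, ← mul_assoc, show (2:ℝ) * k = ((2 * k : ℤ) : ℝ) by push_cast; ring]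
    exact Real.sin_int_mul_pi _
  have hHd : ContDiff ℝ (⊤ : ℕ∞) H := by
    have h1 : ContDiff ℝ (⊤ : ℕ∞) fun r : ℝ => hF A (r ^ 2) := (hF_contDiff A).comp (by fun_prop)
    exact ((h1.div_const 2).sub ((Real.contDiff_sin.comp (contDiff_const.mul h1)).div_const 4)).sub contDiff_const
  have hHs : HasCompactSupport H := by
    refine HasCompactSupport.of_support_subset_isCompact (K := Set.Icc (-2) 2) isCompact_Icc ?_
    intro r hr
    by_contra hc
    apply hr
    have : 2 ≤ r ^ 2 := by
      rw [Set.mem_Icc, not_and_or] at hc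
      rcases hc with h | h <;> nlinarith
    simp [H, hF_one this, hs2]
  have hH' : ∀ r, deriv H r = Real.sin (hF A (r ^ 2)) ^ 2 * (deriv (hF A) (r ^ 2) * (2 * r)) := by
    intro r
    have h0 : HasDerivAt (fun r : ℝ => r ^ 2) (2 * r) r := by simpa using hasDerivAt_pow 2 r
    have h1 : HasDerivAt (fun r : ℝ => hF A (r ^ 2)) (deriv (hF A) (r ^ 2) * (2 * r)) r :=
      HasDerivAt.comp (h₂ := hF A) (h := fun r : ℝ => r ^ 2) r ((hF_contDiff A).differentiable (by simp) (r ^ 2)).hasDerivAt h0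
    have h2 : HasDerivAt H _ r := ((h1.div_const 2).sub ((h1.const_mul 2).sin.div_const 4)).sub_const (A / 2)
    rw [h2.deriv, Real.cos_two_mul]
    have := Real.sin_sq_add_cos_sq (hF A (r ^ 2))
    linear_combination (-(deriv (hF A) (r ^ 2) * (2 * r))) * this
  have hI := HasCompactSupport.integral_Ioi_deriv_eq (hHd.of_le (by simp)) hHs 0
  have hH0 : H 0 = -(A/2) := by simp [H, hF_zero]
  rw [hH0] at hI
  have hqi3 := int_q3 (fun y => 2 * Real.sin (hF A (y ^ 2)) ^ 2 * deriv (hF A) (y ^ 2) / y)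
  have e : ∀ z : R3, √(q3 z) ^ 2 = q3 z := fun z =>
    Real.sq_sqrt (Finset.sum_nonneg fun i _ => sq_nonneg _)
  simp only [e] at hqi3
  rw [degree]
  simp_rw [hedge_det]
  rw [hqi3]
  have e2 : ∫ y in Set.Ioi (0:ℝ), y ^ 2 * (2 * Real.sin (hF A (y ^ 2)) ^ 2 * deriv (hF A) (y ^ 2) / y)
      = ∫ y in Set.Ioi (0:ℝ), deriv H y := by
    refine setIntegral_congr_fun measurableSet_Ioi fun y hy => ?_
    have : y ≠ 0 := ne_of_gt hy
    simp only [hH']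
    field_simp
  rw [e2, hI, hA]
  field_simp
  ring

theorem class_nonempty (k : ℤ) : ∃ φ : SkyrmeMap, memX φ ∧ degree φ = (k : ℝ) :=
  ⟨hedge (k * π), hedge_memX (Real.sin_int_mul_pi k), hedge_degree k⟩

end

section

theorem setInt_shift (f : R3 → ℝ) (R : ℝ) (q : R3) :
    ∫ x in QR R, f (x + q) = ∫ x in Metric.closedBall q R, f x := by
  have h := (measurePreserving_add_right (volume : Measure R3) q).setIntegral_preimage_emb
    (measurableEmbedding_addRight q) f (Metric.closedBall q R)
  rw [← h]
  congr 2
  ext x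
  simp [QR, dist_eq_norm]

theorem sum_cubes_le {ι : Type*} {f : R3 → ℝ} (hf : Integrable f volume) (h0 : ∀ x, 0 ≤ f x) (S : Finset ι)
    (q : ι → R3) {R : ℝ} (hq : ∀ s ∈ S, ∀ t ∈ S, s ≠ t → 2 * R < ‖q s - q t‖) :
    ∑ s ∈ S, ∫ x in QR R, f (x + q s) ≤ ∫ x, f x := by
  simp_rw [setInt_shift]
  rw [← integral_biUnion_finset S (fun s _ => Metric.isClosed_closedBall.measurableSet)
    (fun s hs t ht hst => Metric.closedBall_disjoint_closedBall
      (by rw [dist_eq_norm]; linarith [hq s hs t ht hst])) (fun s _ => hf.integrableOn)]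
  exact setIntegral_le_integral hf (Eventually.of_forall h0)

theorem bad_cover {f : R3 → ℝ} (hf : Integrable f volume) (h0 : ∀ x, 0 ≤ f x) {ε E0 : ℝ} (hE : ∫ x, f x ≤ E0)
    (hε : 0 < ε) {N : ℕ} (hN : E0 < N * ε) :
    ∃ p : Fin N → R3, ∀ y, (ε < ∫ x in QR 2, f (x + y)) → ∃ i, ‖y - p i‖ ≤ 4 := by
  classical
  let P : Finset R3 → Prop := fun s => (∀ y ∈ s, ε < ∫ x in QR 2, f (x + y)) ∧
    ∀ a ∈ s, ∀ b ∈ s, a ≠ b → 4 < ‖a - b‖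
  have hc : ∀ s, P s → s.card < N := by
    intro s hs
    have h1 := sum_cubes_le hf h0 s id (R := 2) (fun a ha b hb hab => by
      have := hs.2 a ha b hb hab; simp only [id]; linarith)
    have h2 : (s.card : ℝ) * ε ≤ ∑ y ∈ s, ∫ x in QR 2, f (x + id y) := by
      rw [← nsmul_eq_mul]
      exact Finset.card_nsmul_le_sum _ _ _ (fun y hy => (hs.1 y hy).le)
    have h3 : (s.card : ℝ) * ε < N * ε := by linarith
    exact_mod_cast lt_of_mul_lt_mul_right h3 hε.le
  obtain ⟨m, ⟨s, hs, rfl⟩, hm⟩ : ∃ m, (∃ s, P s ∧ s.card = m) ∧ ∀ s, P s → s.card ≤ m := by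
    have hne : ∃ m, ∃ s, P s ∧ s.card = m := ⟨0, ∅, ⟨by simp, by simp⟩, rfl⟩
    obtain ⟨m0, h0⟩ := hne
    have hb : ∀ m, (∃ s, P s ∧ s.card = m) → m ≤ N := by
      rintro m ⟨s, hs, rfl⟩; exact (hc s hs).le
    refine ⟨Nat.findGreatest (fun m => ∃ s, P s ∧ s.card = m) N, ?_, fun s hs => ?_⟩
    · exact Nat.findGreatest_spec (P := fun m => ∃ s, P s ∧ s.card = m) (hb _ h0) h0
    · exact Nat.le_findGreatest (hc s hs).le ⟨s, hs, rfl⟩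
  refine ⟨fun i => s.toList.getD i 0, fun y hy => ?_⟩
  have key : ∃ a ∈ s, ‖y - a‖ ≤ 4 := by
    by_contra! hcon
    have hys : y ∉ s := fun h => by have := hcon y h; simp at this; linarith
    have hP : P (insert y s) := by
      refine ⟨fun z hz => ?_, fun a ha b hb hab => ?_⟩
      · rcases Finset.mem_insert.1 hz with rfl | hz
        · exact hy
        · exact hs.1 z hz
      · rcases Finset.mem_insert.1 ha with ha' | ha' <;> rcases Finset.mem_insert.1 hb with hb' | hb'
        · exact absurd (ha'.trans hb'.symm) hab
        · rw [ha']; exact hcon b hb'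
        · rw [norm_sub_rev, hb']; exact hcon a ha'
        · exact hs.2 a ha' b hb' hab
    have := hm _ hP
    rw [Finset.card_insert_of_notMem hys] at this
    omega
  obtain ⟨a, ha, hya⟩ := key
  obtain ⟨i, hi, hia⟩ := List.mem_iff_getElem.1 (Finset.mem_toList.2 ha)
  have hiN : i < N := by
    have := hc s hs
    rw [Finset.length_toList] at hi; omega
  refine ⟨⟨i, hiN⟩, ?_⟩
  simp only
  rw [List.getD_eq_getElem _ _ hi, hia]
  exact hya

theorem clusters (U : Ultrafilter ℕ) {N : ℕ} (p : ℕ → Fin N → R3) :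
    ∃ (S : Finset (Fin N)) (M : ℝ), 0 ≤ M ∧
      (∀ s ∈ S, ∀ t ∈ S, s ≠ t → ∀ L : ℝ, ∀ᶠ n in (U : Filter ℕ), L < ‖p n s - p n t‖) ∧
      ∀ᶠ n in (U : Filter ℕ), ∀ i, ∃ s ∈ S, ‖p n i - p n s‖ ≤ M := by
  classical
  let rel : Setoid (Fin N) :=
    { r := fun i j => ∃ M : ℝ, ∀ᶠ n in (U : Filter ℕ), ‖p n i - p n j‖ ≤ M
      iseqv := ⟨fun i => ⟨0, Eventually.of_forall fun n => by simp⟩,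
        fun {i j} ⟨M, h⟩ => ⟨M, h.mono fun n hn => by rw [norm_sub_rev]; exact hn⟩,
        fun {i j l} ⟨M, h⟩ ⟨M', h'⟩ => ⟨M + M', by
          filter_upwards [h, h'] with n hn hn'
          calc ‖p n i - p n l‖ = ‖(p n i - p n j) + (p n j - p n l)‖ := by congr 1; abel
            _ ≤ _ := (norm_add_le _ _).trans (add_le_add hn hn')⟩⟩ }
  let r : Fin N → Fin N := fun i => (Quotient.mk rel i).out
  have hr : ∀ i, rel (r i) i := fun i => Quotient.exact (Quotient.out_eq (Quotient.mk rel i))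
  choose M hM using hr
  refine ⟨Finset.univ.image r, ∑ i, |M i|, Finset.sum_nonneg fun i _ => abs_nonneg _, ?_, ?_⟩
  · intro s hs t ht hst L
    obtain ⟨i, -, rfl⟩ := Finset.mem_image.1 hs
    obtain ⟨j, -, rfl⟩ := Finset.mem_image.1 ht
    by_contra hcon
    rw [← Ultrafilter.eventually_not] at hcon
    have h1 : rel (r i) (r j) := ⟨L, hcon.mono fun n hn => not_lt.1 hn⟩
    have h2 : rel i j := rel.trans (rel.symm ⟨M i, hM i⟩) (rel.trans h1 ⟨M j, hM j⟩)
    exact hst (by simp only [r]; rw [Quotient.sound h2])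
  · have h3 := (eventually_all (l := (U : Filter ℕ))).2 hM
    filter_upwards [h3] with n hn i
    refine ⟨r i, Finset.mem_image_of_mem _ (Finset.mem_univ _), ?_⟩
    rw [norm_sub_rev]
    exact (hn i).trans ((le_abs_self _).trans
      (Finset.single_le_sum (f := fun i => |M i|) (fun i _ => abs_nonneg _) (Finset.mem_univ i)))

end

section

/-- sum of cutoffs around the points q s -/
def cs {ι : Type*} (S : Finset ι) (q : ι → R3) (R : ℝ) (x : R3) : ℝ := ∑ s ∈ S, cut R (x + -q s)

theorem cs_nonneg {ι : Type*} (S : Finset ι) (q : ι → R3) (R : ℝ) (x : R3) : 0 ≤ cs S q R x :=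
  Finset.sum_nonneg fun _ _ => cut_nonneg _ _

theorem cs_le_one {ι : Type*} (S : Finset ι) (q : ι → R3) {R : ℝ} (hR : 0 < R)
    (hq : ∀ s ∈ S, ∀ t ∈ S, s ≠ t → 4 * R < ‖q s - q t‖) (x : R3) : cs S q R x ≤ 1 := by
  classical
  unfold cs
  by_cases h : ∃ s ∈ S, ‖x + -q s‖ < 2 * R
  · obtain ⟨s, hs, hx⟩ := h
    rw [Finset.sum_eq_single_of_mem s hs]
    · exact cut_le_one _ _
    · intro t ht hts
      apply cut_zero hR
      have h1 := hq s hs t ht hts.symm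
      have h2 : ‖q s - q t‖ ≤ ‖x + -q s‖ + ‖x + -q t‖ := by
        calc ‖q s - q t‖ = ‖(x + -q t) - (x + -q s)‖ := by congr 1; abel
          _ ≤ ‖x + -q t‖ + ‖x + -q s‖ := norm_sub_le _ _
          _ = _ := add_comm _ _
      linarith
  · push Not at h
    rw [Finset.sum_eq_zero fun s hs => cut_zero hR (h s hs)]
    norm_num

theorem cs_smooth {ι : Type*} (S : Finset ι) (q : ι → R3) (R : ℝ) : ContDiff ℝ (⊤ : ℕ∞) (cs S q R) := by
  unfold cs
  exact ContDiff.sum fun s _ => (cut_contDiff R).comp (contDiff_id.add contDiff_const)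

theorem cs_pd {ι : Type*} (S : Finset ι) (q : ι → R3) (R : ℝ) (i : Fin 3) (x : R3) :
    pd i (fun x => 1 - cs S q R x) x = - ∑ s ∈ S, pd i (cut R) (x + -q s) := by
  have hd : ∀ s, DifferentiableAt ℝ (fun x => cut R (x + -q s)) x := fun s =>
    (((cut_contDiff R).comp (contDiff_id.add contDiff_const)).differentiable (by simp)) x
  have h1 : fderiv ℝ (fun x => 1 - cs S q R x) x = - ∑ s ∈ S, fderiv ℝ (fun x => cut R (x + -q s)) x := by
    rw [fderiv_const_sub]
    unfold cs
    rw [fderiv_fun_sum fun s _ => hd s]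
  unfold pd
  rw [h1]
  simp only [_root_.neg_apply, sum_apply]
  congr 1
  exact Finset.sum_congr rfl fun s _ => pd_shift (cut R) (-q s) x i

theorem cs_det {ι : Type*} {φ : SkyrmeMap} (h : memX φ) (S : Finset ι) (q : ι → R3) {R : ℝ} (hR : 0 < R) :
    ∫ x, (1 - cs S q R x) * detDen φ x =
      (∫ x, detDen φ x) - ∑ s ∈ S, ∫ x, cut R x * detDen (φ.tr (q s)) x := by
  have hD := SkyrmeMap.det_int h
  have hi : ∀ s, Integrable (fun x => cut R (x + -q s) * detDen φ x) volume := fun s =>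
    mul_test_int ((cut_test hR).shift _) hD
  have h1 : (fun x => (1 - cs S q R x) * detDen φ x) =
      fun x => detDen φ x - ∑ s ∈ S, cut R (x + -q s) * detDen φ x := by
    funext x; unfold cs; rw [sub_mul, one_mul, Finset.sum_mul]
  rw [h1, integral_sub hD (integrable_finsetSum _ fun s _ => hi s), integral_finsetSum _ fun s _ => hi s]
  congr 1
  refine Finset.sum_congr rfl fun s _ => ?_
  rw [← integral_add_right_eq_self _ (q s)]
  refine integral_congr_ae (Eventually.of_forall fun x => ?_)
  simp [SkyrmeMap.tr_D]

theorem tr_energy (φ : SkyrmeMap) (p : R3) : energy (φ.tr p) = energy φ := by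
  unfold energy
  simp_rw [SkyrmeMap.tr_e]
  exact integral_add_right_eq_self (energyDensity φ) p

theorem e_QR_tendsto {φ : SkyrmeMap} (h : memX φ) :
    Tendsto (fun n : ℕ => ∫ x in QR n, energyDensity φ x) atTop (𝓝 (energy φ)) := by
  have h1 := tendsto_setIntegral_of_monotone (μ := (volume : Measure R3)) (f := energyDensity φ)
    (s := fun n : ℕ => QR (n : ℝ))
    (fun n => Metric.isClosed_closedBall.measurableSet)
    (fun m n hmn => Metric.closedBall_subset_closedBall (by exact_mod_cast hmn)) h.integrableOn
  have h2 : (⋃ n : ℕ, QR (n : ℝ)) = Set.univ := Metric.iUnion_closedBall_nat 0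
  rw [h2, setIntegral_univ] at h1
  exact h1

end

section

theorem decompose (k : ℤ) (φ : ℕ → SkyrmeMap) (hX : ∀ n, memX (φ n)) (hd : ∀ n, degree (φ n) = (k : ℝ)) {I E0 : ℝ}
    (hE : ∀ n, energy (φ n) ≤ E0) (hI : Tendsto (fun n => energy (φ n)) atTop (𝓝 I)) :
    ∃ (N : ℕ) (S : Finset (Fin N)) (ψ : Fin N → SkyrmeMap), (∀ s, memX (ψ s)) ∧
      |(k : ℝ) - ∑ s ∈ S, degree (ψ s)| ≤ 1 / 2 ∧ ∑ s ∈ S, energy (ψ s) ≤ I := by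
  have hE0 : 0 ≤ E0 := le_trans (integral_nonneg (SkyrmeMap.e_nonneg (φ 0))) (hE 0)
  obtain ⟨κ, hκ, hκE⟩ : ∃ κ : ℝ, 0 < κ ∧ κ * (64 * E0) ≤ π ^ 2 := by
    refine ⟨π ^ 2 / (64 * E0 + 1), by positivity, ?_⟩
    rw [div_mul_eq_mul_div, div_le_iff₀ (by positivity)]
    nlinarith [sq_nonneg π]
  obtain ⟨ε, hε, hv⟩ := vanish hκ zero_le_one
  obtain ⟨N, hN⟩ := exists_nat_gt (E0 / ε)
  rw [div_lt_iff₀ hε] at hN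
  have hcov := fun n => bad_cover (hX n) (SkyrmeMap.e_nonneg (φ n)) (hE n) hε hN
  choose p hp using hcov
  let U : Ultrafilter ℕ := hyperfilter ℕ
  have hU : (U : Filter ℕ) ≤ atTop := Nat.hyperfilter_le_atTop
  obtain ⟨S, M, hM0, hsep, hclu⟩ := clusters U p
  have htE : ∀ s n, energy ((φ n).tr (p n s)) ≤ E0 := fun s n => by rw [tr_energy]; exact hE n
  have htX : ∀ s n, memX ((φ n).tr (p n s)) := fun s n => SkyrmeMap.tr_memX (hX n) _
  have hcpt := fun s => compactness U (fun n => (φ n).tr (p n s)) (htX s) (htE s)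
  choose ψ hψX hψ using hcpt
  have hsep' : ∀ L : ℝ, ∀ᶠ n in (U : Filter ℕ), ∀ s ∈ S, ∀ t ∈ S, s ≠ t → L < ‖p n s - p n t‖ := by
    intro L
    rw [eventually_all_finset]
    intro s hs
    rw [eventually_all_finset]
    intro t ht
    by_cases hst : s = t
    · exact Eventually.of_forall fun n h => absurd hst h
    · exact (hsep s hs t ht hst L).mono fun n h _ => h
  refine ⟨N, S, ψ, hψX, ?_, ?_⟩
  · have hdet : ∀ n, ∫ x, detDen (φ n) x = 2 * π ^ 2 * k := fun n => by
      have h1 := hd n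
      unfold degree at h1
      have : (π : ℝ) ≠ 0 := pi_ne_zero
      field_simp at h1
      linarith
    obtain ⟨C, hC, hcut⟩ := pd_cut_bdd
    have hR : ∀ R : ℝ, 1 ≤ R → N * C ≤ R → 5 + M ≤ R →
        |2 * π ^ 2 * k - ∑ s ∈ S, ∫ x, cut R x * detDen (ψ s) x| ≤ π ^ 2 := by
      intro R hR1 hRC hRM
      have hR0 : 0 < R := by linarith
      have hlim : Tendsto (fun n => |2 * π ^ 2 * k - ∑ s ∈ S, ∫ x, cut R x * detDen ((φ n).tr (p n s)) x|)
          (U : Filter ℕ) (𝓝 |2 * π ^ 2 * k - ∑ s ∈ S, ∫ x, cut R x * detDen (ψ s) x|) := by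
        refine (tendsto_const_nhds.sub (tendsto_finsetSum _ fun s _ => ?_)).abs
        exact (hψ s).det_tendsto (htX s) (hψX s) (htE s) (cut_test hR0)
      refine le_of_tendsto hlim ?_
      filter_upwards [hclu, hsep' (4 * R)] with n hn hn'
      have hle := cs_le_one S (p n) hR0 hn'
      have hnn := cs_nonneg S (p n) R
      have h1 := hv (φ n) (hX n) (fun x => 1 - cs S (p n) R x) (contDiff_const.sub (cs_smooth _ _ _))
        (fun x => by rw [abs_le]; constructor <;> linarith [hle x, hnn x])
        (fun i x => by
          rw [cs_pd, abs_neg]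
          calc |∑ s ∈ S, pd i (cut R) (x + -p n s)| ≤ ∑ s ∈ S, |pd i (cut R) (x + -p n s)| :=
                Finset.abs_sum_le_sum_abs _ _
            _ ≤ ∑ s ∈ S, C / R := Finset.sum_le_sum fun s _ => hcut R hR0 i _
            _ = S.card * (C / R) := by rw [Finset.sum_const, nsmul_eq_mul]
            _ ≤ N * (C / R) := by
                gcongr
                exact_mod_cast (Finset.card_le_univ S).trans (by simp)
            _ ≤ 1 := by
                rw [← mul_div_assoc, div_le_one hR0]; exact hRC)
        (fun y hy x hx => by
          obtain ⟨i, hi⟩ := hp n y hy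
          obtain ⟨s, hs, his⟩ := hn i
          have hx1 : ‖x‖ ≤ 1 := by simpa [QR] using hx
          have hnrm : ‖x + y + -p n s‖ ≤ R := by
            calc ‖x + y + -p n s‖ = ‖x + (y - p n i) + (p n i - p n s)‖ := by congr 1; abel
              _ ≤ ‖x‖ + ‖y - p n i‖ + ‖p n i - p n s‖ := norm_add₃_le
              _ ≤ R := by linarith
          have h2 : (1 : ℝ) ≤ cs S (p n) R (x + y) := by
            rw [← cut_one hR0 hnrm]
            exact Finset.single_le_sum (f := fun s => cut R (x + y + -p n s))
              (fun t _ => cut_nonneg _ _) hs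
          linarith [hle (x + y)])
      rw [cs_det (hX n) S (p n) hR0, hdet n] at h1
      refine h1.trans (le_trans ?_ hκE)
      have := hE n
      gcongr
    have hlim2 : Tendsto (fun m : ℕ => |2 * π ^ 2 * k - ∑ s ∈ S, ∫ x, cut ((m : ℝ) + 1) x * detDen (ψ s) x|)
        atTop (𝓝 |2 * π ^ 2 * k - ∑ s ∈ S, ∫ x, detDen (ψ s) x|) :=
      (tendsto_const_nhds.sub (tendsto_finsetSum _ fun s _ => cut_tendsto (SkyrmeMap.det_int (hψX s)))).abs
    have h2 : |2 * π ^ 2 * k - ∑ s ∈ S, ∫ x, detDen (ψ s) x| ≤ π ^ 2 := by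
      refine le_of_tendsto hlim2 ?_
      have hn1 := tendsto_natCast_atTop_atTop (R := ℝ)
      filter_upwards [hn1.eventually_ge_atTop (N * C), hn1.eventually_ge_atTop (5 + M)] with m h1 h2
      have : (0 : ℝ) ≤ m := Nat.cast_nonneg m
      exact hR _ (by linarith) (by linarith) (by linarith)
    have h3 : (k : ℝ) - ∑ s ∈ S, degree (ψ s) =
        (1 / (2 * π ^ 2)) * (2 * π ^ 2 * k - ∑ s ∈ S, ∫ x, detDen (ψ s) x) := by
      unfold degree
      rw [← Finset.mul_sum]
      have : (π : ℝ) ≠ 0 := pi_ne_zero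
      field_simp
    rw [h3, abs_mul, abs_of_nonneg (by positivity)]
    calc 1 / (2 * π ^ 2) * |2 * π ^ 2 * k - ∑ s ∈ S, ∫ x, detDen (ψ s) x| ≤ 1 / (2 * π ^ 2) * π ^ 2 := by gcongr
      _ = 1 / 2 := by
        have : (π : ℝ) ≠ 0 := pi_ne_zero
        field_simp
  · refine le_of_tendsto (tendsto_finsetSum _ fun s _ => e_QR_tendsto (hψX s))
      (Eventually.of_forall fun m => ?_)
    refine le_of_forall_pos_le_add fun η hη => ?_
    obtain ⟨δ, hδ, hδη⟩ : ∃ δ : ℝ, 0 < δ ∧ (S.card : ℝ) * δ + δ ≤ η := by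
      refine ⟨η / ((S.card : ℝ) + 1), by positivity, le_of_eq ?_⟩
      field_simp
    have h1 : ∀ s ∈ S, ∀ᶠ n in (U : Filter ℕ), (∫ x in QR (m : ℝ), energyDensity (ψ s) x) - δ <
        ∫ x in QR (m : ℝ), energyDensity (φ n) (x + p n s) := by
      intro s _
      by_contra hcon
      rw [← Ultrafilter.eventually_not] at hcon
      have := (hψ s).lsc (htX s) (hψX s) (S := QR (m : ℝ)) Metric.isClosed_closedBall.measurableSet
        (hcon.mono fun n hn => not_lt.1 hn)
      linarith
    have h2 : ∀ᶠ n in (U : Filter ℕ), energy (φ n) < I + δ := hU (hI.eventually_lt_const (by linarith))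
    obtain ⟨n, hn1, hn2, hn3⟩ := (((eventually_all_finset S).2 h1).and (h2.and (hsep' (2 * m)))).exists
    have h4 := sum_cubes_le (hX n) (SkyrmeMap.e_nonneg (φ n)) S (p n) hn3
    have h5 : ∑ s ∈ S, ((∫ x in QR (m : ℝ), energyDensity (ψ s) x) - δ) ≤
        ∑ s ∈ S, ∫ x in QR (m : ℝ), energyDensity (φ n) (x + p n s) :=
      Finset.sum_le_sum fun s hs => (hn1 s hs).le
    rw [Finset.sum_sub_distrib, Finset.sum_const, nsmul_eq_mul] at h5
    unfold energy at hn2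
    linarith

theorem I_le {k : ℤ} {φ : SkyrmeMap} (h : memX φ) (hd : degree φ = (k : ℝ)) : Skyrme.I k ≤ energy φ := by
  refine csInf_le ⟨0, ?_⟩ ⟨φ, h, hd, rfl⟩
  rintro E ⟨φ, -, -, rfl⟩
  exact integral_nonneg (SkyrmeMap.e_nonneg φ)

theorem min_seq (k : ℤ) : ∃ φ : ℕ → SkyrmeMap, (∀ n, memX (φ n)) ∧ (∀ n, degree (φ n) = (k : ℝ)) ∧
    (∀ n, energy (φ n) ≤ Skyrme.I k + 1) ∧ Tendsto (fun n => energy (φ n)) atTop (𝓝 (Skyrme.I k)) := by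
  have h : ∀ n : ℕ, ∃ φ : SkyrmeMap, memX φ ∧ degree φ = (k : ℝ) ∧ energy φ < Skyrme.I k + 1 / ((n : ℝ) + 1) := by
    intro n
    obtain ⟨φ0, h0, hd0⟩ := class_nonempty k
    obtain ⟨E, ⟨φ, h1, h2, rfl⟩, h3⟩ := exists_lt_of_csInf_lt
      (s := {E : ℝ | ∃ φ : SkyrmeMap, memX φ ∧ degree φ = (k : ℝ) ∧ energy φ = E}) ⟨_, φ0, h0, hd0, rfl⟩
      (b := Skyrme.I k + 1 / ((n : ℝ) + 1)) (lt_add_of_pos_right _ (by positivity))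
    exact ⟨φ, h1, h2, h3⟩
  choose φ h1 h2 h3 using h
  refine ⟨φ, h1, h2, fun n => (h3 n).le.trans ?_, ?_⟩
  · gcongr
    rw [div_le_one (by positivity)]
    have : (0 : ℝ) ≤ n := Nat.cast_nonneg n
    linarith
  · have hl : Tendsto (fun n : ℕ => Skyrme.I k + 1 / ((n : ℝ) + 1)) atTop (𝓝 (Skyrme.I k)) := by
      simpa using tendsto_const_nhds.add (tendsto_one_div_add_atTop_nhds_zero_nat (𝕜 := ℝ))
    exact tendsto_of_tendsto_of_tendsto_of_le_of_le tendsto_const_nhds hl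
      (fun n => I_le (h1 n) (h2 n)) (fun n => (h3 n).le)

end

/-- If for every finite decomposition k = d₁ + ⋯ + d_J (J ≥ 2) into nonzero
integers one has the strict inequality I_k < Σ I_{dᵢ}, then I_k is achieved. -/
theorem skyrme_existence (k : ℤ) (hk : k ≠ 0)
    (h : ∀ (J : ℕ), 2 ≤ J → ∀ d : Fin J → ℤ, (∀ i, d i ≠ 0) → (∑ i, d i) = k →
      Skyrme.I k < ∑ i, Skyrme.I (d i)) :
    ∃ φ : SkyrmeMap, memX φ ∧ degree φ = (k : ℝ) ∧ energy φ = Skyrme.I k := by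
  classical
  obtain ⟨φ, hX, hd, hE, hI⟩ := min_seq k
  obtain ⟨N, S, ψ, hψ, hdeg, hen⟩ := decompose k φ hX hd hE hI
  choose d hdψ using fun s => SkyrmeMap.degree_int (hψ s)
  have hsum : ∑ s ∈ S, d s = k := by
    simp_rw [hdψ] at hdeg
    have h1 : |((k - ∑ s ∈ S, d s : ℤ) : ℝ)| < 1 := by push_cast; linarith
    have h2 : |k - ∑ s ∈ S, d s| < 1 := by exact_mod_cast h1
    rw [Int.abs_lt_one_iff] at h2
    omega
  have hsum' : ∑ s ∈ S.filter (fun s => d s ≠ 0), d s = k := by rw [Finset.sum_filter_ne_zero, hsum]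
  have hen0 : ∀ s, 0 ≤ energy (ψ s) := fun s => integral_nonneg (SkyrmeMap.e_nonneg (ψ s))
  have hen' : ∑ s ∈ S.filter (fun s => d s ≠ 0), energy (ψ s) ≤ Skyrme.I k :=
    (Finset.sum_le_sum_of_subset_of_nonneg (Finset.filter_subset _ _) fun s _ _ => hen0 s).trans hen
  have hne : ∀ s ∈ S.filter (fun s => d s ≠ 0), d s ≠ 0 := fun s hs => (Finset.mem_filter.1 hs).2
  generalize S.filter (fun s => d s ≠ 0) = T at hsum' hen' hne
  have hT0 : T.card ≠ 0 := by
    intro h0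
    rw [Finset.card_eq_zero] at h0
    rw [h0, Finset.sum_empty] at hsum'
    exact hk hsum'.symm
  by_cases h2 : 2 ≤ T.card
  · exfalso
    have h3 := h T.card h2 (fun i => d (T.equivFin.symm i)) (fun i => hne _ (T.equivFin.symm i).2) (by
      rw [← hsum', ← Finset.sum_coe_sort T]
      exact Equiv.sum_comp T.equivFin.symm (fun s : T => d s))
    have h4 : ∑ i, Skyrme.I (d (T.equivFin.symm i)) = ∑ s ∈ T, Skyrme.I (d s) := by
      rw [← Finset.sum_coe_sort T]
      exact Equiv.sum_comp T.equivFin.symm (fun s : T => Skyrme.I (d s))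
    have h5 : ∑ s ∈ T, Skyrme.I (d s) ≤ ∑ s ∈ T, energy (ψ s) :=
      Finset.sum_le_sum fun s _ => I_le (hψ s) (hdψ s)
    linarith
  · obtain ⟨s, rfl⟩ := Finset.card_eq_one.1 (show T.card = 1 by omega)
    rw [Finset.sum_singleton] at hsum' hen'
    have hds : degree (ψ s) = (k : ℝ) := by rw [hdψ, hsum']
    exact ⟨ψ s, hψ s, hds, le_antisymm hen' (I_le (hψ s) hds)⟩
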